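/- Assume the Riemann hypothesis. Then for every real x ≥ 4, there exists a prime number p with x ≤ p ≤ x + (22/25)·√x·log x. -/

import Mathlib

open MeasureTheory Filter
open scoped FourierTransform Real

/-- The class 𝒜 sharp constant 𝒞(A). -/
noncomputable def Ccal (A : ℝ) : ℝ :=
  sSup { r : ℝ | ∃ F : ℝ → ℂ, Continuous F ∧ Integrable F ∧ F ≠ 0 ∧
    r = (‖F 0‖ - A * ∫ t in {t : ℝ | 1 ≤ |t|}, ‖𝓕 F t‖) / ∫ x : ℝ, ‖F x‖ }

/-- 𝒞(∞), over the bandlimited class ℰ. -/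
noncomputable def CcalInf : ℝ :=
  sSup { r : ℝ | ∃ F : ℝ → ℂ, Continuous F ∧ Integrable F ∧ F ≠ 0 ∧
    Function.support (𝓕 F) ⊆ Set.Icc (-1 : ℝ) 1 ∧
    r = ‖F 0‖ / ∫ x : ℝ, ‖F x‖ }

/-- Fourier transform of a real-valued function, as a real number (its real part). -/
noncomputable def FTr (F : ℝ → ℝ) (t : ℝ) : ℝ := (𝓕 (fun x => (F x : ℂ)) t).re

/-- The class 𝒜⁺ sharp constant 𝒞⁺(A). -/
noncomputable def CcalPlus (A : ℝ) : ℝ :=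
  sSup { r : ℝ | ∃ F : ℝ → ℝ, Continuous F ∧ Integrable F ∧ F ≠ 0 ∧ (∀ x, F (-x) = F x) ∧
    r = (F 0 - A * ∫ t in {t : ℝ | 1 ≤ |t|}, max (FTr F t) 0) / ∫ x : ℝ, |F x| }

/-- 𝒞⁺(∞), over the class ℰ⁺. -/
noncomputable def CcalPlusInf : ℝ :=
  sSup { r : ℝ | ∃ F : ℝ → ℝ, Continuous F ∧ Integrable F ∧ F ≠ 0 ∧ (∀ x, F (-x) = F x) ∧
    (∀ t : ℝ, 1 ≤ |t| → FTr F t ≤ 0) ∧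
    r = F 0 / ∫ x : ℝ, |F x| }

/-- The prime counting function at a real argument. -/
noncomputable def primePi (x : ℝ) : ℕ := Nat.primeCounting ⌊x⌋₊

/-- The Brun–Titchmarsh constant 𝐁. -/
noncomputable def BrunTitchmarsh : ℝ :=
  limsup (fun x : ℝ =>
    ((primePi (x + Real.sqrt x) : ℝ) - (primePi x : ℝ)) / (Real.sqrt x / Real.log x)) atTop

namespace PrimeGap

/-! ### Growth of the completed zeta quotient -/

section ZetaGrowth
open Complex Set Topology Asymptotics

/-- The integral `∫₁^∞ {t} t^{-s-1} dt`. -/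
noncomputable def fractIntegral (s : ℂ) : ℂ :=
  ∫ t in Ioi (1 : ℝ), ((Int.fract t : ℝ) : ℂ) * (t : ℂ) ^ (-(s + 1))

lemma fractIntegral_eq_mellin (s : ℂ) :
    fractIntegral s =
      mellin ((Ioi (1 : ℝ)).indicator fun t ↦ ((Int.fract t : ℝ) : ℂ)) (-s) := by
  have hfun : ∀ t : ℝ, (t : ℂ) ^ (-s - 1) •
      (Ioi (1 : ℝ)).indicator (fun t ↦ ((Int.fract t : ℝ) : ℂ)) t =
      (Ioi (1 : ℝ)).indicator
        (fun t : ℝ ↦ ((Int.fract t : ℝ) : ℂ) * (t : ℂ) ^ (-(s + 1))) t := by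
    intro t
    by_cases ht : t ∈ Ioi (1 : ℝ)
    · rw [indicator_of_mem ht, indicator_of_mem ht, smul_eq_mul, mul_comm]
      congr 2; ring
    · rw [indicator_of_notMem ht, indicator_of_notMem ht, smul_zero]
  rw [mellin]
  simp_rw [hfun]
  rw [setIntegral_indicator measurableSet_Ioi, fractIntegral]
  congr 2
  ext t
  simp only [mem_inter_iff, mem_Ioi]
  constructor
  · intro h; exact ⟨by linarith, h⟩
  · exact fun h ↦ h.2

lemma differentiableAt_fractIntegral {s : ℂ} (hs : 0 < s.re) :
    DifferentiableAt ℂ fractIntegral s := by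
  have hmeas : Measurable ((Ioi (1 : ℝ)).indicator fun t ↦ ((Int.fract t : ℝ) : ℂ)) :=
    (measurable_ofReal.comp measurable_fract).indicator measurableSet_Ioi
  have hbd : ∀ t : ℝ, ‖(Ioi (1 : ℝ)).indicator (fun t ↦ ((Int.fract t : ℝ) : ℂ)) t‖ ≤ 1 := by
    intro t
    refine (norm_indicator_le_norm_self _ _).trans ?_
    rw [norm_real, Real.norm_of_nonneg (Int.fract_nonneg t)]
    exact (Int.fract_lt_one t).le
  have hd : DifferentiableAt ℂ
      (mellin ((Ioi (1 : ℝ)).indicator fun t ↦ ((Int.fract t : ℝ) : ℂ))) (-s) := by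
    refine mellin_differentiableAt_of_isBigO_rpow (a := 0) (b := -s.re - 1) ?_ ?_ ?_ ?_ ?_
    · refine (LocallyIntegrable.locallyIntegrableOn ?_ _)
      refine (locallyIntegrable_const (1 : ℝ)).mono hmeas.aestronglyMeasurable ?_
      filter_upwards with t
      simpa using hbd t
    · refine IsBigO.of_bound 1 ?_
      filter_upwards with t
      simpa using hbd t
    · simpa using hs
    · refine IsBigO.of_bound 1 ?_
      have : Ioo (0 : ℝ) 1 ∈ 𝓝[>] (0 : ℝ) := Ioo_mem_nhdsGT one_pos
      filter_upwards [this] with t ht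
      rw [indicator_of_notMem (by simpa using ht.2.le)]
      simp
    · simp
  have heq : fractIntegral = fun s ↦
      mellin ((Ioi (1 : ℝ)).indicator fun t ↦ ((Int.fract t : ℝ) : ℂ)) (-s) :=
    funext fractIntegral_eq_mellin
  rw [heq]
  exact hd.comp s differentiableAt_id.neg

lemma integrableOn_Ioi_cpow_neg {s : ℂ} (hs : 0 < s.re) :
    IntegrableOn (fun t : ℝ ↦ (t : ℂ) ^ (-(s + 1))) (Ioi 1) :=
  integrableOn_Ioi_cpow_of_lt (by simp; linarith) one_pos

lemma norm_fractIntegral_le {s : ℂ} (hs : 0 < s.re) : ‖fractIntegral s‖ ≤ 1 / s.re := by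
  have h1 : ∫ t in Ioi (1 : ℝ), t ^ (-(s.re + 1)) = 1 / s.re := by
    rw [integral_Ioi_rpow_of_lt (by linarith) one_pos]
    simp
  rw [← h1, fractIntegral]
  refine norm_integral_le_of_norm_le (integrableOn_Ioi_rpow_of_lt (by linarith) one_pos) ?_
  filter_upwards [ae_restrict_mem measurableSet_Ioi] with t ht
  have ht0 : (0 : ℝ) < t := one_pos.trans ht
  rw [norm_mul, norm_real, Real.norm_of_nonneg (Int.fract_nonneg t),
    norm_cpow_eq_rpow_re_of_pos ht0]
  simp only [neg_re, add_re, one_re]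
  exact mul_le_of_le_one_left (by positivity) (Int.fract_lt_one t).le

lemma riemannZeta₁_eq_of_one_lt {s : ℂ} (hs : 1 < s.re) :
    riemannZeta₁ s = s - s * (s - 1) * fractIntegral s := by
  have hs1 : s ≠ 1 := by rintro rfl; simp at hs
  have hs1' : s - 1 ≠ 0 := sub_ne_zero.mpr hs1
  have hz : riemannZeta s =
      s * ∫ t in Ioi (1 : ℝ), (∑ k ∈ Finset.Icc 1 ⌊t⌋₊, (1 : ℕ → ℂ) k) * t ^ (-(s + 1)) := by
    rw [← LSeries_one_eq_riemannZeta hs]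
    refine LSeries_eq_mul_integral' 1 zero_le_one hs ?_
    refine IsBigO.of_bound 1 ?_
    filter_upwards with n
    simp
  have hInt : ∫ t in Ioi (1 : ℝ), (∑ k ∈ Finset.Icc 1 ⌊t⌋₊, (1 : ℕ → ℂ) k) * t ^ (-(s + 1)) =
      (∫ t in Ioi (1 : ℝ), (t : ℂ) ^ (-s)) - fractIntegral s := by
    have hi1 : IntegrableOn (fun t : ℝ ↦ (t : ℂ) ^ (-s)) (Ioi 1) :=
      integrableOn_Ioi_cpow_of_lt (by simpa using hs) one_pos
    have hi2 : IntegrableOn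
        (fun t : ℝ ↦ ((Int.fract t : ℝ) : ℂ) * (t : ℂ) ^ (-(s + 1))) (Ioi 1) := by
      refine (integrableOn_Ioi_cpow_neg (s := s) (by linarith)).bdd_mul (c := 1)
        (measurable_ofReal.comp measurable_fract).aestronglyMeasurable ?_
      filter_upwards with t
      simp only [norm_real, Real.norm_of_nonneg (Int.fract_nonneg t)]
      exact (Int.fract_lt_one t).le
    rw [fractIntegral, ← integral_sub hi1 hi2]
    refine setIntegral_congr_fun measurableSet_Ioi fun t ht ↦ ?_
    have ht0 : (0 : ℝ) < t := one_pos.trans ht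
    have hfl : ((⌊t⌋₊ : ℝ) : ℂ) = (t : ℂ) - ((Int.fract t : ℝ) : ℂ) := by
      rw [← ofReal_sub, Int.self_sub_fract, ← natCast_floor_eq_intCast_floor ht0.le]
    have htc : (t : ℂ) * (t : ℂ) ^ (-(s + 1)) = (t : ℂ) ^ (-s) := by
      have : (t : ℂ) ≠ 0 := by exact_mod_cast ht0.ne'
      rw [show -(s + 1) = -s - 1 by ring, cpow_sub _ _ this, cpow_one]
      field_simp
    have hsum : (∑ k ∈ Finset.Icc 1 ⌊t⌋₊, (1 : ℕ → ℂ) k) = ((⌊t⌋₊ : ℝ) : ℂ) := by simp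
    simp only [hsum, hfl, sub_mul, htc]
  have hpow : ∫ t in Ioi (1 : ℝ), (t : ℂ) ^ (-s) = 1 / (s - 1) := by
    rw [integral_Ioi_cpow_of_lt (by simpa using hs) one_pos]
    simp only [ofReal_one, one_cpow]
    rw [show -s + 1 = -(s - 1) by ring, neg_div_neg_eq]
  have h2 := riemannZeta_eq_inv_sub_mul hs1
  rw [hz, hInt, hpow] at h2
  have h3 : riemannZeta₁ s = (s - 1) * ((s - 1)⁻¹ * riemannZeta₁ s) := by field_simp
  rw [h3, ← h2]
  field_simp

lemma riemannZeta₁_eq {s : ℂ} (hs : 0 < s.re) :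
    riemannZeta₁ s = s - s * (s - 1) * fractIntegral s := by
  have hopen : IsOpen {z : ℂ | 0 < z.re} := isOpen_lt continuous_const continuous_re
  have hf : AnalyticOnNhd ℂ riemannZeta₁ {z : ℂ | 0 < z.re} :=
    differentiable_riemannZeta₁.differentiableOn.analyticOnNhd hopen
  have hg : AnalyticOnNhd ℂ (fun s ↦ s - s * (s - 1) * fractIntegral s) {z : ℂ | 0 < z.re} := by
    refine DifferentiableOn.analyticOnNhd (fun z hz ↦ ?_) hopen
    have := differentiableAt_fractIntegral (s := z) hz
    exact DifferentiableAt.differentiableWithinAt (by fun_prop)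
  have hconn : IsPreconnected {z : ℂ | 0 < z.re} := (convex_halfSpace_re_gt 0).isPreconnected
  refine hf.eqOn_of_preconnected_of_eventuallyEq hg hconn (z₀ := 2) (by simp) ?_ hs
  have : {z : ℂ | 1 < z.re} ∈ 𝓝 (2 : ℂ) :=
    (isOpen_lt continuous_const continuous_re).mem_nhds (by simp)
  filter_upwards [this] with z hz using riemannZeta₁_eq_of_one_lt hz

lemma norm_riemannZeta₁_le {s : ℂ} (hs : 0 < s.re) :
    ‖riemannZeta₁ s‖ ≤ ‖s‖ + ‖s‖ * ‖s - 1‖ / s.re := by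
  rw [riemannZeta₁_eq hs]
  refine (norm_sub_le _ _).trans ?_
  rw [norm_mul, norm_mul]
  have := norm_fractIntegral_le hs
  gcongr
  calc ‖s‖ * ‖s - 1‖ * ‖fractIntegral s‖ ≤ ‖s‖ * ‖s - 1‖ * (1 / s.re) := by gcongr
    _ = _ := by ring

/-- For `Re s ≥ 2`, the zeta function is bounded away from zero. -/
lemma norm_riemannZeta_ge {s : ℂ} (hs : 2 ≤ s.re) : 1 / 4 ≤ ‖riemannZeta s‖ := by
  have hs1 : 1 < s.re := by linarith
  have hz := zeta_eq_tsum_one_div_nat_add_one_cpow hs1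
  have hsum : Summable fun n : ℕ ↦ 1 / ((n : ℝ) + 1) ^ 2 := by
    have := (summable_nat_add_iff 1).mpr (Real.summable_one_div_nat_pow.mpr one_lt_two)
    simpa using this
  have hterm : ∀ n : ℕ, ‖1 / ((n : ℂ) + 1) ^ s‖ ≤ 1 / ((n : ℝ) + 1) ^ 2 := by
    intro n
    have hn : (0 : ℝ) < (n : ℝ) + 1 := by positivity
    rw [norm_div, norm_one, show ((n : ℂ) + 1) = (((n : ℝ) + 1 : ℝ) : ℂ) by push_cast; rfl,
      norm_cpow_eq_rpow_re_of_pos hn]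
    rw [← Real.rpow_natCast]
    gcongr
    · linarith [n.cast_nonneg (α := ℝ)]
    · exact_mod_cast hs
  have hsc : Summable fun n : ℕ ↦ 1 / ((n : ℂ) + 1) ^ s := Summable.of_norm_bounded hsum hterm
  have hpi : ∑' n : ℕ, 1 / ((n : ℝ) + 1) ^ 2 = π ^ 2 / 6 := by
    have h1 := hasSum_zeta_two.tsum_eq
    have h2 : Summable fun n : ℕ ↦ 1 / (n : ℝ) ^ 2 := Real.summable_one_div_nat_pow.mpr one_lt_two
    rw [h2.tsum_eq_zero_add] at h1
    simpa using h1
  have htail : ∑' n : ℕ, 1 / (((n + 1 : ℕ) : ℝ) + 1) ^ 2 = π ^ 2 / 6 - 1 := by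
    rw [← hpi, hsum.tsum_eq_zero_add]
    simp
  have hb : ‖∑' n : ℕ, 1 / (((n + 1 : ℕ) : ℂ) + 1) ^ s‖ ≤ π ^ 2 / 6 - 1 := by
    rw [← htail]
    refine tsum_of_norm_bounded (f := fun n : ℕ ↦ 1 / (((n + 1 : ℕ) : ℂ) + 1) ^ s)
      ((summable_nat_add_iff 1).mpr hsum).hasSum fun n ↦ hterm (n + 1)
  rw [hz, hsc.tsum_eq_zero_add]
  simp only [Nat.cast_zero, zero_add, one_cpow, div_one]
  have h3 : π ^ 2 / 6 - 1 ≤ 3 / 4 := by nlinarith [Real.pi_lt_d2, Real.pi_pos]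
  have h4 := norm_sub_norm_le (1 : ℂ) (-∑' n : ℕ, 1 / (((n + 1 : ℕ) : ℂ) + 1) ^ s)
  rw [sub_neg_eq_add, norm_neg, norm_one] at h4
  linarith

lemma norm_riemannZeta₁_ge {s : ℂ} (hs : 2 ≤ s.re) : 1 / 4 ≤ ‖riemannZeta₁ s‖ := by
  have hs1 : s ≠ 1 := by rintro rfl; norm_num at hs
  have h1 := norm_riemannZeta_ge hs
  rw [riemannZeta_eq_inv_sub_mul hs1, norm_mul, norm_inv] at h1
  have h2 : 1 ≤ ‖s - 1‖ := by
    have := re_le_norm (s - 1)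
    simp at this; linarith
  have h3 : ‖s - 1‖⁻¹ ≤ 1 := inv_le_one_of_one_le₀ h2
  nlinarith [norm_nonneg (riemannZeta₁ s)]

end ZetaGrowth

section LogBound
open Complex Set Topology Asymptotics Metric

/-- A nonvanishing holomorphic function on a disc has a holomorphic logarithm. -/
lemma exists_log_on_ball {f : ℂ → ℂ} {c : ℂ} {R : ℝ} (hR : 0 < R)
    (hf : DifferentiableOn ℂ f (ball c R)) (hne : ∀ z ∈ ball c R, f z ≠ 0) :
    ∃ g : ℂ → ℂ, DifferentiableOn ℂ g (ball c R) ∧ g c = 0 ∧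
      ∀ z ∈ ball c R, f z = f c * exp (g z) := by
  have hf' : DifferentiableOn ℂ (fun z ↦ deriv f z / f z) (ball c R) :=
    (hf.deriv isOpen_ball).div hf hne
  obtain ⟨G, hG⟩ := hf'.isExactOn_ball
  have hc : c ∈ ball c R := mem_ball_self hR
  refine ⟨fun z ↦ G z - G c, fun z hz ↦ ((hG z hz).differentiableAt.sub_const _).differentiableWithinAt,
    by simp, fun z hz ↦ ?_⟩
  have hder : ∀ w ∈ ball c R, HasDerivAt (fun w ↦ f w * exp (-(G w - G c))) 0 w := by
    intro w hw
    have h1 : HasDerivAt f (deriv f w) w :=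
      (hf.differentiableAt (isOpen_ball.mem_nhds hw)).hasDerivAt
    have h2 : HasDerivAt (fun w ↦ exp (-(G w - G c)))
        (exp (-(G w - G c)) * -(deriv f w / f w)) w := ((hG w hw).sub_const (G c)).fun_neg.cexp
    have h3 := hne w hw
    refine (h1.fun_mul h2).congr_deriv ?_
    field_simp
    ring
  have hconst : (fun w ↦ f w * exp (-(G w - G c))) z = (fun w ↦ f w * exp (-(G w - G c))) c := by
    refine isOpen_ball.is_const_of_deriv_eq_zero (convex_ball c R).isPreconnected
      (fun w hw ↦ (hder w hw).differentiableAt.differentiableWithinAt)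
      (fun w hw ↦ (hder w hw).deriv) hz hc
  simp only [sub_self, neg_zero, exp_zero, mul_one] at hconst
  rw [← hconst, mul_assoc, ← exp_add]
  simp

/-- A lower bound for a nonvanishing holomorphic function on a disc, from an upper bound. -/
lemma norm_center_le_exp_mul_norm {f : ℂ → ℂ} {c z : ℂ} {R M : ℝ} (hM : 0 < M)
    (hf : DifferentiableOn ℂ f (ball c R)) (hne : ∀ w ∈ ball c R, f w ≠ 0)
    (hbd : ∀ w ∈ ball c R, ‖f w‖ ≤ Real.exp M * ‖f c‖) (hz : z ∈ ball c R) :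
    ‖f c‖ ≤ Real.exp (2 * M * ‖z - c‖ / (R - ‖z - c‖)) * ‖f z‖ := by
  have hR : 0 < R := pos_of_mem_ball hz
  obtain ⟨g, hg, hg0, hgf⟩ := exists_log_on_ball hR hf hne
  have hfc : 0 < ‖f c‖ := norm_pos_iff.mpr (hne c (mem_ball_self hR))
  have hmem : ∀ w ∈ ball (0 : ℂ) R, c + w ∈ ball c R := by
    intro w hw; simpa [mem_ball, dist_eq] using hw
  have hzc : z - c ∈ ball (0 : ℂ) R := by simpa [mem_ball, dist_eq] using hz
  have hb : ‖g (c + (z - c))‖ ≤ 2 * M * ‖z - c‖ / (R - ‖z - c‖) := by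
    refine borelCaratheodory_zero (f := fun w ↦ g (c + w)) hM ?_ ?_ hR hzc (by simpa using hg0)
    · exact hg.comp (by fun_prop) hmem
    · intro w hw
      have h1 := hbd _ (hmem w hw)
      rw [hgf _ (hmem w hw), norm_mul, norm_exp, mul_comm] at h1
      exact Real.exp_le_exp.mp (le_of_mul_le_mul_right h1 hfc)
  rw [add_sub_cancel] at hb
  rw [hgf z hz, norm_mul, norm_exp, mul_left_comm, ← Real.exp_add]
  refine le_mul_of_one_le_right hfc.le (Real.one_le_exp ?_)
  have := (abs_le.mp (abs_re_le_norm (g z))).1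
  linarith

end LogBound

section GammaRatio
open Complex Set Topology

/-- The quotient `Γ(z) / Γ(z + l)` is bounded on half-planes `Re z ≥ a > 0`. -/
lemma norm_Gamma_le_mul_norm_Gamma_add {a l : ℝ} (ha : 0 < a) (hl : 0 < l) :
    ∃ C : ℝ, 0 < C ∧ ∀ z : ℂ, a ≤ z.re → ‖Gamma z‖ ≤ C * ‖Gamma (z + l)‖ := by
  have hal : (0 : ℝ) < ((a : ℂ)).re := by simpa using ha
  have hll : (0 : ℝ) < ((l : ℂ)).re := by simpa using hl
  have hG : 0 < ‖Gamma l‖ := norm_pos_iff.mpr (Gamma_ne_zero_of_re_pos hll)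
  set K : ℝ := ∫ x : ℝ in 0..1, ‖(x : ℂ) ^ ((a : ℂ) - 1) * (1 - (x : ℂ)) ^ ((l : ℂ) - 1)‖ with hK
  have hK0 : 0 ≤ K := intervalIntegral.integral_nonneg zero_le_one fun _ _ ↦ norm_nonneg _
  refine ⟨(K + 1) / ‖Gamma l‖, by positivity, fun z hz ↦ ?_⟩
  have hz0 : 0 < z.re := ha.trans_le hz
  have h1 := congrArg norm (Gamma_mul_Gamma_eq_betaIntegral hz0 hll)
  rw [norm_mul, norm_mul] at h1
  have h2 : ‖betaIntegral z l‖ ≤ K := by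
    rw [betaIntegral]
    refine intervalIntegral.norm_integral_le_of_norm_le zero_le_one ?_
      (betaIntegral_convergent hal hll).norm
    filter_upwards with x hx
    rw [norm_mul, norm_mul]
    refine mul_le_mul_of_nonneg_right ?_ (norm_nonneg _)
    rw [norm_cpow_eq_rpow_re_of_pos hx.1, norm_cpow_eq_rpow_re_of_pos hx.1]
    refine Real.rpow_le_rpow_of_exponent_ge hx.1 hx.2 ?_
    simpa using hz
  have h3 : ‖Gamma z‖ * ‖Gamma l‖ ≤ (K + 1) * ‖Gamma (z + l)‖ := by
    rw [h1, mul_comm]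
    exact mul_le_mul_of_nonneg_right (by linarith) (norm_nonneg _)
  rw [div_mul_eq_mul_div, le_div_iff₀ hG]
  exact h3

end GammaRatio

section ZetaLower
open Complex Set Topology Metric

lemma riemannZeta₁_ne_zero_of_RH (hRH : RiemannHypothesis) {s : ℂ} (hs : 1 / 2 < s.re) :
    riemannZeta₁ s ≠ 0 := by
  by_cases h1 : s = 1
  · simp [h1]
  intro h0
  have hz : riemannZeta s = 0 := by rw [riemannZeta_eq_inv_sub_mul h1, h0, mul_zero]
  have := hRH s hz ?_ h1
  · linarith
  · rintro ⟨n, rfl⟩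
    have h4 : ((-2 * ((n : ℂ) + 1))).re = -2 * ((n : ℝ) + 1) := by simp
    rw [h4] at hs
    have : (0 : ℝ) ≤ n := n.cast_nonneg
    linarith

/-- Under RH, `1 / ζ₁` has at most exponential growth on `Re s ≥ 1/2 + δ`. -/
lemma one_le_exp_mul_norm_riemannZeta₁ (hRH : RiemannHypothesis) {δ : ℝ} (hδ : 0 < δ) :
    ∃ A : ℝ, 0 < A ∧ ∀ s : ℂ, 1 / 2 + δ ≤ s.re →
      1 ≤ Real.exp (A * (1 + ‖s‖)) * ‖riemannZeta₁ s‖ := by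
  refine ⟨21 / δ + 2, by positivity, fun s hs ↦ ?_⟩
  have hexp2 : (4 : ℝ) ≤ Real.exp 2 := by
    have := Real.add_one_le_exp (1 : ℝ)
    rw [show (2 : ℝ) = 1 + 1 by norm_num, Real.exp_add]
    nlinarith
  have hA0 : 0 ≤ 21 / δ * (1 + ‖s‖) := by positivity
  rcases le_total 2 s.re with h2 | h2
  · have h := norm_riemannZeta₁_ge h2
    have h3 : (4 : ℝ) ≤ Real.exp ((21 / δ + 2) * (1 + ‖s‖)) :=
      hexp2.trans (Real.exp_le_exp.mpr (by nlinarith [norm_nonneg s]))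
    nlinarith
  · set c : ℂ := 2 + s.im * I with hc
    have hcre : c.re = 2 := by simp [hc]
    have hcim : c.im = s.im := by simp [hc]
    have hsc : ‖s - c‖ = 2 - s.re := by
      have : s - c = ((s.re - 2 : ℝ) : ℂ) := by
        apply Complex.ext <;> simp [hcre, hcim]
      rw [this, norm_real, Real.norm_of_nonpos (by linarith)]
      ring
    have hball : ∀ z ∈ ball c (3 / 2), 1 / 2 < z.re := by
      intro z hz
      rw [mem_ball, dist_eq] at hz
      have := (abs_lt.mp ((abs_re_le_norm (z - c)).trans_lt hz)).1
      rw [sub_re, hcre] at this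
      linarith
    have hcge := norm_riemannZeta₁_ge hcre.ge
    have hbd : ∀ z ∈ ball c (3 / 2),
        ‖riemannZeta₁ z‖ ≤ Real.exp (‖s‖ + 7) * ‖riemannZeta₁ c‖ := by
      intro z hz
      have hzr := hball z hz
      have h1 := norm_riemannZeta₁_le (s := z) (by linarith)
      have h3 : ‖z‖ ≤ ‖s‖ + 3 := by
        rw [mem_ball, dist_eq] at hz
        have e : z = (z - c) + (c - s) + s := by ring
        have := norm_add₃_le (a := z - c) (b := c - s) (c := s)
        rw [← e, norm_sub_rev c s, hsc] at this
        linarith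
      have h4 : ‖z - 1‖ ≤ ‖z‖ + 1 := (norm_sub_le _ _).trans (by simp)
      have h5 : ‖z‖ * ‖z - 1‖ / z.re ≤ 2 * (‖z‖ * (‖z‖ + 1)) := by
        rw [div_le_iff₀ (by linarith)]
        have : ‖z‖ * ‖z - 1‖ ≤ ‖z‖ * (‖z‖ + 1) := by gcongr
        have h0 : 0 ≤ ‖z‖ * (‖z‖ + 1) := by positivity
        nlinarith
      have h6 : (‖z‖ + 1) ^ 2 / 2 ≤ Real.exp (‖z‖ + 1) := by
        have := Real.quadratic_le_exp_of_nonneg (x := ‖z‖ + 1) (by positivity)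
        nlinarith [norm_nonneg z]
      have h7 : ‖riemannZeta₁ z‖ ≤ 4 * Real.exp (‖s‖ + 4) := by
        have : Real.exp (‖z‖ + 1) ≤ Real.exp (‖s‖ + 4) := Real.exp_le_exp.mpr (by linarith)
        nlinarith [norm_nonneg z]
      have h8 : Real.exp (‖s‖ + 7) = Real.exp (‖s‖ + 4) * Real.exp 3 := by
        rw [← Real.exp_add]; congr 1; ring
      have h9 : (16 : ℝ) ≤ Real.exp 3 := by
        have := Real.exp_one_gt_d9
        rw [show (3 : ℝ) = 1 + 1 + 1 by norm_num, Real.exp_add, Real.exp_add]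
        have h10 : (7.3 : ℝ) ≤ Real.exp 1 * Real.exp 1 := by nlinarith
        nlinarith
      calc ‖riemannZeta₁ z‖ ≤ 4 * Real.exp (‖s‖ + 4) := h7
        _ = Real.exp (‖s‖ + 4) * 16 * (1 / 4) := by ring
        _ ≤ Real.exp (‖s‖ + 4) * Real.exp 3 * ‖riemannZeta₁ c‖ := by gcongr
        _ = _ := by rw [h8]
    have hkey := norm_center_le_exp_mul_norm (z := s) (M := ‖s‖ + 7) (by positivity)
      differentiable_riemannZeta₁.differentiableOn
      (fun w hw ↦ riemannZeta₁_ne_zero_of_RH hRH (hball w hw)) hbd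
      (by rw [mem_ball, dist_eq, hsc]; linarith)
    rw [hsc] at hkey
    have hexpo : 2 * (‖s‖ + 7) * (2 - s.re) / (3 / 2 - (2 - s.re)) ≤ 21 / δ * (1 + ‖s‖) := by
      rw [div_mul_eq_mul_div, div_le_div_iff₀ (by linarith) hδ]
      have h1 : 2 * (‖s‖ + 7) * (2 - s.re) ≤ 21 * (1 + ‖s‖) := by
        have : 2 * (‖s‖ + 7) * (2 - s.re) ≤ 2 * (‖s‖ + 7) * (3 / 2) := by
          gcongr; linarith
        nlinarith [norm_nonneg s]
      have h2 : δ ≤ 3 / 2 - (2 - s.re) := by linarith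
      have h3 : 0 ≤ 21 * (1 + ‖s‖) := by positivity
      calc _ ≤ 21 * (1 + ‖s‖) * δ := by gcongr
        _ ≤ _ := by gcongr
    have h4 : ‖riemannZeta₁ c‖ ≤ Real.exp (21 / δ * (1 + ‖s‖)) * ‖riemannZeta₁ s‖ :=
      hkey.trans (by gcongr)
    have h5 : (4 : ℝ) ≤ Real.exp (2 * (1 + ‖s‖)) :=
      hexp2.trans (Real.exp_le_exp.mpr (by nlinarith [norm_nonneg s]))
    have h6 : Real.exp ((21 / δ + 2) * (1 + ‖s‖)) =
        Real.exp (2 * (1 + ‖s‖)) * Real.exp (21 / δ * (1 + ‖s‖)) := by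
      rw [← Real.exp_add]; congr 1; ring
    rw [h6, mul_assoc]
    nlinarith

end ZetaLower

/-! ### Positivity of the logarithmic derivative of the completed zeta function -/

section Xi
open Complex Set Topology Metric Asymptotics
open scoped ComplexConjugate

/-- The entire function `s (s - 1) π^{-s/2} Γ(s/2) ζ(s)`, in a form valid for `Re s > 0`. -/
noncomputable def xi (s : ℂ) : ℂ := s * Gammaℝ s * riemannZeta₁ s

lemma differentiableAt_Gammaℝ {s : ℂ} (hs : 0 < s.re) : DifferentiableAt ℂ Gammaℝ s := by
  have h : DifferentiableAt ℂ Gamma (s / 2) := by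
    refine differentiableAt_Gamma _ fun m hm ↦ ?_
    have := congrArg re hm
    simp only [neg_re, natCast_re] at this
    have h2 : (s / 2).re = s.re / 2 := by simp
    have : (0 : ℝ) ≤ m := m.cast_nonneg
    linarith
  have hpi : (π : ℂ) ≠ 0 := by exact_mod_cast Real.pi_ne_zero
  have : Gammaℝ = fun s ↦ (π : ℂ) ^ (-s / 2) * Gamma (s / 2) := funext Gammaℝ_def
  rw [this]
  refine DifferentiableAt.mul ?_ (h.comp s (by fun_prop))
  exact (differentiableAt_id.neg.div_const 2).const_cpow (Or.inl hpi)

lemma differentiableAt_xi {s : ℂ} (hs : 0 < s.re) : DifferentiableAt ℂ xi s :=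
  (differentiableAt_id.mul (differentiableAt_Gammaℝ hs)).mul
    differentiable_riemannZeta₁.differentiableAt

lemma xi_ne_zero (hRH : RiemannHypothesis) {s : ℂ} (hs : 1 / 2 < s.re) : xi s ≠ 0 := by
  have h0 : 0 < s.re := by linarith
  refine mul_ne_zero (mul_ne_zero ?_ (Gammaℝ_ne_zero_of_re_pos h0))
    (riemannZeta₁_ne_zero_of_RH hRH hs)
  rintro rfl
  simp at h0

lemma xi_eq {s : ℂ} (hs : 0 < s.re) (h1 : s ≠ 1) :
    xi s = s * (s - 1) * completedRiemannZeta s := by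
  have h0 : s ≠ 0 := by rintro rfl; simp at hs
  have h2 := riemannZeta_def_of_ne_zero h0
  rw [riemannZeta_eq_inv_sub_mul h1, eq_div_iff (Gammaℝ_ne_zero_of_re_pos hs)] at h2
  rw [xi, ← h2]
  have : s - 1 ≠ 0 := sub_ne_zero.mpr h1
  field_simp

lemma xi_one_sub {s : ℂ} (hs : 0 < s.re) (hs1 : s.re < 1) : xi (1 - s) = xi s := by
  have h0 : s ≠ 0 := by rintro rfl; simp at hs
  have h1 : s ≠ 1 := by rintro rfl; simp at hs1
  rw [xi_eq hs h1, xi_eq (s := 1 - s) (by simpa using hs1) (by simpa using h0),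
    completedRiemannZeta_one_sub]
  ring

lemma xi_conj (s : ℂ) : xi (conj s) = conj (xi s) := by
  have hG : Gammaℝ (conj s) = conj (Gammaℝ s) := by
    rw [Gammaℝ_def, Gammaℝ_def, map_mul, ← Gamma_conj]
    have harg : ((π : ℝ) : ℂ).arg ≠ π := by
      rw [arg_ofReal_of_nonneg Real.pi_pos.le]; exact Real.pi_pos.ne
    have h2 : conj s / 2 = conj (s / 2) := by simp [conj_ofNat]
    have h3 : -conj s / 2 = conj (-s / 2) := by simp [conj_ofNat]
    rw [h2, h3, cpow_conj _ _ harg, conj_ofReal]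
  have hz : riemannZeta₁ (conj s) = conj (riemannZeta₁ s) := by
    by_cases h1 : s = 1
    · simp [h1]
    have h1' : conj s ≠ 1 := fun h ↦ h1 (by simpa using congrArg conj h)
    have h2 := riemannZeta_conj s
    have h3 : s - 1 ≠ 0 := sub_ne_zero.mpr h1
    have h4 : conj s - 1 ≠ 0 := sub_ne_zero.mpr h1'
    rw [riemannZeta_eq_inv_sub_mul h1, riemannZeta_eq_inv_sub_mul h1', map_mul, map_inv₀, map_sub,
      map_one] at h2
    exact mul_left_cancel₀ (inv_ne_zero h4) h2
  rw [xi, xi, map_mul, map_mul, hG, hz]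

lemma norm_xi_critical {l t : ℝ} (hl : 0 < l) (hl2 : l < 1 / 2) :
    ‖xi ((t : ℂ) * I + 1 / 2 - l)‖ = ‖xi ((t : ℂ) * I + 1 / 2 + l)‖ := by
  have h : (1 : ℂ) - ((t : ℂ) * I + 1 / 2 - l) = conj ((t : ℂ) * I + 1 / 2 + l) := by
    apply Complex.ext
    · simp; ring
    · simp
  rw [← xi_one_sub (s := (t : ℂ) * I + 1 / 2 - l) (by simp; linarith) (by simp; linarith), h,
    xi_conj, RCLike.norm_conj]

lemma norm_riemannZeta₁_ge_mul {s : ℂ} (hs : 2 ≤ s.re) : ‖s - 1‖ / 4 ≤ ‖riemannZeta₁ s‖ := by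
  have hs1 : s ≠ 1 := by rintro rfl; norm_num at hs
  have h1 := norm_riemannZeta_ge hs
  have h2 : 0 < ‖s - 1‖ := norm_pos_iff.mpr (sub_ne_zero.mpr hs1)
  rw [riemannZeta_eq_inv_sub_mul hs1, norm_mul, norm_inv, inv_mul_eq_div, le_div_iff₀ h2] at h1
  linarith

/-- The quotient of shifted completed zeta functions is controlled by the quotient of the
shifted zeta functions. -/
lemma norm_xi_le_mul {a l : ℝ} (ha : 0 < a) (hl : 0 < l) :
    ∃ C : ℝ, 0 < C ∧ ∀ w : ℂ, a ≤ w.re →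
      ‖xi w‖ * ‖riemannZeta₁ (w + 2 * l)‖ ≤ C * ‖riemannZeta₁ w‖ * ‖xi (w + 2 * l)‖ := by
  obtain ⟨C, hC, hG⟩ := norm_Gamma_le_mul_norm_Gamma_add (half_pos ha) hl
  refine ⟨π ^ l * C, by positivity, fun w hw ↦ ?_⟩
  have h1 := hG (w / 2) (by simp; linarith)
  have h2 : ‖Gammaℝ w‖ ≤ π ^ l * C * ‖Gammaℝ (w + 2 * l)‖ := by
    rw [Gammaℝ_def, Gammaℝ_def, norm_mul, norm_mul, norm_cpow_eq_rpow_re_of_pos Real.pi_pos,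
      norm_cpow_eq_rpow_re_of_pos Real.pi_pos]
    have e1 : (w + 2 * l) / 2 = w / 2 + l := by ring
    have e2 : (-w / 2).re = -w.re / 2 := by simp
    have e3 : (-(w + 2 * l) / 2).re = -w.re / 2 - l := by simp; ring
    rw [e1, e2, e3, Real.rpow_sub Real.pi_pos]
    have : π ^ l * C * (π ^ (-w.re / 2) / π ^ l * ‖Gamma (w / 2 + l)‖) =
        π ^ (-w.re / 2) * (C * ‖Gamma (w / 2 + l)‖) := by
      have := (Real.rpow_pos_of_pos Real.pi_pos l).ne'
      field_simp
    rw [this]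
    gcongr
  have h3 : ‖w‖ ≤ ‖w + 2 * l‖ := by
    rw [Complex.norm_def, Complex.norm_def]
    refine Real.sqrt_le_sqrt ?_
    rw [normSq_apply, normSq_apply]
    simp only [add_re, mul_re, re_ofNat, ofReal_re, im_ofNat, ofReal_im, mul_zero, sub_zero,
      add_im, mul_im, zero_mul, add_zero]
    nlinarith
  rw [xi, xi, norm_mul, norm_mul, norm_mul, norm_mul]
  calc ‖w‖ * ‖Gammaℝ w‖ * ‖riemannZeta₁ w‖ * ‖riemannZeta₁ (w + 2 * l)‖
      ≤ ‖w + 2 * l‖ * (π ^ l * C * ‖Gammaℝ (w + 2 * l)‖) * ‖riemannZeta₁ w‖ *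
        ‖riemannZeta₁ (w + 2 * l)‖ := by gcongr
    _ = _ := by ring

lemma norm_riemannZeta₁_le_exp {a : ℝ} (ha : 0 < a) {w : ℂ} (hw : a ≤ w.re) :
    ‖riemannZeta₁ w‖ ≤ 2 * (1 + 1 / a) * Real.exp (‖w‖ + 1) := by
  have h1 := norm_riemannZeta₁_le (s := w) (ha.trans_le hw)
  have h4 : ‖w - 1‖ ≤ ‖w‖ + 1 := (norm_sub_le _ _).trans (by simp)
  have h5 : ‖w‖ * ‖w - 1‖ / w.re ≤ 1 / a * (‖w‖ + 1) ^ 2 := by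
    calc ‖w‖ * ‖w - 1‖ / w.re ≤ (‖w‖ + 1) * (‖w‖ + 1) / a := by
          gcongr; linarith
      _ = _ := by ring
  have h6 : (‖w‖ + 1) ^ 2 / 2 ≤ Real.exp (‖w‖ + 1) := by
    have := Real.quadratic_le_exp_of_nonneg (x := ‖w‖ + 1) (by positivity)
    nlinarith [norm_nonneg w]
  have h7 : ‖w‖ ≤ (‖w‖ + 1) ^ 2 := by nlinarith [norm_nonneg w]
  have h8 : 0 < 1 + 1 / a := by positivity
  calc ‖riemannZeta₁ w‖ ≤ (1 + 1 / a) * (‖w‖ + 1) ^ 2 := by linarith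
    _ = 2 * (1 + 1 / a) * ((‖w‖ + 1) ^ 2 / 2) := by ring
    _ ≤ _ := by gcongr

/-- Under RH, `|ξ(s - l)| ≤ |ξ(s + l)|` to the right of the critical line. -/
lemma norm_xi_sub_le (hRH : RiemannHypothesis) {l : ℝ} (hl : 0 < l) (hl2 : l < 1 / 2) {s : ℂ}
    (hs : 1 / 2 ≤ s.re) : ‖xi (s - l)‖ ≤ ‖xi (s + l)‖ := by
  set a : ℝ := 1 / 2 - l with ha
  have ha0 : 0 < a := by linarith
  set f : ℂ → ℂ := fun z ↦ xi (z + 1 / 2 - l) / xi (z + 1 / 2 + l) with hf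
  have hne : ∀ z : ℂ, 0 ≤ z.re → xi (z + 1 / 2 + l) ≠ 0 := fun z hz ↦
    xi_ne_zero hRH (by simp; linarith)
  have hzne : ∀ z : ℂ, 0 ≤ z.re → riemannZeta₁ (z + 1 / 2 + l) ≠ 0 := fun z hz ↦
    riemannZeta₁_ne_zero_of_RH hRH (by simp; linarith)
  obtain ⟨C, hC, hquot⟩ := norm_xi_le_mul ha0 hl
  have hfle : ∀ z : ℂ, 0 ≤ z.re →
      ‖f z‖ ≤ C * (‖riemannZeta₁ (z + 1 / 2 - l)‖ / ‖riemannZeta₁ (z + 1 / 2 + l)‖) := by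
    intro z hz
    have h1 := hquot (z + 1 / 2 - l) (by simp; linarith)
    rw [show z + 1 / 2 - (l : ℂ) + 2 * l = z + 1 / 2 + l by ring] at h1
    simp only [hf]
    rw [norm_div, div_le_iff₀ (norm_pos_iff.mpr (hne z hz)), ← mul_div_assoc, div_mul_eq_mul_div,
      le_div_iff₀ (norm_pos_iff.mpr (hzne z hz))]
    exact h1
  have hd : DiffContOnCl ℂ f {z | 0 < z.re} := by
    refine DifferentiableOn.diffContOnCl fun z hz ↦ ?_
    have hz0 : 0 ≤ z.re := by
      have h2 : closure {z : ℂ | 0 < z.re} ⊆ {z | 0 ≤ z.re} :=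
        closure_minimal (fun z (hz : 0 < z.re) ↦ show 0 ≤ z.re from hz.le) (isClosed_le continuous_const continuous_re)
      exact h2 hz
    have h1 : DifferentiableAt ℂ xi (z + 1 / 2 - l) := differentiableAt_xi (by simp; linarith)
    have h2 : DifferentiableAt ℂ xi (z + 1 / 2 + l) := differentiableAt_xi (by simp; linarith)
    refine DifferentiableAt.differentiableWithinAt (DifferentiableAt.div ?_ ?_ (hne z hz0))
    · exact h1.comp z (f := fun z : ℂ ↦ z + 1 / 2 - l) (by fun_prop)
    · exact h2.comp z (f := fun z : ℂ ↦ z + 1 / 2 + l) (by fun_prop)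
  have hl1 : ‖(l : ℂ)‖ = l := by rw [norm_real, Real.norm_of_nonneg hl.le]
  have hn1 : ∀ z : ℂ, ‖z + 1 / 2 - l‖ ≤ ‖z‖ + 1 := by
    intro z
    have h := norm_sub_le (z + 1 / 2) (l : ℂ)
    have h' := norm_add_le z (1 / 2 : ℂ)
    norm_num at h h' ⊢
    rw [abs_of_pos hl] at h
    linarith
  have hn2 : ∀ z : ℂ, ‖z + 1 / 2 + l‖ ≤ ‖z‖ + 1 := by
    intro z
    have h := norm_add_le (z + 1 / 2) (l : ℂ)
    have h' := norm_add_le z (1 / 2 : ℂ)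
    norm_num at h h' ⊢
    rw [abs_of_pos hl] at h
    linarith
  have hexp : ∃ c < (2 : ℝ), ∃ B,
      f =O[Bornology.cobounded ℂ ⊓ 𝓟 {z | 0 < z.re}] fun z ↦ Real.exp (B * ‖z‖ ^ c) := by
    obtain ⟨A, hA, hlow⟩ := one_le_exp_mul_norm_riemannZeta₁ hRH hl
    refine ⟨1, by norm_num, 1 + A, ?_⟩
    refine IsBigO.of_bound (C * (2 * (1 + 1 / a)) * Real.exp (2 + 2 * A)) ?_
    refine eventually_inf_principal.mpr (Eventually.of_forall fun z hz ↦ ?_)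
    have hz0 : 0 ≤ z.re := le_of_lt hz
    rw [Real.rpow_one, Real.norm_of_nonneg (Real.exp_pos _).le]
    refine (hfle z hz0).trans ?_
    have h1 := norm_riemannZeta₁_le_exp ha0 (w := z + 1 / 2 - l) (by simp; linarith)
    have h2 := hlow (z + 1 / 2 + l) (by simp; linarith)
    have h3 : 1 / ‖riemannZeta₁ (z + 1 / 2 + l)‖ ≤ Real.exp (A * (1 + ‖z + 1 / 2 + l‖)) := by
      rw [div_le_iff₀ (norm_pos_iff.mpr (hzne z hz0))]
      exact h2
    rw [div_eq_mul_one_div ‖riemannZeta₁ (z + 1 / 2 - l)‖]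
    calc C * (‖riemannZeta₁ (z + 1 / 2 - l)‖ * (1 / ‖riemannZeta₁ (z + 1 / 2 + l)‖))
        ≤ C * ((2 * (1 + 1 / a) * Real.exp (‖z‖ + 1 + 1)) * Real.exp (A * (1 + (‖z‖ + 1)))) := by
          gcongr
          · exact h1.trans (by gcongr; exact hn1 z)
          · exact h3.trans (by gcongr; exact hn2 z)
      _ = C * (2 * (1 + 1 / a)) * (Real.exp (‖z‖ + 1 + 1) * Real.exp (A * (1 + (‖z‖ + 1)))) := by
          ring
      _ = C * (2 * (1 + 1 / a)) * (Real.exp (2 + 2 * A) * Real.exp ((1 + A) * ‖z‖)) := by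
          rw [← Real.exp_add, ← Real.exp_add]
          congr 2; ring
      _ = _ := by ring
  have hre : IsBoundedUnder (· ≤ ·) atTop fun x : ℝ ↦ ‖f x‖ := by
    refine isBoundedUnder_of_eventually_le (a := C * 16) ?_
    filter_upwards [eventually_ge_atTop (2 : ℝ)] with x hx
    refine (hfle x (by simp; linarith)).trans ?_
    gcongr
    have e1 : (x : ℂ) + 1 / 2 - l = ((x + 1 / 2 - l : ℝ) : ℂ) := by push_cast; ring
    have e2 : (x : ℂ) + 1 / 2 + l = ((x + 1 / 2 + l : ℝ) : ℂ) := by push_cast; ring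
    have h1 := norm_riemannZeta₁_le (s := ((x + 1 / 2 - l : ℝ) : ℂ))
      (by rw [ofReal_re]; linarith)
    have h2 := norm_riemannZeta₁_ge_mul (s := ((x + 1 / 2 + l : ℝ) : ℂ))
      (by rw [ofReal_re]; linarith)
    have h3 : (0 : ℝ) < x + 1 / 2 - l := by linarith
    rw [← ofReal_one, ← ofReal_sub, norm_real, norm_real, ofReal_re,
      Real.norm_of_nonneg h3.le, Real.norm_of_nonneg (by linarith),
      mul_div_cancel_left₀ _ h3.ne'] at h1
    rw [← ofReal_one, ← ofReal_sub, norm_real, Real.norm_of_nonneg (by linarith)] at h2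
    rw [e1, e2, div_le_iff₀ (by linarith)]
    linarith
  have him : ∀ x : ℝ, ‖f (x * I)‖ ≤ 1 := by
    intro x
    simp only [hf]
    rw [norm_div, norm_xi_critical hl hl2]
    exact div_self_le_one _
  have hs0 : 0 ≤ (s - 1 / 2).re := by simp; linarith
  have hmain := PhragmenLindelof.right_half_plane_of_bounded_on_real hd hexp hre him hs0
  simp only [hf, sub_add_cancel] at hmain
  have h5 := hne (s - 1 / 2) hs0
  rw [sub_add_cancel] at h5
  rwa [norm_div, div_le_one (norm_pos_iff.mpr h5)] at hmain

/-- Under RH, the logarithmic derivative of `ξ` has nonnegative real part on `Re s > 1/2`. -/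
theorem logDeriv_xi_re_nonneg (hRH : RiemannHypothesis) {s : ℂ} (hs : 1 / 2 < s.re) :
    0 ≤ (logDeriv xi s).re := by
  have hd : HasDerivAt xi (deriv xi s) s := (differentiableAt_xi (by linarith)).hasDerivAt
  have hp : HasDerivAt (fun r : ℝ ↦ xi (s + r)) (deriv xi s) 0 := by
    have : HasDerivAt (fun z : ℂ ↦ xi (s + z)) (deriv xi s) ((0 : ℝ) : ℂ) := by
      refine HasDerivAt.comp_const_add s _ ?_
      simpa using hd
    exact this.comp_ofReal
  have hm : HasDerivAt (fun r : ℝ ↦ xi (s - r)) (-deriv xi s) 0 := by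
    have : HasDerivAt (fun z : ℂ ↦ xi (s - z)) (-deriv xi s) ((0 : ℝ) : ℂ) := by
      refine HasDerivAt.comp_const_sub s _ ?_
      simpa using hd
    exact this.comp_ofReal
  have h1 := hp.norm_sq.sub hm.norm_sq
  simp only [ofReal_zero, add_zero, sub_zero, inner_neg_right] at h1
  have hv : 0 ≤ inner ℝ (xi s) (deriv xi s) := by
    have ht := h1.hasDerivWithinAt (s := Ioi 0)
    rw [hasDerivWithinAt_iff_tendsto_slope' (by simp)] at ht
    have h2 : 0 ≤ 2 * inner ℝ (xi s) (deriv xi s) - 2 * -inner ℝ (xi s) (deriv xi s) := by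
      refine ge_of_tendsto ht ?_
      have : Ioo (0 : ℝ) (1 / 2) ∈ 𝓝[>] (0 : ℝ) := Ioo_mem_nhdsGT (by norm_num)
      filter_upwards [this] with r hr
      have h3 := norm_xi_sub_le hRH hr.1 hr.2 hs.le
      have h4 : ‖xi (s - r)‖ ^ 2 ≤ ‖xi (s + r)‖ ^ 2 := by gcongr
      rw [slope_def_field]
      refine div_nonneg ?_ (by linarith [hr.1])
      simp only [Pi.sub_apply, ofReal_zero, add_zero, sub_zero]
      linarith
    linarith
  rw [logDeriv_apply, div_eq_mul_inv, Complex.inv_def, ← mul_assoc]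
  rw [re_mul_ofReal]
  refine mul_nonneg ?_ (inv_nonneg.mpr (normSq_nonneg _))
  rw [Complex.inner] at hv
  exact hv

end Xi

/-! ### Gauss' integral for the digamma function -/

section Digamma
open Complex Set Topology

lemma norm_one_sub_cpow_le {z : ℂ} (hz : 1 ≤ z.re) {x : ℝ} (hx : x ∈ Ioc (0 : ℝ) 1) :
    ‖1 - (x : ℂ) ^ z‖ ≤ ‖z‖ * (1 - x) := by
  have hder : ∀ t ∈ Icc x 1, HasDerivWithinAt (fun t : ℝ ↦ (t : ℂ) ^ z) (z * (t : ℂ) ^ (z - 1))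
      (Icc x 1) t := by
    intro t ht
    have ht0 : 0 < t := hx.1.trans_le ht.1
    have hz0 : z ≠ 0 := by rintro rfl; norm_num at hz
    exact (hasDerivAt_ofReal_cpow_const ht0.ne' hz0).hasDerivWithinAt
  have := (convex_Icc x 1).norm_image_sub_le_of_norm_hasDerivWithin_le (C := ‖z‖) hder ?_
    (left_mem_Icc.mpr hx.2) (right_mem_Icc.mpr hx.2)
  · simpa [Real.norm_of_nonneg (sub_nonneg.mpr hx.2)] using this
  · intro t ht
    have ht0 : 0 < t := hx.1.trans_le ht.1
    rw [norm_mul, norm_cpow_eq_rpow_re_of_pos ht0]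
    refine mul_le_of_le_one_right (norm_nonneg _) (Real.rpow_le_one ht0.le ht.2 ?_)
    simpa using hz

lemma tendsto_beta_sub {z : ℂ} (hz : 1 ≤ z.re) :
    Tendsto (fun l : ℝ ↦ betaIntegral 1 l - betaIntegral (z + 1) l) (𝓝[>] 0)
      (𝓝 (∫ x : ℝ in 0..1, (1 - (x : ℂ) ^ z) * (1 - (x : ℂ)) ^ (-1 : ℂ))) := by
  have hev : (fun l : ℝ ↦ ∫ x : ℝ in 0..1, (1 - (x : ℂ) ^ z) * (1 - (x : ℂ)) ^ ((l : ℂ) - 1))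
      =ᶠ[𝓝[>] 0] fun l : ℝ ↦ betaIntegral 1 l - betaIntegral (z + 1) l := by
    filter_upwards [self_mem_nhdsWithin] with l hl
    have hl' : (0 : ℝ) < (l : ℂ).re := by simpa using hl
    have h1 := betaIntegral_convergent (u := 1) (v := l) (by simp) hl'
    have h2 := betaIntegral_convergent (u := z + 1) (v := l) (by simp; linarith) hl'
    rw [betaIntegral, betaIntegral, ← intervalIntegral.integral_sub h1 h2]
    congr 1
    ext x
    simp
    ring
  refine Tendsto.congr' hev ?_
  refine intervalIntegral.tendsto_integral_filter_of_dominated_convergence (fun _ ↦ ‖z‖) ?_ ?_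
    (by simp) ?_
  · filter_upwards with l
    refine Measurable.aestronglyMeasurable ?_
    fun_prop
  · filter_upwards [self_mem_nhdsWithin] with l hl
    have hl0 : (0 : ℝ) < l := hl
    have hne : ∀ᵐ x : ℝ, x ≠ 1 := by simp [ae_iff]
    filter_upwards [hne] with x hx1 hx
    rw [uIoc_of_le zero_le_one] at hx
    have hx2 : 0 < 1 - x := sub_pos.mpr (lt_of_le_of_ne hx.2 hx1)
    rw [norm_mul, ← ofReal_one, ← ofReal_sub, norm_cpow_eq_rpow_re_of_pos hx2, ofReal_one]
    have h3 := norm_one_sub_cpow_le hz hx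
    have h4 : (1 - x) * (1 - x) ^ (l - 1) = (1 - x) ^ l := by
      rw [Real.rpow_sub_one hx2.ne']; field_simp
    have h5 : (1 - x) ^ l ≤ 1 := Real.rpow_le_one hx2.le (by linarith [hx.1]) hl0.le
    calc ‖1 - (x : ℂ) ^ z‖ * (1 - x) ^ (((l : ℂ) - 1).re)
        ≤ ‖z‖ * (1 - x) * (1 - x) ^ (l - 1) := by
          simp only [sub_re, ofReal_re, one_re]; gcongr
      _ = ‖z‖ * (1 - x) ^ l := by rw [mul_assoc, h4]
      _ ≤ ‖z‖ := mul_le_of_le_one_right (norm_nonneg _) h5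
  · have hne : ∀ᵐ x : ℝ, x ≠ 1 := by simp [ae_iff]
    filter_upwards [hne] with x hx1 _
    refine Tendsto.const_mul _ ?_
    have h6 : (1 : ℂ) - x ≠ 0 := by
      rw [sub_ne_zero]; exact_mod_cast hx1.symm
    have hc : Continuous fun l : ℝ ↦ ((1 : ℂ) - x) ^ ((l : ℂ) - 1) :=
      Continuous.const_cpow (by fun_prop) (Or.inl h6)
    have := hc.tendsto 0
    simp only [ofReal_zero, zero_sub] at this
    exact this.mono_left nhdsWithin_le_nhds

lemma tendsto_beta_sub_digamma {z : ℂ} (hz : 1 ≤ z.re) :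
    Tendsto (fun l : ℝ ↦ betaIntegral 1 l - betaIntegral (z + 1) l) (𝓝[>] 0)
      (𝓝 (Real.eulerMascheroniConstant + digamma (z + 1))) := by
  have hdG : ∀ w : ℂ, 0 < w.re → HasDerivAt Gamma (deriv Gamma w) w := by
    intro w hw
    refine (differentiableAt_Gamma _ fun m hm ↦ ?_).hasDerivAt
    have := congrArg re hm
    simp only [neg_re, natCast_re] at this
    have : (0 : ℝ) ≤ m := m.cast_nonneg
    linarith
  have hz1 : 0 < (z + 1).re := by simp; linarith
  have hGz : Gamma (z + 1) ≠ 0 := Gamma_ne_zero_of_re_pos hz1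
  set φ : ℂ → ℂ := fun l ↦ (Gamma (1 + l))⁻¹ - Gamma (z + 1) * (Gamma (z + 1 + l))⁻¹ with hφ
  have h1 : HasDerivAt (fun l : ℂ ↦ (Gamma (1 + l))⁻¹) (Real.eulerMascheroniConstant : ℂ) 0 := by
    have h : HasDerivAt (fun l : ℂ ↦ Gamma (1 + l)) (-(Real.eulerMascheroniConstant : ℂ)) 0 := by
      refine HasDerivAt.comp_const_add 1 _ ?_
      simpa using hasDerivAt_Gamma_one
    have h' := h.fun_inv (by simp)
    simpa using h'
  have h2 : HasDerivAt (fun l : ℂ ↦ Gamma (z + 1) * (Gamma (z + 1 + l))⁻¹)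
      (-digamma (z + 1)) 0 := by
    have h : HasDerivAt (fun l : ℂ ↦ Gamma (z + 1 + l)) (deriv Gamma (z + 1)) 0 := by
      refine HasDerivAt.comp_const_add (z + 1) _ ?_
      simpa using hdG _ hz1
    have h' := (h.fun_inv (by simpa using hGz)).const_mul (Gamma (z + 1))
    refine h'.congr_deriv ?_
    rw [digamma_def, logDeriv_apply, add_zero]
    field_simp
  have hφ' : HasDerivAt φ ((Real.eulerMascheroniConstant : ℂ) + digamma (z + 1)) 0 := by
    have := h1.fun_sub h2
    rwa [sub_neg_eq_add] at this
  have hφ0 : φ 0 = 0 := by simp [hφ, hGz]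
  have hφr : Tendsto (fun l : ℝ ↦ φ l / l) (𝓝[>] 0)
      (𝓝 ((Real.eulerMascheroniConstant : ℂ) + digamma (z + 1))) := by
    have h := hasDerivAt_iff_tendsto_slope.mp hφ'
    have hmap : Tendsto (fun l : ℝ ↦ (l : ℂ)) (𝓝[>] 0) (𝓝[≠] 0) := by
      refine tendsto_nhdsWithin_iff.mpr ⟨?_, ?_⟩
      · have := continuous_ofReal.tendsto 0
        simp only [ofReal_zero] at this
        exact this.mono_left nhdsWithin_le_nhds
      · filter_upwards [self_mem_nhdsWithin] with l hl
        have : (0 : ℝ) < l := hl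
        simpa using this.ne'
    refine (h.comp hmap).congr fun l ↦ ?_
    simp [slope_def_field, hφ0]
  have hG1 : Tendsto (fun l : ℝ ↦ Gamma ((l : ℂ) + 1)) (𝓝[>] 0) (𝓝 1) := by
    have hc : ContinuousAt Gamma ((0 : ℝ) + 1 : ℂ) := by
      simpa using hasDerivAt_Gamma_one.continuousAt
    have h2 : Tendsto (fun l : ℝ ↦ (l : ℂ) + 1) (𝓝[>] 0) (𝓝 ((0 : ℝ) + 1 : ℂ)) :=
      (Continuous.tendsto (by fun_prop) _).mono_left nhdsWithin_le_nhds
    have := hc.tendsto.comp h2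
    simpa [Function.comp_def] using this
  have hmul := hG1.mul hφr
  rw [one_mul] at hmul
  refine hmul.congr' ?_
  filter_upwards [self_mem_nhdsWithin] with l hl
  have hl0 : (0 : ℝ) < l := hl
  have hlc : (l : ℂ) ≠ 0 := by exact_mod_cast hl0.ne'
  have hl' : (0 : ℝ) < (l : ℂ).re := by simpa using hl
  rw [betaIntegral_eq_Gamma_mul_div _ _ (by simp) hl', betaIntegral_eq_Gamma_mul_div _ _ hz1 hl',
    Gamma_add_one _ hlc, Gamma_one]
  simp only [hφ]
  field_simp

/-- Gauss' integral representation of the digamma function. -/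
theorem digamma_add_one_eq {z : ℂ} (hz : 1 ≤ z.re) :
    digamma (z + 1) = -(Real.eulerMascheroniConstant : ℂ) +
      ∫ w in Ioi (0 : ℝ), (1 - exp (-z * w)) / (exp w - 1) := by
  have h1 := tendsto_nhds_unique (tendsto_beta_sub_digamma hz) (tendsto_beta_sub hz)
  have himg : (fun w : ℝ ↦ Real.exp (-w)) '' Ioi 0 = Ioo 0 1 := by
    ext x
    simp only [mem_image, mem_Ioi, mem_Ioo]
    constructor
    · rintro ⟨w, hw, rfl⟩
      exact ⟨Real.exp_pos _, by simpa using hw⟩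
    · rintro ⟨h0, h1⟩
      exact ⟨-Real.log x, by simpa using Real.log_neg h0 h1, by simp [Real.exp_log h0]⟩
  have hsub := integral_image_eq_integral_abs_deriv_smul (s := Ioi (0 : ℝ)) measurableSet_Ioi
    (f := fun w : ℝ ↦ Real.exp (-w)) (f' := fun w ↦ -Real.exp (-w))
    (fun w _ ↦ by
      have := ((hasDerivAt_id w).fun_neg.exp).hasDerivWithinAt (s := Ioi 0)
      simpa using this)
    (fun a _ b _ h ↦ by simpa using h)
    (fun x : ℝ ↦ (1 - (x : ℂ) ^ z) * (1 - (x : ℂ)) ^ (-1 : ℂ))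
  rw [himg] at hsub
  rw [intervalIntegral.integral_of_le zero_le_one, integral_Ioc_eq_integral_Ioo, hsub] at h1
  have h2 : ∫ w in Ioi (0 : ℝ), |-Real.exp (-w)| •
      ((1 - ((Real.exp (-w) : ℝ) : ℂ) ^ z) * (1 - ((Real.exp (-w) : ℝ) : ℂ)) ^ (-1 : ℂ)) =
      ∫ w in Ioi (0 : ℝ), (1 - exp (-z * w)) / (exp w - 1) := by
    refine setIntegral_congr_fun measurableSet_Ioi fun w hw ↦ ?_
    have hw0 : (0 : ℝ) < w := hw
    have hpos := Real.exp_pos (-w)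
    have hcp : ((Real.exp (-w) : ℝ) : ℂ) ^ z = exp (-z * w) := by
      rw [cpow_def_of_ne_zero (by exact_mod_cast hpos.ne'), ← ofReal_log hpos.le, Real.log_exp]
      congr 1; push_cast; ring
    have hE : exp (w : ℂ) ≠ 0 := exp_ne_zero _
    have hne : exp (w : ℂ) - 1 ≠ 0 := by
      rw [sub_ne_zero, ← ofReal_exp]
      have : Real.exp w ≠ 1 := (Real.one_lt_exp_iff.mpr hw0).ne'
      exact_mod_cast this
    rw [abs_neg, abs_of_pos hpos, hcp, cpow_neg_one, real_smul, ofReal_exp, ofReal_neg, exp_neg]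
    field_simp
  rw [h2] at h1
  rw [← h1]; ring

end Digamma

/-! ### The logarithmic derivative of the completed zeta function -/

section LogDerivXi
open Complex Set Topology

lemma self_div_exp_sub_one_le {w : ℝ} (hw : 0 < w) : w / (Real.exp w - 1) ≤ Real.exp (-w / 2) := by
  have h1 : 0 < Real.exp w - 1 := by linarith [Real.add_one_lt_exp hw.ne']
  have h2 : w / 2 ≤ Real.sinh (w / 2) := Real.self_le_sinh_iff.mpr (by linarith)
  rw [Real.sinh_eq] at h2
  rw [div_le_iff₀ h1, mul_sub, ← Real.exp_add, mul_one]
  have e1 : -w / 2 + w = w / 2 := by ring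
  have e2 : -(w / 2) = -w / 2 := by ring
  rw [e1]
  rw [e2] at h2
  linarith

lemma norm_one_sub_exp_neg_mul_le {z : ℂ} (hz : 0 ≤ z.re) {w : ℝ} (hw : 0 ≤ w) :
    ‖1 - exp (-z * w)‖ ≤ ‖z‖ * w := by
  have hder : ∀ t ∈ Icc 0 w, HasDerivWithinAt (fun t : ℝ ↦ exp (-z * t)) (exp (-z * t) * (-z))
      (Icc 0 w) t := by
    intro t _
    have h : HasDerivAt (fun y : ℂ ↦ exp (-z * y)) (exp (-z * t) * (-z)) (t : ℂ) := by
      simpa using ((hasDerivAt_id (t : ℂ)).const_mul (-z)).cexp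
    exact h.comp_ofReal.hasDerivWithinAt
  have := (convex_Icc 0 w).norm_image_sub_le_of_norm_hasDerivWithin_le (C := ‖z‖) hder ?_
    (right_mem_Icc.mpr hw) (left_mem_Icc.mpr hw)
  · simpa [abs_of_nonneg hw] using this
  · intro t ht
    rw [norm_mul, norm_neg, norm_exp]
    refine mul_le_of_le_one_left (norm_nonneg _) ?_
    simpa using mul_nonneg hz ht.1

lemma norm_one_sub_exp_div_le {z : ℂ} (hz : 0 ≤ z.re) {w : ℝ} (hw : 0 < w) :
    ‖(1 - exp (-z * w)) / (exp w - 1)‖ ≤ ‖z‖ * Real.exp (-w / 2) := by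
  have h1 : 0 < Real.exp w - 1 := by linarith [Real.add_one_lt_exp hw.ne']
  have h2 : ‖(exp w - 1 : ℂ)‖ = Real.exp w - 1 := by
    rw [← ofReal_exp, ← ofReal_one, ← ofReal_sub, norm_real, Real.norm_of_nonneg h1.le]
  rw [norm_div, h2]
  calc ‖1 - exp (-z * w)‖ / (Real.exp w - 1) ≤ ‖z‖ * w / (Real.exp w - 1) := by
        gcongr
        exact norm_one_sub_exp_neg_mul_le hz hw.le
    _ = ‖z‖ * (w / (Real.exp w - 1)) := by ring
    _ ≤ _ := by gcongr; exact self_div_exp_sub_one_le hw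

lemma integrableOn_exp_neg_half : IntegrableOn (fun w : ℝ ↦ Real.exp (-w / 2)) (Ioi 0) := by
  have := integrableOn_exp_mul_Ioi (a := -(1 / 2 : ℝ)) (by norm_num) 0
  refine this.congr_fun (fun w _ ↦ ?_) measurableSet_Ioi
  simp only
  ring_nf

lemma integral_exp_neg_half : ∫ w in Ioi (0 : ℝ), Real.exp (-w / 2) = 2 := by
  have := integral_exp_mul_Ioi (a := -(1 / 2 : ℝ)) (by norm_num) 0
  rw [setIntegral_congr_fun measurableSet_Ioi (g := fun w ↦ Real.exp (-(1 / 2) * w))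
    (fun w _ ↦ by simp only; ring_nf), this]
  norm_num

lemma logDeriv_xi_eq {s : ℂ} (hs : 2 ≤ s.re) :
    logDeriv xi s = -((Real.log π + Real.eulerMascheroniConstant : ℝ) : ℂ) / 2
      + (∫ w in Ioi (0 : ℝ), (1 - exp (-(s / 2) * w)) / (exp w - 1)) / 2
      + (∫ w in Ioi (0 : ℝ), exp (-(s - 1) * w))
      - LSeries (fun n ↦ (ArithmeticFunction.vonMangoldt n : ℂ)) s := by
  have hs0 : s ≠ 0 := by rintro rfl; norm_num at hs
  have hs1 : s - 1 ≠ 0 := by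
    intro h; rw [sub_eq_zero] at h; rw [h] at hs; norm_num at hs
  have hz1 : riemannZeta s ≠ 0 := riemannZeta_ne_zero_of_one_le_re (by linarith)
  have hz : riemannZeta₁ s ≠ 0 := by
    intro h
    exact hz1 (by rw [riemannZeta_eq_inv_sub_mul (sub_ne_zero.mp hs1), h, mul_zero])
  have hG : Gammaℝ s ≠ 0 := Gammaℝ_ne_zero_of_re_pos (by linarith)
  have hGd := differentiableAt_Gammaℝ (s := s) (by linarith)
  have hζd := differentiable_riemannZeta₁ s
  have hm : ∀ m : ℕ, s / 2 ≠ -m := by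
    intro m h
    have := congrArg re h
    simp at this
    have : (0 : ℝ) ≤ m := by positivity
    linarith
  have e1 : logDeriv xi s = s⁻¹ + logDeriv Gammaℝ s + logDeriv riemannZeta₁ s := by
    have : xi = fun z ↦ (z * Gammaℝ z) * riemannZeta₁ z := rfl
    rw [this, logDeriv_mul (f := fun z ↦ z * Gammaℝ z) s (mul_ne_zero hs0 hG) hz (by fun_prop) hζd,
      logDeriv_mul s hs0 hG (by fun_prop) hGd]
    simp [logDeriv_apply]
  have hGammad : DifferentiableAt ℂ Gamma (s / 2) := differentiableAt_Gamma _ hm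
  have e2 : logDeriv Gammaℝ s = -(Real.log π : ℂ) / 2 + digamma (s / 2) / 2 := by
    have hpi : (π : ℂ) ≠ 0 := ofReal_ne_zero.mpr Real.pi_ne_zero
    have hd1 : HasDerivAt (fun z : ℂ ↦ (π : ℂ) ^ (-z / 2))
        ((π : ℂ) ^ (-s / 2) * log π * (-1 / 2)) s :=
      (((hasDerivAt_id s).neg.div_const 2).const_cpow (Or.inl hpi))
    have : Gammaℝ = fun z ↦ (π : ℂ) ^ (-z / 2) * Gamma (z / 2) := by
      ext z; rw [Gammaℝ_def]
    rw [this, logDeriv_mul (f := fun z : ℂ ↦ (π : ℂ) ^ (-z / 2)) (g := fun z ↦ Gamma (z / 2)) s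
      (by simp [hpi]) (Gamma_ne_zero hm) hd1.differentiableAt (by fun_prop)]
    congr 1
    · rw [logDeriv_apply, hd1.deriv, ← ofReal_log Real.pi_pos.le]
      have : (π : ℂ) ^ (-s / 2) ≠ 0 := by simp [hpi]
      field_simp
    · have := logDeriv_comp (f := Gamma) (g := fun z : ℂ ↦ z / 2) (x := s) hGammad (by fun_prop)
      rw [Function.comp_def] at this
      rw [this]
      simp [digamma, div_eq_mul_inv]
  have e3 : logDeriv riemannZeta₁ s = 1 / (s - 1) + logDeriv riemannZeta s := by
    have hev : riemannZeta₁ =ᶠ[𝓝 s] fun z ↦ (z - 1) * riemannZeta z := by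
      filter_upwards [isOpen_ne.mem_nhds (sub_ne_zero.mp hs1)] with z hz
      rw [riemannZeta_eq_inv_sub_mul hz, ← mul_assoc, mul_inv_cancel₀ (sub_ne_zero.mpr hz), one_mul]
    rw [logDeriv_apply, hev.deriv_eq, hev.eq_of_nhds, ← logDeriv_apply,
      logDeriv_mul s hs1 hz1 (by fun_prop) (differentiableAt_riemannZeta (sub_ne_zero.mp hs1))]
    simp [logDeriv_apply]
  have e4 : digamma (s / 2) = digamma (s / 2 + 1) - 2 / s := by
    rw [digamma_apply_add_one _ hm]; simp
  have e5 : ∫ w in Ioi (0 : ℝ), exp (-(s - 1) * w) = 1 / (s - 1) := by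
    rw [integral_exp_mul_complex_Ioi (by simp; linarith), ofReal_zero, mul_zero, exp_zero,
      neg_div_neg_eq]
  rw [e1, e2, e3, e4, digamma_add_one_eq (by simp; linarith), e5,
    ArithmeticFunction.LSeries_vonMangoldt_eq_deriv_riemannZeta_div (by linarith), logDeriv_apply]
  push_cast
  field_simp
  ring

lemma exists_norm_logDeriv_xi_le_two :
    ∃ K : ℝ, 0 < K ∧ ∀ s : ℂ, s.re = 2 → ‖logDeriv xi s‖ ≤ K * (1 + |s.im|) := by
  set Λs : ℝ := ∑' n, ‖LSeries.term (fun n ↦ (ArithmeticFunction.vonMangoldt n : ℂ)) 2 n‖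
  have hΛ0 : 0 ≤ Λs := tsum_nonneg fun _ ↦ norm_nonneg _
  set C : ℝ := ‖-((Real.log π + Real.eulerMascheroniConstant : ℝ) : ℂ) / 2‖
  have hC : 0 ≤ C := norm_nonneg _
  refine ⟨C + 4 + Λs, by linarith, fun s hs ↦ ?_⟩
  have hsn : ‖s‖ ≤ 2 + |s.im| := by
    have := norm_le_abs_re_add_abs_im s
    rwa [hs, abs_of_pos (by norm_num : (0 : ℝ) < 2)] at this
  have h1 : ‖∫ w in Ioi (0 : ℝ), (1 - exp (-(s / 2) * w)) / (exp w - 1)‖ ≤ ‖s‖ := by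
    calc _ ≤ ∫ w in Ioi (0 : ℝ), ‖s / 2‖ * Real.exp (-w / 2) := by
          refine norm_integral_le_of_norm_le (integrableOn_exp_neg_half.const_mul _) ?_
          filter_upwards [ae_restrict_mem measurableSet_Ioi] with w hw
          exact norm_one_sub_exp_div_le (by simp [hs]) hw
      _ = ‖s‖ := by
          rw [integral_const_mul, integral_exp_neg_half]; simp
  have h2 : ‖∫ w in Ioi (0 : ℝ), exp (-(s - 1) * w)‖ ≤ 1 := by
    rw [integral_exp_mul_complex_Ioi (by simp; linarith)]
    simp only [ofReal_zero, mul_zero, exp_zero, neg_div_neg_eq, norm_div, norm_one]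
    have : 1 ≤ ‖s - 1‖ := by
      have := abs_re_le_norm (s - 1)
      simp only [sub_re, one_re, hs] at this
      norm_num at this
      exact this
    exact div_le_one_of_le₀ this (norm_nonneg _)
  have h3 : ‖LSeries (fun n ↦ (ArithmeticFunction.vonMangoldt n : ℂ)) s‖ ≤ Λs := by
    have hn : ∀ n, ‖LSeries.term (fun n ↦ (ArithmeticFunction.vonMangoldt n : ℂ)) s n‖
        = ‖LSeries.term (fun n ↦ (ArithmeticFunction.vonMangoldt n : ℂ)) 2 n‖ := by
      intro n; simp [LSeries.norm_term_eq, hs]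
    rw [LSeries]
    refine (norm_tsum_le_tsum_norm ?_).trans_eq (tsum_congr hn)
    exact (ArithmeticFunction.LSeriesSummable_vonMangoldt (s := s) (by linarith)).norm
  rw [logDeriv_xi_eq hs.ge]
  refine (norm_sub_le _ _).trans ?_
  refine (add_le_add_left ((norm_add_le _ _).trans (add_le_add_left (norm_add_le _ _) _)) _).trans ?_
  rw [norm_div (∫ w in Ioi (0 : ℝ), _) (2 : ℂ), norm_ofNat]
  have := abs_nonneg s.im
  nlinarith [mul_nonneg hC this, mul_nonneg hΛ0 this]

lemma differentiableAt_logDeriv_xi (hRH : RiemannHypothesis) {s : ℂ} (hs : 1 / 2 < s.re) :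
    DifferentiableAt ℂ (logDeriv xi) s := by
  have hx : DifferentiableOn ℂ xi {z | 1 / 2 < z.re} := fun w hw ↦
    (differentiableAt_xi (by have : 1 / 2 < w.re := hw; linarith)).differentiableWithinAt
  have hopen : IsOpen {z : ℂ | 1 / 2 < z.re} := isOpen_lt continuous_const continuous_re
  exact ((hx.deriv hopen).differentiableAt (hopen.mem_nhds hs)).div
    (hx.differentiableAt (hopen.mem_nhds hs)) (xi_ne_zero hRH hs)

lemma exists_norm_logDeriv_xi_le (hRH : RiemannHypothesis) {σ : ℝ} (hσ : 1 / 2 < σ) :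
    ∃ K : ℝ, 0 < K ∧ ∀ s : ℂ, σ ≤ s.re → s.re ≤ 2 → ‖logDeriv xi s‖ ≤ K * (1 + |s.im|) := by
  obtain ⟨K, hK, hKb⟩ := exists_norm_logDeriv_xi_le_two
  rcases le_or_gt σ 2 with hσ2 | hσ2
  swap
  · exact ⟨1, one_pos, fun s h1 h2 ↦ by linarith⟩
  set r := 2 - σ
  set R : ℝ := 3 / 2
  have hr : 0 ≤ r := by simp only [r]; linarith
  have hrR : 0 < R - r := by simp only [r, R]; linarith
  refine ⟨(2 * r + K * (R + r)) / (R - r) + 1, by positivity, fun s h1 h2 ↦ ?_⟩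
  set c : ℂ := 2 + s.im * I with hc
  have hcre : c.re = 2 := by simp [hc]
  have hcim : c.im = s.im := by simp [hc]
  have hsc : s - c = ((s.re - 2 : ℝ) : ℂ) := by
    apply Complex.ext <;> simp [hc]
  have hn : ‖s - c‖ = 2 - s.re := by
    rw [hsc, norm_real, Real.norm_of_nonpos (by linarith)]; ring
  have hre : ∀ z ∈ Metric.ball (0 : ℂ) R, 1 / 2 < (c + z).re := by
    intro z hz
    rw [mem_ball_zero_iff] at hz
    have := (abs_le.mp ((abs_re_le_norm z).trans hz.le)).1
    have h3 := (abs_lt.mp ((abs_re_le_norm z).trans_lt hz)).1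
    simp only [add_re, hcre, R] at *
    linarith
  have hBC := borelCaratheodory (f := fun z ↦ -logDeriv xi (c + z)) (M := 1) (R := R)
    (z := s - c) one_pos ?_ ?_ (by norm_num [R]) ?_
  · simp only [norm_neg, add_sub_cancel, add_zero] at hBC
    rw [hn] at hBC
    have hQc := hKb c hcre
    rw [hcim] at hQc
    have him := abs_nonneg s.im
    have hd : 2 - s.re ≤ r := by simp only [r]; linarith
    have hd0 : 0 ≤ 2 - s.re := by linarith
    calc ‖logDeriv xi s‖ ≤ 2 * 1 * (2 - s.re) / (R - (2 - s.re))
          + ‖logDeriv xi c‖ * (R + (2 - s.re)) / (R - (2 - s.re)) := hBC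
      _ ≤ 2 * 1 * r / (R - r) + (K * (1 + |s.im|)) * (R + r) / (R - r) := by gcongr
      _ = (2 * r + K * (R + r) * (1 + |s.im|)) / (R - r) := by ring
      _ ≤ (2 * r * (1 + |s.im|) + K * (R + r) * (1 + |s.im|)) / (R - r) := by
          have : 2 * r ≤ 2 * r * (1 + |s.im|) :=
            le_mul_of_one_le_right (by positivity) (by linarith)
          exact div_le_div_of_nonneg_right (add_le_add_left this _) hrR.le
      _ = (2 * r + K * (R + r)) / (R - r) * (1 + |s.im|) := by ring
      _ ≤ _ := by gcongr; linarith
  · intro z hz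
    have hd := differentiableAt_logDeriv_xi hRH (hre z hz)
    have : DifferentiableAt ℂ (fun z ↦ -logDeriv xi (c + z)) z :=
      (hd.comp z (by fun_prop : DifferentiableAt ℂ (fun z ↦ c + z) z)).neg
    exact this.differentiableWithinAt
  · intro z hz
    have := logDeriv_xi_re_nonneg hRH (hre z hz)
    simp only [mem_ofPred_eq, neg_re]
    linarith
  · rw [mem_ball_zero_iff, hn]
    simp only [R]; linarith

end LogDerivXi

/-! ### Shifting a vertical line of integration -/

section Shift
open Complex Set Topology

lemma continuous_vertical {f : ℂ → ℂ} {x : ℝ} (hf : ∀ s : ℂ, s.re = x → DifferentiableAt ℂ f s) :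
    Continuous fun u : ℝ ↦ f (x + u * I) := by
  rw [continuous_iff_continuousAt]
  intro u
  have h : ContinuousAt f ((x : ℂ) + u * I) := (hf _ (by simp)).continuousAt
  exact ContinuousAt.comp (f := fun u : ℝ ↦ (x : ℂ) + u * I) (g := f) h (by fun_prop)

lemma integral_vertical_eq {f : ℂ → ℂ} {a b : ℝ} (hab : a ≤ b) {g : ℝ → ℝ} (hg : Integrable g)
    (hgt : Tendsto g atTop (𝓝 0)) (hgb : Tendsto g atBot (𝓝 0))
    (hf : ∀ s : ℂ, a ≤ s.re → s.re ≤ b → DifferentiableAt ℂ f s)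
    (hfg : ∀ s : ℂ, a ≤ s.re → s.re ≤ b → ‖f s‖ ≤ g s.im) :
    ∫ u : ℝ, f (a + u * I) = ∫ u : ℝ, f (b + u * I) := by
  have hInt : ∀ x, a ≤ x → x ≤ b → Integrable fun u : ℝ ↦ f (x + u * I) := by
    intro x hax hxb
    have hc := continuous_vertical (f := f) (x := x)
      fun s hs ↦ hf s (hs ▸ hax) (hs ▸ hxb)
    refine hg.mono' hc.aestronglyMeasurable (Eventually.of_forall fun u ↦ ?_)
    have := hfg (x + u * I) (by simpa using hax) (by simpa using hxb)
    simpa using this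
  have hvert : ∀ x, a ≤ x → x ≤ b → Tendsto (fun T : ℝ ↦ ∫ u : ℝ in -T..T, f (x + u * I)) atTop
      (𝓝 (∫ u : ℝ, f (x + u * I))) := fun x h1 h2 ↦
    intervalIntegral_tendsto_integral (hInt x h1 h2) tendsto_neg_atTop_atBot tendsto_id
  have hhor : ∀ {T : ℝ}, ‖∫ x : ℝ in a..b, f (x + T * I)‖ ≤ g T * (b - a) := by
    intro T
    have := intervalIntegral.norm_integral_le_of_norm_le_const (a := a) (b := b) (C := g T)
      (f := fun x : ℝ ↦ f (x + T * I)) ?_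
    · rwa [abs_of_nonneg (sub_nonneg.mpr hab)] at this
    · intro x hx
      rw [uIoc_of_le hab] at hx
      have := hfg (x + T * I) (by simpa using hx.1.le) (by simpa using hx.2)
      simpa using this
  have h1 : Tendsto (fun T : ℝ ↦ ∫ x : ℝ in a..b, f (x + T * I)) atTop (𝓝 0) :=
    squeeze_zero_norm (fun T ↦ hhor) (by simpa using hgt.mul_const (b - a))
  have h2 : Tendsto (fun T : ℝ ↦ ∫ x : ℝ in a..b, f (x + (-T : ℝ) * I)) atTop (𝓝 0) :=
    squeeze_zero_norm (fun T ↦ hhor)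
      (by simpa using (hgb.comp tendsto_neg_atTop_atBot).mul_const (b - a))
  have hrect : ∀ T : ℝ, (∫ x : ℝ in a..b, f (x + (-T : ℝ) * I)) - (∫ x : ℝ in a..b, f (x + T * I)) +
      I • (∫ y : ℝ in -T..T, f (b + y * I)) - I • (∫ y : ℝ in -T..T, f (a + y * I)) = 0 := by
    intro T
    have := integral_boundary_rect_eq_zero_of_differentiableOn f (a - T * I) (b + T * I) ?_
    · simpa using this
    · intro s hs
      have hs1 := hs.1
      simp only [mem_preimage, sub_re, ofReal_re, mul_re, I_re, mul_zero, ofReal_im, I_im,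
        zero_mul, sub_self, sub_zero, add_re, add_zero, uIcc_of_le hab] at hs1
      exact (hf s hs1.1 hs1.2).differentiableWithinAt
  have hlim := ((h2.sub h1).add ((hvert b hab le_rfl).const_smul I)).sub
    ((hvert a le_rfl hab).const_smul I)
  have := tendsto_nhds_unique (hlim.congr hrect) tendsto_const_nhds
  simp only [sub_zero, zero_add, smul_eq_mul] at this
  rw [sub_eq_zero] at this
  exact (mul_left_cancel₀ I_ne_zero this).symm

lemma integrable_one_add_abs_mul_exp {α : ℝ} (hα : 0 < α) :
    Integrable fun u : ℝ ↦ (1 + |u|) * Real.exp (-α * u ^ 2) := by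
  have h1 := integrable_exp_neg_mul_sq hα
  have h2 := (integrable_mul_exp_neg_mul_sq hα).norm
  refine (h1.add h2).congr (Eventually.of_forall fun u ↦ ?_)
  simp [add_mul]

lemma tendsto_one_add_abs_mul_exp {α : ℝ} (hα : 0 < α) :
    Tendsto (fun u : ℝ ↦ (1 + |u|) * Real.exp (-α * u ^ 2)) (cocompact ℝ) (𝓝 0) := by
  have h1 := tendsto_rpow_abs_mul_exp_neg_mul_sq_cocompact hα 0
  have h2 := tendsto_rpow_abs_mul_exp_neg_mul_sq_cocompact hα 1
  simpa [add_mul] using h1.add h2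

/-- The Gaussian weight that equals `exp (-α u² + i β u)` at `σ + i u`. -/
noncomputable def gaussWeight (α β σ : ℝ) (s : ℂ) : ℂ := exp (α * (s - σ) ^ 2 + β * (s - σ))

lemma norm_gaussWeight (α β σ : ℝ) (s : ℂ) : ‖gaussWeight α β σ s‖
    = Real.exp (α * (s.re - σ) ^ 2 + β * (s.re - σ)) * Real.exp (-α * s.im ^ 2) := by
  rw [gaussWeight, norm_exp, ← Real.exp_add]
  congr 1
  simp [pow_two]
  ring

lemma integral_gaussWeight_mul_logDeriv_xi (hRH : RiemannHypothesis) {α β σ : ℝ} (hα : 0 < α)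
    (hσ : 1 / 2 < σ) (hσ2 : σ ≤ 2) :
    ∫ u : ℝ, gaussWeight α β σ (σ + u * I) * logDeriv xi (σ + u * I)
      = ∫ u : ℝ, gaussWeight α β σ (2 + u * I) * logDeriv xi (2 + u * I) := by
  obtain ⟨K, hK, hKb⟩ := exists_norm_logDeriv_xi_le hRH hσ
  have hcoc := tendsto_one_add_abs_mul_exp hα
  rw [cocompact_eq_atBot_atTop, tendsto_sup] at hcoc
  set C := Real.exp (α * 4 + |β| * 2)
  have := integral_vertical_eq (f := fun s ↦ gaussWeight α β σ s * logDeriv xi s) hσ2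
    (g := fun u ↦ C * K * ((1 + |u|) * Real.exp (-α * u ^ 2)))
    ((integrable_one_add_abs_mul_exp hα).const_mul _) (by simpa using hcoc.2.const_mul (C * K))
    (by simpa using hcoc.1.const_mul (C * K)) ?_ ?_
  · simpa using this
  · intro s h1 h2
    refine DifferentiableAt.mul ?_ (differentiableAt_logDeriv_xi hRH (by linarith))
    unfold gaussWeight
    fun_prop
  · intro s h1 h2
    rw [norm_mul, norm_gaussWeight]
    have h3 : Real.exp (α * (s.re - σ) ^ 2 + β * (s.re - σ)) ≤ C := by
      refine Real.exp_le_exp.mpr (add_le_add ?_ ?_)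
      · gcongr; nlinarith
      · calc β * (s.re - σ) ≤ |β| * (s.re - σ) := 
            mul_le_mul_of_nonneg_right (le_abs_self β) (by linarith)
          _ ≤ |β| * 2 := by gcongr; linarith
    calc _ ≤ C * Real.exp (-α * s.im ^ 2) * (K * (1 + |s.im|)) := by
          gcongr; exact hKb s h1 h2
      _ = _ := by ring

lemma integral_gaussWeight_mul_exp {α β σ : ℝ} (hα : 0 < α) (v : ℝ) :
    ∫ u : ℝ, gaussWeight α β σ (2 + u * I) * exp (-(2 + u * I) * v)
      = ((√(π / α) * (Real.exp (-σ * v) * Real.exp (-(v - β) ^ 2 / (4 * α))) : ℝ) : ℂ) := by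
  have h1 : ∀ u : ℝ, gaussWeight α β σ (2 + u * I) * exp (-(2 + u * I) * v)
      = exp (-(α : ℂ) * u ^ 2 + (I * (2 * α * (2 - σ) + β - v)) * u
        + (α * (2 - σ) ^ 2 + β * (2 - σ) - 2 * v)) := by
    intro u
    rw [gaussWeight, ← exp_add]
    congr 1
    have : (u * I) ^ 2 = -(u : ℂ) ^ 2 := by rw [mul_pow, I_sq]; ring
    linear_combination (α : ℂ) * this
  simp_rw [h1]
  rw [integral_cexp_quadratic (by simpa using hα)]
  have hα' : (α : ℂ) ≠ 0 := ofReal_ne_zero.mpr hα.ne'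
  rw [ofReal_mul, Real.sqrt_eq_rpow, ofReal_cpow (by positivity), ← Real.exp_add, ofReal_exp]
  push_cast
  congr 2
  · simp
  · have : (I * (2 * α * (2 - σ) + β - v)) ^ 2 = -((2 * α * (2 - σ) + β - v : ℂ)) ^ 2 := by
      rw [mul_pow, I_sq]; ring
    rw [this]
    field_simp
    ring

lemma integrable_gaussWeight {α β σ : ℝ} (hα : 0 < α) :
    Integrable fun u : ℝ ↦ (1 + |u|) * ‖gaussWeight α β σ (2 + u * I)‖ := by
  refine ((integrable_one_add_abs_mul_exp hα).const_mul
    (Real.exp (α * (2 - σ) ^ 2 + β * (2 - σ)))).congr (Eventually.of_forall fun u ↦ ?_)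
  simp only [norm_gaussWeight]
  simp
  ring

lemma continuous_gaussWeight (α β σ : ℝ) : Continuous (gaussWeight α β σ) := by
  unfold gaussWeight; fun_prop

end Shift

/-! ### The explicit formula for Gaussian test functions -/

section Explicit
open Complex Set Topology
open ArithmeticFunction (vonMangoldt)

/-- The Gaussian `v ↦ exp (-(v - β)² / (4α))`. -/
noncomputable def gauss (α β v : ℝ) : ℝ := Real.exp (-(v - β) ^ 2 / (4 * α))

/-- The arithmetic side of the explicit formula on the line `Re s = σ`, applied to the transform
`k` of a test function. -/
noncomputable def weilForm (σ : ℝ) (k : ℝ → ℝ) : ℝ :=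
  -(Real.log π + Real.eulerMascheroniConstant) / 2 * k 0
    + (∫ w in Ioi (0 : ℝ), (k 0 - Real.exp (-σ * (w / 2)) * k (w / 2)) / (Real.exp w - 1)) / 2
    + (∫ w in Ioi (0 : ℝ), Real.exp w * (Real.exp (-σ * w) * k w))
    - ∑' n : ℕ, vonMangoldt n * (Real.exp (-σ * Real.log n) * k (Real.log n))

lemma integrable_gaussWeight_mul {α β σ : ℝ} (hα : 0 < α) {f : ℝ → ℂ} (hf : AEStronglyMeasurable f) {C : ℝ}
    (hfC : ∀ u, ‖f u‖ ≤ C * (1 + |u|)) :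
    Integrable fun u : ℝ ↦ gaussWeight α β σ (2 + u * I) * f u := by
  refine ((integrable_gaussWeight (β := β) (σ := σ) hα).const_mul C).mono'
    (((continuous_gaussWeight α β σ).comp (by fun_prop)).aestronglyMeasurable.mul hf)
    (Eventually.of_forall fun u ↦ ?_)
  rw [norm_mul]
  calc _ ≤ ‖gaussWeight α β σ (2 + u * I)‖ * (C * (1 + |u|)) := by gcongr; exact hfC u
    _ = _ := by ring

lemma integrable_gaussWeight_prod {α β σ : ℝ} (hα : 0 < α) {F : ℝ × ℝ → ℂ} (hF : Measurable F) {g : ℝ → ℝ}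
    (hg : IntegrableOn g (Ioi 0)) (hFg : ∀ u, ∀ w > 0, ‖F (u, w)‖ ≤ (1 + |u|) * g w) :
    Integrable (fun p : ℝ × ℝ ↦ gaussWeight α β σ (2 + p.1 * I) * F p)
      (volume.prod (volume.restrict (Ioi 0))) := by
  refine ((integrable_gaussWeight (β := β) (σ := σ) hα).mul_prod hg).mono'
    (((continuous_gaussWeight α β σ).comp (by fun_prop)).measurable.mul hF).aestronglyMeasurable ?_
  have : ∀ᵐ p : ℝ × ℝ ∂(volume.prod (volume.restrict (Ioi 0))), 0 < p.2 :=
    (Measure.quasiMeasurePreserving_snd).ae (ae_restrict_mem measurableSet_Ioi)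
  filter_upwards [this] with p hp
  rw [norm_mul]
  calc _ ≤ ‖gaussWeight α β σ (2 + p.1 * I)‖ * ((1 + |p.1|) * g p.2) := by
        gcongr; exact hFg p.1 p.2 hp
    _ = _ := by ring

lemma integral_gaussWeight_mul_integral {α β σ : ℝ} (hα : 0 < α) {F : ℝ × ℝ → ℂ} (hF : Measurable F) {g : ℝ → ℝ}
    (hg : IntegrableOn g (Ioi 0)) (hFg : ∀ u, ∀ w > 0, ‖F (u, w)‖ ≤ (1 + |u|) * g w) :
    Integrable (fun u : ℝ ↦ gaussWeight α β σ (2 + u * I) * ∫ w in Ioi (0 : ℝ), F (u, w)) ∧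
    ∫ u : ℝ, gaussWeight α β σ (2 + u * I) * ∫ w in Ioi (0 : ℝ), F (u, w)
      = ∫ w in Ioi (0 : ℝ), ∫ u : ℝ, gaussWeight α β σ (2 + u * I) * F (u, w) := by
  have h := integrable_gaussWeight_prod (β := β) (σ := σ) hα hF hg hFg
  simp_rw [← integral_const_mul]
  exact ⟨h.integral_prod_left, integral_integral_swap h⟩

lemma integrable_gaussWeight_mul_exp {α β σ : ℝ} (hα : 0 < α) (v : ℝ) :
    Integrable fun u : ℝ ↦ gaussWeight α β σ (2 + u * I) * exp (-(2 + u * I) * v) := by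
  refine integrable_gaussWeight_mul hα (C := Real.exp (-2 * v))
    (Continuous.aestronglyMeasurable (by fun_prop)) fun u ↦ ?_
  rw [norm_exp]
  have : (-(2 + u * I) * (v : ℂ)).re = -2 * v := by simp
  rw [this]
  exact le_mul_of_one_le_right (Real.exp_pos _).le (by linarith [abs_nonneg u])

lemma integral_gaussWeight_digamma {α β σ : ℝ} (hα : 0 < α) :
    Integrable (fun u : ℝ ↦ gaussWeight α β σ (2 + u * I) *
      ∫ w in Ioi (0 : ℝ), (1 - exp (-((2 + u * I) / 2) * w)) / (exp w - 1)) ∧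
    ∫ u : ℝ, gaussWeight α β σ (2 + u * I) *
      ∫ w in Ioi (0 : ℝ), (1 - exp (-((2 + u * I) / 2) * w)) / (exp w - 1)
      = ((√(π / α) * ∫ w in Ioi (0 : ℝ), (gauss α β 0
        - Real.exp (-σ * (w / 2)) * gauss α β (w / 2)) / (Real.exp w - 1) : ℝ) : ℂ) := by
  have hb : ∀ u : ℝ, ∀ w : ℝ, w > 0 → ‖(1 - exp (-((2 + u * I) / 2) * w)) / (exp w - 1)‖
      ≤ (1 + |u|) * Real.exp (-w / 2) := by
    intro u w hw
    refine (norm_one_sub_exp_div_le (by simp) hw).trans ?_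
    gcongr
    have := norm_le_abs_re_add_abs_im ((2 + u * I) / 2)
    simp only [div_ofNat_re, add_re, re_ofNat, mul_re, ofReal_re, I_re, mul_zero, ofReal_im, I_im,
      mul_one, sub_self, add_zero, div_ofNat_im, add_im, im_ofNat, mul_im, zero_add,
      abs_div, Nat.abs_ofNat] at this
    norm_num at this ⊢
    linarith [abs_nonneg u]
  obtain ⟨h1, h2⟩ := integral_gaussWeight_mul_integral (β := β) (σ := σ) hα
    (F := fun p : ℝ × ℝ ↦ (1 - exp (-((2 + p.1 * I) / 2) * p.2)) / (exp p.2 - 1))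
    (by fun_prop) integrableOn_exp_neg_half hb
  refine ⟨h1, h2.trans ?_⟩
  rw [ofReal_mul, ← integral_complex_ofReal, ← integral_const_mul]
  refine integral_congr_ae (Eventually.of_forall fun w ↦ ?_)
  simp only
  have e : ∀ u : ℝ, gaussWeight α β σ (2 + u * I) *
      ((1 - exp (-((2 + u * I) / 2) * w)) / (exp w - 1))
      = (exp w - 1)⁻¹ * (gaussWeight α β σ (2 + u * I) * exp (-(2 + u * I) * (0 : ℝ))
        - gaussWeight α β σ (2 + u * I) * exp (-(2 + u * I) * (w / 2 : ℝ))) := by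
    intro u
    have : -((2 + u * I) / 2) * w = -(2 + u * I) * ((w / 2 : ℝ) : ℂ) := by push_cast; ring
    rw [this]
    simp only [ofReal_zero, mul_zero, exp_zero]
    ring
  simp_rw [e]
  rw [integral_const_mul, integral_sub (integrable_gaussWeight_mul_exp hα _)
    (integrable_gaussWeight_mul_exp hα _), integral_gaussWeight_mul_exp hα,
    integral_gaussWeight_mul_exp hα]
  simp only [gauss]
  push_cast
  simp
  ring

lemma integral_gaussWeight_pole {α β σ : ℝ} (hα : 0 < α) :
    Integrable (fun u : ℝ ↦ gaussWeight α β σ (2 + u * I) *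
      ∫ w in Ioi (0 : ℝ), exp (-((2 + u * I) - 1) * w)) ∧
    ∫ u : ℝ, gaussWeight α β σ (2 + u * I) * ∫ w in Ioi (0 : ℝ), exp (-((2 + u * I) - 1) * w)
      = ((√(π / α) * ∫ w in Ioi (0 : ℝ), Real.exp w *
        (Real.exp (-σ * w) * gauss α β w) : ℝ) : ℂ) := by
  have hb : ∀ u : ℝ, ∀ w : ℝ, w > 0 → ‖exp (-((2 + u * I) - 1) * w)‖
      ≤ (1 + |u|) * Real.exp (-w / 2) := by
    intro u w hw
    rw [norm_exp]
    have : (-((2 + (u : ℂ) * I) - 1) * (w : ℂ)).re = -w := by simp; ring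
    rw [this]
    calc Real.exp (-w) ≤ Real.exp (-w / 2) := Real.exp_le_exp.mpr (by linarith)
      _ ≤ _ := le_mul_of_one_le_left (Real.exp_pos _).le (by linarith [abs_nonneg u])
  obtain ⟨h1, h2⟩ := integral_gaussWeight_mul_integral (β := β) (σ := σ) hα
    (F := fun p : ℝ × ℝ ↦ exp (-((2 + p.1 * I) - 1) * p.2))
    (by fun_prop) integrableOn_exp_neg_half hb
  refine ⟨h1, h2.trans ?_⟩
  rw [ofReal_mul, ← integral_complex_ofReal, ← integral_const_mul]
  refine integral_congr_ae (Eventually.of_forall fun w ↦ ?_)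
  simp only
  have e : ∀ u : ℝ, gaussWeight α β σ (2 + u * I) * exp (-((2 + u * I) - 1) * w)
      = exp w * (gaussWeight α β σ (2 + u * I) * exp (-(2 + u * I) * w)) := by
    intro u
    have : -((2 + u * I) - 1) * w = w + -(2 + u * I) * (w : ℂ) := by ring
    rw [this, exp_add]
    ring
  simp_rw [e]
  rw [integral_const_mul, integral_gaussWeight_mul_exp hα]
  simp only [gauss]
  push_cast
  ring

lemma integral_gaussWeight_LSeries {α β σ : ℝ} (hα : 0 < α) :
    ∫ u : ℝ, gaussWeight α β σ (2 + u * I) * LSeries (fun n ↦ (vonMangoldt n : ℂ)) (2 + u * I)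
      = ((√(π / α) * ∑' n : ℕ, vonMangoldt n *
        (Real.exp (-σ * Real.log n) * gauss α β (Real.log n)) : ℝ) : ℂ) := by
  have hterm : ∀ (n : ℕ) (u : ℝ), LSeries.term (fun n ↦ (vonMangoldt n : ℂ)) (2 + u * I) n
      = vonMangoldt n * exp (-(2 + u * I) * (Real.log n : ℝ)) := by
    intro n u
    rcases eq_or_ne n 0 with rfl | hn
    · simp
    · rw [LSeries.term_of_ne_zero hn, cpow_def_of_ne_zero (Nat.cast_ne_zero.mpr hn),
        ← natCast_log, div_eq_mul_inv, ← exp_neg]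
      congr 2
      ring
  have hsum : ∀ u : ℝ, gaussWeight α β σ (2 + u * I) *
      LSeries (fun n ↦ (vonMangoldt n : ℂ)) (2 + u * I)
      = ∑' n : ℕ, vonMangoldt n *
        (gaussWeight α β σ (2 + u * I) * exp (-(2 + u * I) * (Real.log n : ℝ))) := by
    intro u
    rw [LSeries, ← tsum_mul_left]
    refine tsum_congr fun n ↦ ?_
    rw [hterm]
    ring
  have hInt : ∀ n : ℕ, Integrable fun u : ℝ ↦ (vonMangoldt n : ℂ) *
      (gaussWeight α β σ (2 + u * I) * exp (-(2 + u * I) * (Real.log n : ℝ))) := fun n ↦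
    (integrable_gaussWeight_mul_exp hα _).const_mul _
  have hsumm : Summable fun n : ℕ ↦ ∫ u : ℝ, ‖(vonMangoldt n : ℂ) *
      (gaussWeight α β σ (2 + u * I) * exp (-(2 + u * I) * (Real.log n : ℝ)))‖ := by
    have h2 : Summable fun n ↦ ‖LSeries.term (fun n ↦ (vonMangoldt n : ℂ)) 2 n‖ :=
      (ArithmeticFunction.LSeriesSummable_vonMangoldt (s := 2) (by simp)).norm
    refine (h2.mul_right (∫ u : ℝ, ‖gaussWeight α β σ (2 + u * I)‖)).congr fun n ↦ ?_
    rw [← integral_const_mul]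
    congr 1
    ext u
    have := hterm n 0
    simp only [ofReal_zero, zero_mul, add_zero] at this
    rw [this]
    simp only [norm_mul, norm_exp]
    have : (-(2 + u * I) * ((Real.log n : ℝ) : ℂ)).re = (-2 * ((Real.log n : ℝ) : ℂ)).re := by
      simp [-natCast_log]
    rw [this]
    ring
  have := (hasSum_integral_of_summable_integral_norm hInt hsumm).tsum_eq
  simp_rw [hsum]
  rw [← this, ofReal_mul, ofReal_tsum, ← tsum_mul_left]
  refine tsum_congr fun n ↦ ?_
  rw [integral_const_mul, integral_gaussWeight_mul_exp hα]
  simp only [gauss]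
  push_cast
  ring

lemma integral_gaussWeight_mul_logDeriv_xi_eq {α β σ : ℝ} (hα : 0 < α) (hRH : RiemannHypothesis) (hσ : 1 / 2 < σ)
    (hσ2 : σ ≤ 2) :
    ∫ u : ℝ, gaussWeight α β σ (σ + u * I) * logDeriv xi (σ + u * I)
      = ((√(π / α) * weilForm σ (gauss α β) : ℝ) : ℂ) := by
  rw [integral_gaussWeight_mul_logDeriv_xi hRH hα hσ hσ2]
  obtain ⟨K, hK, hKb⟩ := exists_norm_logDeriv_xi_le_two
  have hQ : Integrable fun u : ℝ ↦ gaussWeight α β σ (2 + u * I) * logDeriv xi (2 + u * I) := by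
    refine integrable_gaussWeight_mul hα ?_ (C := K) fun u ↦ ?_
    · have := continuous_vertical (f := logDeriv xi) (x := 2) fun s hs ↦
        differentiableAt_logDeriv_xi hRH (by rw [hs]; norm_num)
      simpa using this.aestronglyMeasurable
    · simpa using hKb (2 + u * I) (by simp)
  obtain ⟨hD1, hD2⟩ := integral_gaussWeight_digamma (α := α) (β := β) (σ := σ) hα
  obtain ⟨hP1, hP2⟩ := integral_gaussWeight_pole (α := α) (β := β) (σ := σ) hα
  have h0 := integral_gaussWeight_mul_exp (α := α) (β := β) (σ := σ) hα 0
  have h01 := integrable_gaussWeight_mul_exp (α := α) (β := β) (σ := σ) hα 0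
  simp only [ofReal_zero, mul_zero, exp_zero, mul_one, Real.exp_zero, one_mul] at h0 h01
  have hL := integral_gaussWeight_LSeries (α := α) (β := β) (σ := σ) hα
  have hdec : ∀ u : ℝ, gaussWeight α β σ (2 + u * I) *
      LSeries (fun n ↦ (vonMangoldt n : ℂ)) (2 + u * I)
      = (-((Real.log π + Real.eulerMascheroniConstant : ℝ) : ℂ) / 2) *
          gaussWeight α β σ (2 + u * I)
        + (1 / 2 : ℂ) * (gaussWeight α β σ (2 + u * I) *
          ∫ w in Ioi (0 : ℝ), (1 - exp (-((2 + u * I) / 2) * w)) / (exp w - 1))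
        + gaussWeight α β σ (2 + u * I) * (∫ w in Ioi (0 : ℝ), exp (-((2 + u * I) - 1) * w))
        - gaussWeight α β σ (2 + u * I) * logDeriv xi (2 + u * I) := by
    intro u
    rw [logDeriv_xi_eq (s := 2 + u * I) (by simp)]
    ring
  simp_rw [hdec] at hL
  have hA := h01.const_mul (-((Real.log π + Real.eulerMascheroniConstant : ℝ) : ℂ) / 2)
  have hB := hD1.const_mul (1 / 2 : ℂ)
  have hAB := hA.add hB
  have hABP := hAB.add hP1
  simp only [Pi.add_def] at hAB hABP
  rw [integral_sub hABP hQ, integral_add hAB hP1, integral_add hA hB, integral_const_mul, integral_const_mul,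
    hD2, hP2, h0] at hL
  rw [sub_eq_iff_eq_add] at hL
  rw [← sub_eq_iff_eq_add'] at hL
  rw [← hL, weilForm]
  simp only [gauss]
  push_cast
  ring

end Explicit

/-! ### Positivity of the explicit formula -/

section Positivity
open Complex Set Topology
open ArithmeticFunction (vonMangoldt)

lemma gauss_pos (α β v : ℝ) : 0 < gauss α β v := Real.exp_pos _

lemma gauss_le_one {α : ℝ} (hα : 0 < α) (β v : ℝ) : gauss α β v ≤ 1 := by
  rw [gauss, Real.exp_le_one_iff, neg_div, neg_nonpos]
  positivity

lemma gauss_le_exp {α : ℝ} (hα : 0 < α) (β v : ℝ) :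
    gauss α β v ≤ Real.exp (2 * β + 4 * α) * Real.exp (-2 * v) := by
  rw [gauss, ← Real.exp_add, Real.exp_le_exp, div_le_iff₀ (by positivity)]
  nlinarith [sq_nonneg (v - β - 4 * α)]

lemma continuous_gauss (α β : ℝ) : Continuous (gauss α β) := by
  unfold gauss; fun_prop

lemma abs_exp_neg_sub_exp_neg_le {x y : ℝ} (hx : 0 ≤ x) (hy : 0 ≤ y) :
    |Real.exp (-x) - Real.exp (-y)| ≤ |x - y| := by
  wlog h : x ≤ y generalizing x y
  · rw [abs_sub_comm, abs_sub_comm x]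
    exact this hy hx (le_of_not_ge h)
  rw [abs_of_nonneg (sub_nonneg.mpr (Real.exp_le_exp.mpr (neg_le_neg h))),
    abs_of_nonpos (sub_nonpos.mpr h)]
  have h1 : Real.exp (-y) = Real.exp (-x) * Real.exp (-(y - x)) := by
    rw [← Real.exp_add]; ring_nf
  have h2 := Real.one_sub_le_exp_neg (y - x)
  have h3 : Real.exp (-x) ≤ 1 := Real.exp_le_one_iff.mpr (by linarith)
  have h4 := Real.exp_pos (-x)
  rw [h1]
  nlinarith

lemma abs_gauss_zero_sub_le {α : ℝ} (hα : 0 < α) (β : ℝ) {v : ℝ} (hv : 0 ≤ v) :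
    |gauss α β 0 - gauss α β v| ≤ ((1 + 2 * |β|) / (4 * α) + 1) * v := by
  have h0 : 0 ≤ (1 + 2 * |β|) / (4 * α) := by positivity
  rcases le_or_gt v 1 with h1 | h1
  · simp only [gauss, neg_div]
    refine (abs_exp_neg_sub_exp_neg_le (by positivity) (by positivity)).trans ?_
    rw [← sub_div, abs_div, abs_of_pos (by positivity : 0 < 4 * α)]
    have e : (0 - β) ^ 2 - (v - β) ^ 2 = v * (2 * β - v) := by ring
    rw [e, abs_mul, abs_of_nonneg hv]
    have : |2 * β - v| ≤ 1 + 2 * |β| := by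
      rw [abs_le]
      constructor <;> linarith [neg_abs_le β, le_abs_self β]
    calc v * |2 * β - v| / (4 * α) ≤ v * (1 + 2 * |β|) / (4 * α) := by gcongr
      _ = (1 + 2 * |β|) / (4 * α) * v := by ring
      _ ≤ _ := by nlinarith
  · have : |gauss α β 0 - gauss α β v| ≤ 1 := by
      have := gauss_pos α β 0
      have := gauss_pos α β v
      have := gauss_le_one hα β 0
      have := gauss_le_one hα β v
      rw [abs_le]; constructor <;> linarith
    nlinarith

lemma abs_digamma_integrand_le {α : ℝ} (hα : 0 < α) (β : ℝ) {σ w : ℝ} (hσ : 0 ≤ σ) (hσ2 : σ ≤ 2)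
    (hw : 0 < w) :
    |(gauss α β 0 - Real.exp (-σ * (w / 2)) * gauss α β (w / 2)) / (Real.exp w - 1)|
      ≤ ((1 + 2 * |β|) / (4 * α) + 2) * Real.exp (-w / 2) := by
  have h1 : 0 < Real.exp w - 1 := by linarith [Real.add_one_lt_exp hw.ne']
  have h2 := abs_gauss_zero_sub_le hα β (v := w / 2) (by linarith)
  have h3 : |(1 - Real.exp (-σ * (w / 2))) * gauss α β (w / 2)| ≤ w := by
    have e1 : Real.exp (-σ * (w / 2)) ≤ 1 := Real.exp_le_one_iff.mpr (by nlinarith)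
    have e2 := Real.add_one_le_exp (-σ * (w / 2))
    have e3 : σ * (w / 2) ≤ w := by nlinarith
    rw [abs_of_nonneg (mul_nonneg (by linarith) (gauss_pos _ _ _).le)]
    calc _ ≤ (1 - Real.exp (-σ * (w / 2))) * 1 :=
          mul_le_mul_of_nonneg_left (gauss_le_one hα _ _) (by linarith)
      _ ≤ w := by linarith
  have h0 : 0 ≤ (1 + 2 * |β|) / (4 * α) := by positivity
  have h4 : |gauss α β 0 - Real.exp (-σ * (w / 2)) * gauss α β (w / 2)|
      ≤ ((1 + 2 * |β|) / (4 * α) + 2) * w := by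
    have e : gauss α β 0 - Real.exp (-σ * (w / 2)) * gauss α β (w / 2)
      = (gauss α β 0 - gauss α β (w / 2))
        + (1 - Real.exp (-σ * (w / 2))) * gauss α β (w / 2) := by ring
    rw [e]
    refine (abs_add_le _ _).trans ((add_le_add h2 h3).trans ?_)
    nlinarith
  rw [abs_div, abs_of_pos h1]
  calc _ ≤ ((1 + 2 * |β|) / (4 * α) + 2) * w / (Real.exp w - 1) := by gcongr
    _ = ((1 + 2 * |β|) / (4 * α) + 2) * (w / (Real.exp w - 1)) := by ring
    _ ≤ _ := by gcongr; exact self_div_exp_sub_one_le hw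

lemma integrableOn_digamma_integrand {α : ℝ} (hα : 0 < α) (β : ℝ) {σ : ℝ} (hσ : 0 ≤ σ)
    (hσ2 : σ ≤ 2) :
    IntegrableOn (fun w ↦ (gauss α β 0 - Real.exp (-σ * (w / 2)) * gauss α β (w / 2))
      / (Real.exp w - 1)) (Ioi 0) := by
  refine (integrableOn_exp_neg_half.const_mul ((1 + 2 * |β|) / (4 * α) + 2)).mono'
    (Measurable.aestronglyMeasurable ?_) ?_
  · have := (continuous_gauss α β).measurable
    fun_prop
  · filter_upwards [ae_restrict_mem measurableSet_Ioi] with w hw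
    exact abs_digamma_integrand_le hα β hσ hσ2 hw

lemma pole_integrand_le {α : ℝ} (hα : 0 < α) (β : ℝ) {σ w : ℝ} (hσ : 0 ≤ σ) (hw : 0 < w) :
    |Real.exp w * (Real.exp (-σ * w) * gauss α β w)|
      ≤ Real.exp (2 * β + 4 * α) * Real.exp (-w / 2) := by
  rw [abs_of_nonneg (by have := (gauss_pos α β w).le; positivity)]
  have h1 : Real.exp (-σ * w) ≤ 1 := Real.exp_le_one_iff.mpr (by nlinarith)
  calc _ ≤ Real.exp w * (1 * (Real.exp (2 * β + 4 * α) * Real.exp (-2 * w))) := by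
        gcongr
        · exact (gauss_pos _ _ _).le
        · exact gauss_le_exp hα β w
    _ = Real.exp (2 * β + 4 * α) * Real.exp (-w) := by
        rw [one_mul, mul_left_comm, ← Real.exp_add w]; ring_nf
    _ ≤ _ := by gcongr; linarith

lemma abs_prime_term_le {α : ℝ} (hα : 0 < α) (β : ℝ) {σ : ℝ} (hσ : 0 ≤ σ) (n : ℕ) :
    |vonMangoldt n * (Real.exp (-σ * Real.log n) * gauss α β (Real.log n))|
      ≤ Real.exp (2 * β + 4 * α) * ‖LSeries.term (fun n ↦ (vonMangoldt n : ℂ)) 2 n‖ := by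
  rcases eq_or_ne n 0 with rfl | hn
  · simp
  have hn1 : (0 : ℝ) < n := by positivity
  have hlog : 0 ≤ Real.log n := Real.log_natCast_nonneg n
  have hΛ : 0 ≤ vonMangoldt n := ArithmeticFunction.vonMangoldt_nonneg
  have e : ‖LSeries.term (fun n ↦ (vonMangoldt n : ℂ)) 2 n‖
      = vonMangoldt n * Real.exp (-2 * Real.log n) := by
    rw [LSeries.norm_term_eq, if_neg hn, norm_real, Real.norm_of_nonneg hΛ,
      Real.rpow_def_of_pos hn1, div_eq_mul_inv, ← Real.exp_neg]
    simp
    ring_nf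
    simp
  rw [e, abs_of_nonneg (by have := (gauss_pos α β (Real.log n)).le; positivity)]
  have h1 : Real.exp (-σ * Real.log n) ≤ 1 := Real.exp_le_one_iff.mpr (by nlinarith)
  calc _ ≤ vonMangoldt n * (1 * (Real.exp (2 * β + 4 * α) * Real.exp (-2 * Real.log n))) := by
        gcongr
        · exact (gauss_pos _ _ _).le
        · exact gauss_le_exp hα β _
    _ = _ := by ring

lemma summable_norm_term_two :
    Summable fun n ↦ ‖LSeries.term (fun n ↦ (vonMangoldt n : ℂ)) 2 n‖ :=
  (ArithmeticFunction.LSeriesSummable_vonMangoldt (s := 2) (by simp)).norm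

lemma summable_prime_term {α : ℝ} (hα : 0 < α) (β : ℝ) {σ : ℝ} (hσ : 0 ≤ σ) :
    Summable fun n : ℕ ↦ vonMangoldt n * (Real.exp (-σ * Real.log n) * gauss α β (Real.log n)) :=
  Summable.of_norm_bounded (summable_norm_term_two.mul_left _) (abs_prime_term_le hα β hσ)

lemma tendsto_weilForm {α : ℝ} (hα : 0 < α) (β : ℝ) :
    Tendsto (fun σ ↦ weilForm σ (gauss α β)) (𝓝[>] (1 / 2)) (𝓝 (weilForm (1 / 2) (gauss α β))) := by
  have hev : ∀ᶠ σ : ℝ in 𝓝[>] (1 / 2), 0 ≤ σ ∧ σ ≤ 2 := by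
    filter_upwards [Ioo_mem_nhdsGT (by norm_num : (1 / 2 : ℝ) < 2)] with σ hσ
    exact ⟨by linarith [hσ.1], hσ.2.le⟩
  have hlim : ∀ {f : ℝ → ℝ}, Continuous f → Tendsto f (𝓝[>] (1 / 2)) (𝓝 (f (1 / 2))) := fun hf ↦
    (hf.tendsto _).mono_left nhdsWithin_le_nhds
  have hm := (continuous_gauss α β).measurable
  unfold weilForm
  refine ((tendsto_const_nhds.add (Tendsto.div_const ?_ _)).add ?_).sub ?_
  · refine tendsto_integral_filter_of_dominated_convergence
      (fun w ↦ ((1 + 2 * |β|) / (4 * α) + 2) * Real.exp (-w / 2)) ?_ ?_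
      (integrableOn_exp_neg_half.const_mul _) ?_
    · exact Eventually.of_forall fun σ ↦ Measurable.aestronglyMeasurable (by fun_prop)
    · filter_upwards [hev] with σ hσ
      filter_upwards [ae_restrict_mem measurableSet_Ioi] with w hw
      exact abs_digamma_integrand_le hα β hσ.1 hσ.2 hw
    · exact Eventually.of_forall fun w ↦ hlim
        (f := fun σ ↦ (gauss α β 0 - Real.exp (-σ * (w / 2)) * gauss α β (w / 2))
          / (Real.exp w - 1)) (by fun_prop)
  · refine tendsto_integral_filter_of_dominated_convergence
      (fun w ↦ Real.exp (2 * β + 4 * α) * Real.exp (-w / 2)) ?_ ?_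
      (integrableOn_exp_neg_half.const_mul _) ?_
    · exact Eventually.of_forall fun σ ↦ Measurable.aestronglyMeasurable (by fun_prop)
    · filter_upwards [hev] with σ hσ
      filter_upwards [ae_restrict_mem measurableSet_Ioi] with w hw
      exact pole_integrand_le hα β hσ.1 hw
    · exact Eventually.of_forall fun w ↦ hlim
        (f := fun σ ↦ Real.exp w * (Real.exp (-σ * w) * gauss α β w)) (by fun_prop)
  · refine tendsto_tsum_of_dominated_convergence (summable_norm_term_two.mul_left
      (Real.exp (2 * β + 4 * α))) ?_ ?_
    · exact fun n ↦ hlim (f := fun σ ↦ vonMangoldt n *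
        (Real.exp (-σ * Real.log n) * gauss α β (Real.log n))) (by fun_prop)
    · filter_upwards [hev] with σ hσ n
      exact abs_prime_term_le hα β hσ.1 n

lemma sum_mul_weilForm_nonneg_of_half_lt (hRH : RiemannHypothesis) {ι : Type*} (I' : Finset ι)
    (c β : ι → ℝ) {α : ℝ} (hα : 0 < α)
    (hsin : ∀ u : ℝ, ∑ i ∈ I', c i * Real.sin (β i * u) = 0)
    (hcos : ∀ u : ℝ, 0 ≤ ∑ i ∈ I', c i * Real.cos (β i * u)) {σ : ℝ} (hσ : 1 / 2 < σ)
    (hσ2 : σ ≤ 2) : 0 ≤ ∑ i ∈ I', c i * weilForm σ (gauss α (β i)) := by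
  obtain ⟨K, hK, hKb⟩ := exists_norm_logDeriv_xi_le hRH hσ
  have hw : ∀ (b u : ℝ), gaussWeight α b σ (σ + u * I)
      = Real.exp (-α * u ^ 2) * (Real.cos (b * u) + Real.sin (b * u) * I) := by
    intro b u
    have e : (α : ℂ) * (σ + u * I - σ) ^ 2 + b * (σ + u * I - σ)
        = ((-α * u ^ 2 : ℝ) : ℂ) + ((b * u : ℝ) : ℂ) * I := by
      have : (u * I) ^ 2 = -(u : ℂ) ^ 2 := by rw [mul_pow, I_sq]; ring
      push_cast
      linear_combination (α : ℂ) * this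
    rw [gaussWeight, e, exp_add, exp_mul_I, ofReal_exp, ofReal_cos, ofReal_sin]
  have hInt : ∀ b : ℝ, Integrable fun u : ℝ ↦
      gaussWeight α b σ (σ + u * I) * logDeriv xi (σ + u * I) := by
    intro b
    have hc := continuous_vertical (f := fun s ↦ gaussWeight α b σ s * logDeriv xi s) (x := σ)
      fun s hs ↦ DifferentiableAt.mul (by unfold gaussWeight; fun_prop)
        (differentiableAt_logDeriv_xi hRH (by rw [hs]; exact hσ))
    refine ((integrable_one_add_abs_mul_exp hα).const_mul K).mono' hc.aestronglyMeasurable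
      (Eventually.of_forall fun u ↦ ?_)
    rw [norm_mul, norm_gaussWeight]
    have := hKb (σ + u * I) (by simp) (by simpa using hσ2)
    simp only [add_re, ofReal_re, mul_re, I_re, mul_zero, ofReal_im, I_im, mul_one, sub_self,
      add_zero, add_im, mul_im, zero_add] at this ⊢
    simp only [ne_eq, OfNat.ofNat_ne_zero, not_false_eq_true, zero_pow, mul_zero,
      Real.exp_zero, one_mul]
    calc _ ≤ Real.exp (-α * u ^ 2) * (K * (1 + |u|)) := by gcongr
      _ = _ := by ring
  have hsum : ((√(π / α) * ∑ i ∈ I', c i * weilForm σ (gauss α (β i)) : ℝ) : ℂ)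
      = ∫ u : ℝ, ∑ i ∈ I', (c i : ℂ) *
        (gaussWeight α (β i) σ (σ + u * I) * logDeriv xi (σ + u * I)) := by
    rw [integral_finsetSum _ fun i _ ↦ (hInt (β i)).const_mul _]
    simp_rw [integral_const_mul, integral_gaussWeight_mul_logDeriv_xi_eq hα hRH hσ hσ2]
    rw [Finset.mul_sum, ofReal_sum]
    refine Finset.sum_congr rfl fun i _ ↦ ?_
    push_cast
    ring
  have hform : ∀ u : ℝ, ∑ i ∈ I', (c i : ℂ) *
      (gaussWeight α (β i) σ (σ + u * I) * logDeriv xi (σ + u * I))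
      = ((Real.exp (-α * u ^ 2) * ∑ i ∈ I', c i * Real.cos (β i * u) : ℝ) : ℂ)
        * logDeriv xi (σ + u * I) := by
    intro u
    have hs : ∑ i ∈ I', (c i : ℂ) * (Real.sin (β i * u) : ℂ) = 0 := by
      have := congrArg (fun x : ℝ ↦ (x : ℂ)) (hsin u)
      push_cast at this ⊢
      exact this
    calc _ = (Real.exp (-α * u ^ 2) : ℂ) * logDeriv xi (σ + u * I) *
          (∑ i ∈ I', (c i : ℂ) * (Real.cos (β i * u) : ℂ)
            + (∑ i ∈ I', (c i : ℂ) * (Real.sin (β i * u) : ℂ)) * I) := by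
          rw [Finset.sum_mul, ← Finset.sum_add_distrib, Finset.mul_sum]
          refine Finset.sum_congr rfl fun i _ ↦ ?_
          rw [hw]
          ring
      _ = _ := by
          rw [hs]
          push_cast
          ring
  have hre : √(π / α) * ∑ i ∈ I', c i * weilForm σ (gauss α (β i))
      = ∫ u : ℝ, (Real.exp (-α * u ^ 2) * ∑ i ∈ I', c i * Real.cos (β i * u))
        * (logDeriv xi (σ + u * I)).re := by
    have hI : Integrable fun u : ℝ ↦ ∑ i ∈ I', (c i : ℂ) *
        (gaussWeight α (β i) σ (σ + u * I) * logDeriv xi (σ + u * I)) :=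
      integrable_finsetSum _ fun i _ ↦ (hInt (β i)).const_mul _
    have h1 := integral_re hI
    rw [← hsum] at h1
    simp only [RCLike.re_to_complex, ofReal_re] at h1
    rw [← h1]
    refine integral_congr_ae (Eventually.of_forall fun u ↦ ?_)
    simp only
    rw [hform, re_ofReal_mul]
  have h0 : 0 ≤ √(π / α) * ∑ i ∈ I', c i * weilForm σ (gauss α (β i)) := by
    rw [hre]
    refine integral_nonneg fun u ↦ ?_
    have := logDeriv_xi_re_nonneg hRH (s := σ + u * I) (by simpa using hσ)
    have := hcos u
    positivity
  have hpos : 0 < √(π / α) := Real.sqrt_pos.mpr (by positivity)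
  exact nonneg_of_mul_nonneg_right h0 hpos

/-- **Weil positivity** for linear combinations of Gaussians, under the Riemann hypothesis. -/
theorem sum_mul_weilForm_nonneg (hRH : RiemannHypothesis) {ι : Type*} (I' : Finset ι)
    (c β : ι → ℝ) {α : ℝ} (hα : 0 < α)
    (hsin : ∀ u : ℝ, ∑ i ∈ I', c i * Real.sin (β i * u) = 0)
    (hcos : ∀ u : ℝ, 0 ≤ ∑ i ∈ I', c i * Real.cos (β i * u)) :
    0 ≤ ∑ i ∈ I', c i * weilForm (1 / 2) (gauss α (β i)) := by
  have hlim : Tendsto (fun σ ↦ ∑ i ∈ I', c i * weilForm σ (gauss α (β i))) (𝓝[>] (1 / 2))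
      (𝓝 (∑ i ∈ I', c i * weilForm (1 / 2) (gauss α (β i)))) :=
    tendsto_finsetSum _ fun i _ ↦ (tendsto_weilForm hα (β i)).const_mul _
  refine ge_of_tendsto hlim ?_
  filter_upwards [Ioo_mem_nhdsGT (by norm_num : (1 / 2 : ℝ) < 2)] with σ hσ
  exact sum_mul_weilForm_nonneg_of_half_lt hRH I' c β hα hsin hcos hσ.1 hσ.2.le

end Positivity

section SelbergSieve

open Finset ArithmeticFunction
open scoped ArithmeticFunction.Moebius

/-- The weight `μ(l)² / φ(l)` of the Selberg sieve for the primes. -/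
noncomputable def sieveWeight (l : ℕ) : ℝ := if Squarefree l then (1 : ℝ) / l.totient else 0

/-- The normalising sum of the Selberg sieve of level `z`. -/
noncomputable def sieveSum (z : ℕ) : ℝ := ∑ l ∈ Icc 1 z, sieveWeight l

/-- Selberg's coefficients of level `z`. -/
noncomputable def sieveCoeff (z d : ℕ) : ℝ :=
  (μ d : ℝ) * d / sieveSum z * ∑ l ∈ Icc 1 z with d ∣ l, sieveWeight l

lemma sieveWeight_nonneg (l : ℕ) : 0 ≤ sieveWeight l := by
  unfold sieveWeight; split_ifs <;> positivity

lemma sieveWeight_one : sieveWeight 1 = 1 := by simp [sieveWeight]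

lemma sieveSum_pos {z : ℕ} (hz : 1 ≤ z) : 0 < sieveSum z := by
  have h := single_le_sum (f := sieveWeight) (fun l _ => sieveWeight_nonneg l)
    (mem_Icc.2 ⟨le_refl 1, hz⟩)
  rw [sieveWeight_one] at h
  exact lt_of_lt_of_le one_pos h

lemma sum_inv_le_of_primeFactors_prod_eq {l : ℕ} (hl : Squarefree l) (s : Finset ℕ)
    (hs : ∀ n ∈ s, n ≠ 0 ∧ ∏ p ∈ n.primeFactors, p = l) :
    ∑ n ∈ s, (1 : ℝ) / n ≤ sieveWeight l := by
  have hl0 : l ≠ 0 := hl.ne_zero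
  have hlR : (l : ℝ) ≠ 0 := by exact_mod_cast hl0
  let g : ℕ →* ℝ :=
    { toFun := fun n => (n : ℝ)⁻¹, map_one' := by simp, map_mul' := by intro a b; simp [mul_comm] }
  have hg : ∀ n : ℕ, g n = (n : ℝ)⁻¹ := fun n => rfl
  have h2 := (EulerProduct.summable_and_hasSum_factoredNumbers_prod_filter_prime_geometric
    (f := g) (by
      intro p hp
      rw [hg]
      simpa using inv_lt_one_of_one_lt₀ (by exact_mod_cast hp.one_lt : (1 : ℝ) < p))
    l.primeFactors).2
  have hprod : ∏ p ∈ l.primeFactors with p.Prime, (1 - g p)⁻¹ = l / l.totient := by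
    have ht : (l.totient : ℝ) = l * ∏ p ∈ l.primeFactors, (1 - (p : ℝ)⁻¹) := by
      have := congrArg (Rat.cast : ℚ → ℝ) (Nat.totient_eq_mul_prod_factors l)
      push_cast at this
      exact this
    rw [filter_true_of_mem fun p hp => Nat.prime_of_mem_primeFactors hp, prod_inv_distrib, ht]
    simp only [hg]
    rw [div_mul_eq_div_div, div_self hlR, one_div]
  rw [hprod] at h2
  have hdvd : ∀ n ∈ s, l ∣ n := fun n hn => (hs n hn).2 ▸ Nat.prod_primeFactors_dvd n
  have hmem : ∀ n ∈ s, n / l ∈ Nat.factoredNumbers l.primeFactors := by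
    intro n hn
    refine Nat.mem_factoredNumbers_of_dvd
      (Nat.mem_factoredNumbers_of_primeFactors_subset (hs n hn).1 ?_) (Nat.div_dvd_of_dvd (hdvd n hn))
    rw [← (hs n hn).2, Nat.primeFactors_prod_primeFactors]
  have h3 : ∑ n ∈ s, (1 : ℝ) / n = ∑ m ∈ s.attach.image
      (fun n => (⟨n.1 / l, hmem n.1 n.2⟩ : Nat.factoredNumbers l.primeFactors)), g m / l := by
    rw [sum_image, ← sum_attach]
    · refine sum_congr rfl fun n _ => ?_
      rw [hg, Nat.cast_div (hdvd n.1 n.2) hlR]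
      have : (n.1 : ℝ) ≠ 0 := by exact_mod_cast (hs n.1 n.2).1
      field_simp
    · intro a _ b _ hab
      have h := congrArg Subtype.val hab
      exact Subtype.ext ((Nat.div_left_inj (hdvd a.1 a.2) (hdvd b.1 b.2)).1 h)
  rw [h3, ← sum_div]
  have h4 := sum_le_hasSum (s.attach.image
      (fun n => (⟨n.1 / l, hmem n.1 n.2⟩ : Nat.factoredNumbers l.primeFactors)))
      (fun m _ => by rw [hg]; positivity) h2
  rw [sieveWeight, if_pos hl]
  calc _ ≤ (l : ℝ) / l.totient / l := by gcongr
    _ = 1 / l.totient := by field_simp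

lemma log_le_sieveSum (z : ℕ) : Real.log (z + 1) ≤ sieveSum z := by
  have h1 := log_add_one_le_harmonic z
  rw [harmonic_eq_sum_Icc] at h1
  push_cast at h1
  refine h1.trans ?_
  have hsq : ∀ n : ℕ, Squarefree (∏ p ∈ n.primeFactors, p) := fun n =>
    Finset.squarefree_prod_of_pairwise_isCoprime
      (fun p hp q hq hpq => Nat.coprime_iff_isRelPrime.1 ((Nat.coprime_primes
        (Nat.prime_of_mem_primeFactors hp) (Nat.prime_of_mem_primeFactors hq)).2 hpq))
      (fun p hp => (Nat.prime_of_mem_primeFactors hp).prime.squarefree)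
  rw [← sum_fiberwise_of_maps_to (s := Icc 1 z) (t := Icc 1 z)
    (g := fun n => ∏ p ∈ n.primeFactors, p)]
  · refine sum_le_sum fun l hl => ?_
    rcases eq_or_ne ({n ∈ Icc 1 z | ∏ p ∈ n.primeFactors, p = l}) ∅ with h | h
    · rw [h]; simpa using sieveWeight_nonneg l
    · obtain ⟨n, hn⟩ := nonempty_iff_ne_empty.2 h
      have hsql : Squarefree l := (mem_filter.1 hn).2 ▸ hsq n
      simp only [← one_div]
      refine sum_inv_le_of_primeFactors_prod_eq hsql _ fun m hm => ?_
      rw [mem_filter, mem_Icc] at hm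
      exact ⟨by omega, hm.2⟩
  · intro n hn
    rw [mem_Icc] at hn ⊢
    exact ⟨Nat.one_le_iff_ne_zero.2 (hsq n).ne_zero,
      (Nat.le_of_dvd (by omega) (Nat.prod_primeFactors_dvd n)).trans hn.2⟩

lemma sieveWeight_div {l k : ℕ} (hl : Squarefree l) (hk : k ∣ l) :
    sieveWeight (l / k) = k.totient * sieveWeight l := by
  obtain ⟨m, rfl⟩ := hk
  have hcop := Nat.coprime_of_squarefree_mul hl
  have hk0 : k ≠ 0 := fun h => hl.ne_zero (by simp [h])
  have hm : Squarefree m := hl.of_mul_right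
  have : (k.totient : ℝ) ≠ 0 := by
    exact_mod_cast (Nat.totient_pos.2 (Nat.pos_of_ne_zero hk0)).ne'
  rw [Nat.mul_div_cancel_left _ (Nat.pos_of_ne_zero hk0), sieveWeight, sieveWeight, if_pos hl,
    if_pos hm, Nat.totient_mul hcop]
  push_cast
  field_simp

lemma mul_sum_sieveWeight_le {z d : ℕ} (hd : Squarefree d) :
    (d : ℝ) * ∑ l ∈ Icc 1 z with d ∣ l, sieveWeight l ≤ sieveSum z := by
  have hd0 := hd.ne_zero
  have h0 : ∑ l ∈ Icc 1 z with d ∣ l, sieveWeight l =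
      ∑ l ∈ Icc 1 z with d ∣ l ∧ Squarefree l, sieveWeight l := by
    rw [← filter_filter]
    refine (sum_filter_of_ne fun l _ h => ?_).symm
    by_contra hsq
    exact h (by simp [sieveWeight, hsq])
  have hd' : (d : ℝ) = ∑ k ∈ d.divisors, (k.totient : ℝ) := by exact_mod_cast (Nat.sum_totient d).symm
  rw [h0, hd', sum_mul_sum, ← sum_product']
  have h1 : ∀ x ∈ d.divisors ×ˢ {l ∈ Icc 1 z | d ∣ l ∧ Squarefree l},
      (x.1.totient : ℝ) * sieveWeight x.2 = sieveWeight (x.2 / x.1) := by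
    intro x hx
    simp only [mem_product, Nat.mem_divisors, mem_filter] at hx
    exact (sieveWeight_div hx.2.2.2 (hx.1.1.trans hx.2.2.1)).symm
  rw [sum_congr rfl h1]
  have hgcd : ∀ x ∈ d.divisors ×ˢ {l ∈ Icc 1 z | d ∣ l ∧ Squarefree l},
      Nat.gcd (x.2 / x.1) d * x.1 = d := by
    rintro ⟨k, l⟩ hx
    simp only [mem_product, Nat.mem_divisors, mem_filter] at hx
    obtain ⟨⟨⟨e, rfl⟩, -⟩, -, ⟨m, rfl⟩, hsq⟩ := hx
    have hk0 : 0 < k := Nat.pos_of_ne_zero fun h => hd0 (by simp [h])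
    have hkm : Nat.Coprime m k :=
      ((Nat.coprime_of_squarefree_mul hsq).symm.of_dvd_right ⟨e, rfl⟩)
    simp only
    rw [mul_assoc k, Nat.mul_div_cancel_left _ hk0, mul_comm k e, Nat.gcd_mul_left, Nat.Coprime.gcd_eq_one hkm, mul_one]
  have hinj : Set.InjOn (fun x : ℕ × ℕ => x.2 / x.1)
      (d.divisors ×ˢ {l ∈ Icc 1 z | d ∣ l ∧ Squarefree l} : Finset (ℕ × ℕ)) := by
    intro x hx y hy hxy
    have hx' := hgcd x hx
    have hy' := hgcd y hy
    simp only at hxy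
    rw [hxy] at hx'
    have hg0 : 0 < Nat.gcd (y.2 / y.1) d := Nat.gcd_pos_of_pos_right _ (Nat.pos_of_ne_zero hd0)
    have h1 : x.1 = y.1 := Nat.eq_of_mul_eq_mul_left hg0 (hx'.trans hy'.symm)
    simp only [coe_product, Set.mem_prod, mem_coe, Nat.mem_divisors, mem_filter] at hx hy
    refine Prod.ext h1 ((Nat.div_left_inj (hx.1.1.trans hx.2.2.1) (h1 ▸ hy.1.1.trans hy.2.2.1)).1 ?_)
    rw [hxy, h1]
  rw [← sum_image hinj]
  refine sum_le_sum_of_subset_of_nonneg ?_ fun l _ _ => sieveWeight_nonneg l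
  intro m hm
  obtain ⟨x, hx, rfl⟩ := mem_image.1 hm
  simp only [mem_product, Nat.mem_divisors, mem_filter, mem_Icc] at hx ⊢
  have hx1 : x.1 ∣ x.2 := hx.1.1.trans hx.2.2.1
  exact ⟨Nat.div_pos (Nat.le_of_dvd (by omega) hx1) (Nat.pos_of_ne_zero fun h => hd0 (by
    have := hx.1.1; rw [h] at this; simpa using this)), (Nat.div_le_self _ _).trans hx.2.1.2⟩

lemma abs_sieveCoeff_le_one {z : ℕ} (hz : 1 ≤ z) (d : ℕ) : |sieveCoeff z d| ≤ 1 := by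
  by_cases hd : Squarefree d
  · have hS := sieveSum_pos hz
    have h0 : 0 ≤ ∑ l ∈ Icc 1 z with d ∣ l, sieveWeight l :=
      sum_nonneg fun l _ => sieveWeight_nonneg l
    have hμ : |(μ d : ℝ)| = 1 := by exact_mod_cast abs_moebius_eq_one_of_squarefree hd
    rw [sieveCoeff, abs_mul, abs_div, abs_mul, hμ, abs_of_pos hS, abs_of_nonneg h0, Nat.abs_cast,
      one_mul, div_mul_eq_mul_div, div_le_one hS]
    exact mul_sum_sieveWeight_le hd
  · simp [sieveCoeff, moebius_eq_zero_of_not_squarefree hd]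

lemma sieveCoeff_one {z : ℕ} (hz : 1 ≤ z) : sieveCoeff z 1 = 1 := by
  have h := (sieveSum_pos hz).ne'
  simp only [sieveCoeff, moebius_apply_one, Int.cast_one, Nat.cast_one, mul_one, one_dvd,
    filter_true]
  rw [← sieveSum]
  field_simp

lemma sum_moebius_dvd_dvd {z l m : ℕ} (hm : Squarefree m) (hmz : m ≤ z) :
    ∑ d ∈ Icc 1 z with l ∣ d ∧ d ∣ m, (μ d : ℝ) = if m = l then (μ l : ℝ) else 0 := by
  by_cases hlm : l ∣ m
  · obtain ⟨e, rfl⟩ := hlm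
    have hl0 : 0 < l := Nat.pos_of_ne_zero fun h => hm.ne_zero (by simp [h])
    have hcop := Nat.coprime_of_squarefree_mul hm
    have himg : {d ∈ Icc 1 z | l ∣ d ∧ d ∣ l * e} = e.divisors.image (fun c => l * c) := by
      ext d
      simp only [mem_filter, mem_Icc, mem_image, Nat.mem_divisors]
      constructor
      · rintro ⟨-, ⟨c, rfl⟩, h⟩
        exact ⟨c, ⟨Nat.dvd_of_mul_dvd_mul_left hl0 h, hm.of_mul_right.ne_zero⟩, rfl⟩
      · rintro ⟨c, ⟨hc, -⟩, rfl⟩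
        have hdv := Nat.mul_dvd_mul_left l hc
        have := Nat.pos_of_dvd_of_pos hdv (Nat.pos_of_ne_zero hm.ne_zero)
        exact ⟨⟨this, (Nat.le_of_dvd (Nat.pos_of_ne_zero hm.ne_zero) hdv).trans hmz⟩, ⟨c, rfl⟩, hdv⟩
    rw [himg, sum_image fun a _ b _ h => Nat.eq_of_mul_eq_mul_left hl0 h]
    have h1 : ∀ c ∈ e.divisors, (μ (l * c) : ℝ) = μ l * μ c := fun c hc => by
      have := isMultiplicative_moebius.map_mul_of_coprime
        (hcop.of_dvd_right (Nat.dvd_of_mem_divisors hc))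
      exact_mod_cast this
    rw [sum_congr rfl h1, ← mul_sum]
    have h2 : ∑ c ∈ e.divisors, (μ c : ℝ) = if e = 1 then 1 else 0 := by
      have := congrArg (fun f : ArithmeticFunction ℤ => f e) coe_zeta_mul_moebius
      simp only [coe_zeta_mul_apply, one_apply] at this
      exact_mod_cast this
    rw [h2]
    have h3 : (l * e = l) ↔ e = 1 := by
      constructor
      · intro h; exact Nat.eq_of_mul_eq_mul_left hl0 (by simpa using h)
      · rintro rfl; simp
    simp [h3]
  · rw [if_neg (fun h => hlm (by rw [h])), filter_false_of_mem, sum_empty]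
    exact fun d _ h => hlm (h.1.trans h.2)

lemma sum_sieveCoeff_div {z l : ℕ} (hl : l ∈ Icc 1 z) :
    ∑ d ∈ Icc 1 z with l ∣ d, sieveCoeff z d / d = μ l * sieveWeight l / sieveSum z := by
  have h1 : ∀ d ∈ {d ∈ Icc 1 z | l ∣ d}, sieveCoeff z d / d =
      ∑ m ∈ Icc 1 z, if d ∣ m then (μ d : ℝ) * sieveWeight m / sieveSum z else 0 := by
    intro d hd
    rw [mem_filter, mem_Icc] at hd
    have hd0 : (d : ℝ) ≠ 0 := by exact_mod_cast (by omega : d ≠ 0)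
    rw [← sum_filter, sieveCoeff, ← sum_div, ← mul_sum]
    field_simp
  rw [sum_congr rfl h1, sum_comm]
  have h2 : ∀ m ∈ Icc 1 z, ∑ d ∈ Icc 1 z with l ∣ d,
      (if d ∣ m then (μ d : ℝ) * sieveWeight m / sieveSum z else 0) =
      if m = l then (μ l : ℝ) * sieveWeight l / sieveSum z else 0 := by
    intro m hm
    rw [← sum_filter, filter_filter, ← sum_div, ← sum_mul]
    by_cases hsq : Squarefree m
    · rw [sum_moebius_dvd_dvd hsq (mem_Icc.1 hm).2]
      split_ifs with h
      · rw [h]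
      · simp
    · have : sieveWeight m = 0 := by simp [sieveWeight, hsq]
      rw [this]
      split_ifs with h
      · rw [← h, this]; simp
      · simp
  rw [sum_congr rfl h2, sum_ite_eq' , if_pos hl]

lemma sum_sieveCoeff_mul_div_lcm {z : ℕ} (hz : 1 ≤ z) :
    ∑ d ∈ Icc 1 z, ∑ e ∈ Icc 1 z, sieveCoeff z d * sieveCoeff z e / (Nat.lcm d e) =
      1 / sieveSum z := by
  have hS := (sieveSum_pos hz).ne'
  have h1 : ∀ d ∈ Icc 1 z, ∀ e ∈ Icc 1 z,
      sieveCoeff z d * sieveCoeff z e / (Nat.lcm d e) = ∑ l ∈ Icc 1 z,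
        l.totient * ((if l ∣ d then sieveCoeff z d / d else 0) *
          (if l ∣ e then sieveCoeff z e / e else 0)) := by
    intro d hd e he
    rw [mem_Icc] at hd he
    have hd0 : (d : ℝ) ≠ 0 := by exact_mod_cast (by omega : d ≠ 0)
    have he0 : (e : ℝ) ≠ 0 := by exact_mod_cast (by omega : e ≠ 0)
    have hl0 : (Nat.lcm d e : ℝ) ≠ 0 := by
      exact_mod_cast (Nat.lcm_pos (by omega) (by omega)).ne'
    have hg : (Nat.gcd d e : ℝ) = ∑ l ∈ Icc 1 z with l ∣ d ∧ l ∣ e, (l.totient : ℝ) := by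
      rw [← Nat.sum_totient (Nat.gcd d e)]
      push_cast
      refine sum_congr ?_ fun _ _ => rfl
      ext l
      simp only [Nat.mem_divisors, mem_filter, mem_Icc, Nat.dvd_gcd_iff]
      constructor
      · rintro ⟨⟨h1, h2⟩, -⟩
        exact ⟨⟨Nat.pos_of_dvd_of_pos h1 (by omega), (Nat.le_of_dvd (by omega) h1).trans hd.2⟩,
          h1, h2⟩
      · rintro ⟨-, h⟩
        exact ⟨h, (Nat.gcd_pos_of_pos_left _ (by omega)).ne'⟩
    have hgl : (Nat.gcd d e : ℝ) * Nat.lcm d e = d * e := by exact_mod_cast Nat.gcd_mul_lcm d e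
    have h2 : sieveCoeff z d * sieveCoeff z e / (Nat.lcm d e) =
        Nat.gcd d e * (sieveCoeff z d / d * (sieveCoeff z e / e)) := by
      field_simp
      linear_combination -(sieveCoeff z d * sieveCoeff z e) * hgl
    rw [h2, hg, sum_mul, sum_filter]
    refine sum_congr rfl fun l _ => ?_
    by_cases h3 : l ∣ d <;> by_cases h4 : l ∣ e <;> simp [h3, h4]
  rw [sum_congr rfl fun d hd => sum_congr rfl (h1 d hd)]
  have h2 : ∀ l ∈ Icc 1 z, ∑ d ∈ Icc 1 z, ∑ e ∈ Icc 1 z,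
      (l.totient : ℝ) * ((if l ∣ d then sieveCoeff z d / d else 0) *
          (if l ∣ e then sieveCoeff z e / e else 0)) = sieveWeight l / sieveSum z ^ 2 := by
    intro l hl
    simp_rw [← mul_sum]
    rw [← sum_mul, ← sum_filter, sum_sieveCoeff_div hl]
    by_cases hsq : Squarefree l
    · have hμ : (μ l : ℝ) ^ 2 = 1 := by exact_mod_cast moebius_sq_eq_one_of_squarefree hsq
      have hφ : (l.totient : ℝ) ≠ 0 := by
        exact_mod_cast (Nat.totient_pos.2 (Nat.pos_of_ne_zero hsq.ne_zero)).ne'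
      rw [sieveWeight, if_pos hsq]
      field_simp
      linear_combination hμ
    · simp [sieveWeight, hsq]
  calc _ = ∑ l ∈ Icc 1 z, sieveWeight l / sieveSum z ^ 2 := by
        rw [← sum_congr rfl h2, sum_congr rfl fun d _ => sum_comm, sum_comm]
    _ = 1 / sieveSum z := by
        rw [← sum_div, ← sieveSum]; field_simp

lemma abs_card_multiples_sub_le {u v : ℝ} (hu : 0 ≤ u) (huv : u ≤ v) {d : ℕ} (hd : 0 < d) :
    |(#{n ∈ Ioc ⌊u⌋₊ ⌊v⌋₊ | d ∣ n} : ℝ) - (v - u) / d| ≤ 1 := by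
  have hcard : #{n ∈ Ioc ⌊u⌋₊ ⌊v⌋₊ | d ∣ n} + ⌊u⌋₊ / d = ⌊v⌋₊ / d := by
    have h1 := Nat.Ioc_filter_dvd_card_eq_div ⌊u⌋₊ d
    have h2 := Nat.Ioc_filter_dvd_card_eq_div ⌊v⌋₊ d
    rw [← h1, ← h2, ← card_union_of_disjoint, ← filter_union, union_comm,
      Ioc_union_Ioc_eq_Ioc (Nat.zero_le _) (Nat.floor_mono huv)]
    exact disjoint_filter_filter (disjoint_left.2 fun n h1 h2 => by
      rw [mem_Ioc] at h1 h2; omega)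
  rw [← Nat.floor_div_natCast, ← Nat.floor_div_natCast] at hcard
  have hdR : (0 : ℝ) < d := by exact_mod_cast hd
  have h1 := Nat.floor_le (a := u / d) (by positivity)
  have h2 := Nat.lt_floor_add_one (u / d)
  have h3 := Nat.floor_le (a := v / d) (div_nonneg (hu.trans huv) hdR.le)
  have h4 := Nat.lt_floor_add_one (v / d)
  have h5 : (#{n ∈ Ioc ⌊u⌋₊ ⌊v⌋₊ | d ∣ n} : ℝ) + ⌊u / d⌋₊ = ⌊v / d⌋₊ := by exact_mod_cast hcard
  rw [sub_div, abs_le]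
  constructor <;> linarith

/-- Selberg's upper bound for the number of primes in an interval. -/
theorem card_primes_Ioc_le {u v : ℝ} {z : ℕ} (hz : 1 ≤ z) (hzu : (z : ℝ) ≤ u) (huv : u ≤ v) :
    (#{p ∈ Ioc ⌊u⌋₊ ⌊v⌋₊ | p.Prime} : ℝ) ≤ (v - u) / Real.log (z + 1) + (z : ℝ) ^ 2 := by
  have hu : 0 ≤ u := le_trans (by positivity) hzu
  have hlog : 0 < Real.log (z + 1) := Real.log_pos (by
    have : (1 : ℝ) ≤ z := by exact_mod_cast hz
    linarith)
  set A := Ioc ⌊u⌋₊ ⌊v⌋₊ with hA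
  have h1 : (#{p ∈ A | p.Prime} : ℝ) ≤
      ∑ n ∈ A, (∑ d ∈ Icc 1 z with d ∣ n, sieveCoeff z d) ^ 2 := by
    calc (#{p ∈ A | p.Prime} : ℝ) = ∑ n ∈ A with n.Prime, (1 : ℝ) := by simp
      _ ≤ ∑ n ∈ A with n.Prime, (∑ d ∈ Icc 1 z with d ∣ n, sieveCoeff z d) ^ 2 := by
          refine sum_le_sum fun p hp => ?_
          rw [mem_filter, hA, mem_Ioc] at hp
          have hzp : z < p := lt_of_le_of_lt (Nat.le_floor hzu) hp.1.1
          have : {d ∈ Icc 1 z | d ∣ p} = {1} := by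
            ext d
            simp only [mem_filter, mem_Icc, mem_singleton]
            constructor
            · rintro ⟨h, hd⟩
              rcases (Nat.dvd_prime hp.2).1 hd with h' | h' <;> omega
            · rintro rfl
              simp [hz]
          rw [this, sum_singleton, sieveCoeff_one hz]
          norm_num
      _ ≤ _ := sum_le_sum_of_subset_of_nonneg (filter_subset _ _) fun n _ _ => sq_nonneg _
  have h2 : ∑ n ∈ A, (∑ d ∈ Icc 1 z with d ∣ n, sieveCoeff z d) ^ 2 =
      ∑ d ∈ Icc 1 z, ∑ e ∈ Icc 1 z,
        sieveCoeff z d * sieveCoeff z e * #{n ∈ A | Nat.lcm d e ∣ n} := by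
    have h3 : ∀ n ∈ A, (∑ d ∈ Icc 1 z with d ∣ n, sieveCoeff z d) ^ 2 =
        ∑ d ∈ Icc 1 z, ∑ e ∈ Icc 1 z,
          if Nat.lcm d e ∣ n then sieveCoeff z d * sieveCoeff z e else 0 := by
      intro n _
      rw [sq, sum_filter, sum_mul_sum]
      refine sum_congr rfl fun d _ => sum_congr rfl fun e _ => ?_
      by_cases h3 : d ∣ n <;> by_cases h4 : e ∣ n <;> simp [Nat.lcm_dvd_iff, h3, h4]
    rw [sum_congr rfl h3, sum_comm]
    refine sum_congr rfl fun d _ => ?_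
    rw [sum_comm]
    refine sum_congr rfl fun e _ => ?_
    rw [← sum_filter, sum_const, nsmul_eq_mul, mul_comm]
  have h3 : ∑ d ∈ Icc 1 z, ∑ e ∈ Icc 1 z,
        sieveCoeff z d * sieveCoeff z e * #{n ∈ A | Nat.lcm d e ∣ n} ≤
      ∑ d ∈ Icc 1 z, ∑ e ∈ Icc 1 z,
        ((v - u) * (sieveCoeff z d * sieveCoeff z e / Nat.lcm d e) + 1) := by
    refine sum_le_sum fun d hd => sum_le_sum fun e he => ?_
    rw [mem_Icc] at hd he
    have h4 := abs_card_multiples_sub_le hu huv (Nat.lcm_pos (by omega : 0 < d) (by omega : 0 < e))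
    have h5 : |sieveCoeff z d * sieveCoeff z e| ≤ 1 := by
      rw [abs_mul]
      exact mul_le_one₀ (abs_sieveCoeff_le_one hz d) (abs_nonneg _) (abs_sieveCoeff_le_one hz e)
    have h6 : |sieveCoeff z d * sieveCoeff z e *
        ((#{n ∈ A | Nat.lcm d e ∣ n} : ℝ) - (v - u) / Nat.lcm d e)| ≤ 1 := by
      rw [abs_mul]
      exact mul_le_one₀ h5 (abs_nonneg _) h4
    have h7 := (abs_le.1 h6).2
    have h8 : (v - u) * (sieveCoeff z d * sieveCoeff z e / Nat.lcm d e) =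
      sieveCoeff z d * sieveCoeff z e * ((v - u) / Nat.lcm d e) := by ring
    rw [h8]
    linarith
  have h4 : ∑ d ∈ Icc 1 z, ∑ e ∈ Icc 1 z,
        ((v - u) * (sieveCoeff z d * sieveCoeff z e / Nat.lcm d e) + 1) =
      (v - u) * (1 / sieveSum z) + (z : ℝ) ^ 2 := by
    simp_rw [sum_add_distrib, ← mul_sum]
    rw [sum_sieveCoeff_mul_div_lcm hz]
    simp [sq]
  rw [h4] at h3
  have h5 : (v - u) * (1 / sieveSum z) ≤ (v - u) / Real.log (z + 1) := by
    rw [mul_one_div]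
    exact div_le_div_of_nonneg_left (by linarith) hlog (log_le_sieveSum z)
  linarith [h1.trans_eq h2]

end SelbergSieve

section Bump

open Set Topology ArithmeticFunction

/-- The Gaussian `exp (-μ ((v - β) / D)²)` centred at `β`, of width `D`. -/
noncomputable def bump (μ D β v : ℝ) : ℝ := Real.exp (-μ * ((v - β) / D) ^ 2)

/-- The archimedean part of the explicit formula on the critical line. -/
noncomputable def archPart (k : ℝ → ℝ) : ℝ :=
  -(Real.log π + Real.eulerMascheroniConstant) / 2 * k 0
    + (∫ w in Ioi (0 : ℝ), (k 0 - Real.exp (-(1 / 2) * (w / 2)) * k (w / 2)) / (Real.exp w - 1)) / 2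

/-- The contribution of the pole to the explicit formula on the critical line. -/
noncomputable def polePart (k : ℝ → ℝ) : ℝ :=
  ∫ w in Ioi (0 : ℝ), Real.exp w * (Real.exp (-(1 / 2) * w) * k w)

/-- The contribution of the primes to the explicit formula on the critical line. -/
noncomputable def primePart (k : ℝ → ℝ) : ℝ :=
  ∑' n : ℕ, vonMangoldt n * (Real.exp (-(1 / 2) * Real.log n) * k (Real.log n))

lemma weilForm_half (k : ℝ → ℝ) : weilForm (1 / 2) k = archPart k + polePart k - primePart k :=
  rfl

variable {μ D : ℝ}

lemma bump_eq_gauss (hμ : 0 < μ) (hD : 0 < D) (β : ℝ) : bump μ D β = gauss (D ^ 2 / (4 * μ)) β := by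
  ext v
  rw [bump, gauss]
  congr 1
  field_simp

lemma bump_pos (β v : ℝ) : 0 < bump μ D β v := Real.exp_pos _

lemma bump_le_one (hμ : 0 ≤ μ) (β v : ℝ) : bump μ D β v ≤ 1 :=
  Real.exp_le_one_iff.2 (by nlinarith [mul_nonneg hμ (sq_nonneg ((v - β) / D))])

lemma integrableOn_arch_bump (hμ : 0 < μ) (hD : 0 < D) (β : ℝ) :
    IntegrableOn (fun w ↦ (bump μ D β 0 - Real.exp (-(1 / 2) * (w / 2)) * bump μ D β (w / 2))
      / (Real.exp w - 1)) (Ioi 0) := by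
  rw [bump_eq_gauss hμ hD]
  exact integrableOn_digamma_integrand (by positivity) β (by norm_num) (by norm_num)

lemma summable_prime_bump (hμ : 0 < μ) (hD : 0 < D) (β : ℝ) :
    Summable fun n : ℕ ↦ vonMangoldt n *
      (Real.exp (-(1 / 2) * Real.log n) * bump μ D β (Real.log n)) := by
  rw [bump_eq_gauss hμ hD]
  exact summable_prime_term (by positivity) β (by norm_num)

/-- Positivity of the explicit formula for the test function
`(∑ Tⱼ cos (j b u) - cos (l u) ∑ aⱼ cos (j b u)) exp (-α u²)`. -/
theorem sum_weilForm_bump_nonneg (hRH : RiemannHypothesis) (hμ : 0 < μ) (hD : 0 < D) (N : ℕ)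
    (a T : ℕ → ℝ) (b l : ℝ)
    (hT : ∀ θ : ℝ, |∑ j ∈ Finset.range N, a j * Real.cos (j * θ)| ≤
      ∑ j ∈ Finset.range N, T j * Real.cos (j * θ)) :
    0 ≤ ∑ j ∈ Finset.range N,
      (T j / 2 * (weilForm (1 / 2) (bump μ D (j * b)) + weilForm (1 / 2) (bump μ D (-(j * b))))
      - a j / 4 * (weilForm (1 / 2) (bump μ D (l + j * b)) + weilForm (1 / 2) (bump μ D (l - j * b))
        + weilForm (1 / 2) (bump μ D (-(l + j * b)))
        + weilForm (1 / 2) (bump μ D (-(l - j * b))))) := by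
  set c : ℕ × Fin 6 → ℝ := fun i =>
    ![T i.1 / 2, T i.1 / 2, -(a i.1 / 4), -(a i.1 / 4), -(a i.1 / 4), -(a i.1 / 4)] i.2 with hc
  set β : ℕ × Fin 6 → ℝ := fun i =>
    ![i.1 * b, -(i.1 * b), l + i.1 * b, l - i.1 * b, -(l + i.1 * b), -(l - i.1 * b)] i.2 with hβ
  have h := sum_mul_weilForm_nonneg hRH (Finset.range N ×ˢ (Finset.univ : Finset (Fin 6))) c β
    (α := D ^ 2 / (4 * μ)) (by positivity) ?_ ?_
  · rw [Finset.sum_product] at h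
    refine h.trans_eq (Finset.sum_congr rfl fun j _ => ?_)
    rw [Fin.sum_univ_six]
    simp only [bump_eq_gauss hμ hD, hc, hβ]
    simp
    ring
  · intro u
    rw [Finset.sum_product]
    refine Finset.sum_eq_zero fun j _ => ?_
    rw [Fin.sum_univ_six]
    simp only [hc, hβ]
    simp only [Matrix.cons_val, neg_mul, Real.sin_neg]
    ring
  · intro u
    have h1 := hT (b * u)
    have h2 : ∑ i ∈ Finset.range N ×ˢ (Finset.univ : Finset (Fin 6)), c i * Real.cos (β i * u) =
        ∑ j ∈ Finset.range N, T j * Real.cos (j * (b * u)) -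
          Real.cos (l * u) * ∑ j ∈ Finset.range N, a j * Real.cos (j * (b * u)) := by
      rw [Finset.sum_product, Finset.mul_sum, ← Finset.sum_sub_distrib]
      refine Finset.sum_congr rfl fun j _ => ?_
      rw [Fin.sum_univ_six]
      simp only [hc, hβ]
      simp only [Matrix.cons_val, neg_mul, Real.cos_neg, add_mul, sub_mul, Real.cos_add,
        Real.cos_sub, mul_assoc]
      ring
    rw [h2, sub_nonneg]
    refine (le_abs_self _).trans (le_trans ?_ h1)
    rw [abs_mul]
    exact mul_le_of_le_one_left (abs_nonneg _) (Real.abs_cos_le_one _)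

end Bump

section ArchimedeanBounds

open Set Topology

lemma hasDerivAt_log_one_sub_exp_neg {w : ℝ} (hw : 0 < w) :
    HasDerivAt (fun w ↦ Real.log (1 - Real.exp (-w))) (1 / (Real.exp w - 1)) w := by
  have h1 : Real.exp (-w) < 1 := Real.exp_lt_one_iff.2 (by linarith)
  have h2 : (1 : ℝ) < Real.exp w := Real.one_lt_exp_iff.2 hw
  have h := (((Real.hasDerivAt_exp (-w)).comp w (hasDerivAt_neg w)).const_sub 1).log
    (by simpa using (sub_pos.2 h1).ne')
  convert! h using 1
  simp only [Function.comp]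
  rw [Real.exp_neg] at h1 ⊢
  have : Real.exp w - 1 ≠ 0 := by linarith
  have : Real.exp w ≠ 0 := by positivity
  field_simp

lemma tendsto_log_one_sub_exp_neg :
    Tendsto (fun w : ℝ ↦ Real.log (1 - Real.exp (-w))) atTop (𝓝 0) := by
  have h : Tendsto (fun w : ℝ ↦ 1 - Real.exp (-w)) atTop (𝓝 (1 - 0)) :=
    (Real.tendsto_exp_neg_atTop_nhds_zero).const_sub 1
  rw [sub_zero] at h
  simpa using h.log one_ne_zero

lemma integrableOn_inv_exp_sub_one {c : ℝ} (hc : 0 < c) :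
    IntegrableOn (fun w ↦ 1 / (Real.exp w - 1)) (Ioi c) :=
  integrableOn_Ioi_deriv_of_nonneg'
    (fun _ hw ↦ hasDerivAt_log_one_sub_exp_neg (hc.trans_le hw))
    (fun _ hw ↦ one_div_nonneg.2 (sub_nonneg.2 (Real.one_le_exp (hc.trans hw).le)))
    tendsto_log_one_sub_exp_neg

lemma integral_inv_exp_sub_one {c : ℝ} (hc : 0 < c) :
    ∫ w in Ioi c, 1 / (Real.exp w - 1) = -Real.log (1 - Real.exp (-c)) := by
  rw [integral_Ioi_of_hasDerivAt_of_nonneg'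
    (fun _ hw ↦ hasDerivAt_log_one_sub_exp_neg (hc.trans_le hw))
    (fun _ hw ↦ one_div_nonneg.2 (sub_nonneg.2 (Real.one_le_exp (hc.trans hw).le)))
    tendsto_log_one_sub_exp_neg, zero_sub]

lemma neg_log_one_sub_exp_neg_le {c : ℝ} (hc : 0 < c) :
    -Real.log (1 - Real.exp (-c)) ≤ Real.log (1 / c) + c := by
  have h1 : c * Real.exp (-c) ≤ 1 - Real.exp (-c) := by
    have h := Real.add_one_le_exp c
    have h' : Real.exp c * Real.exp (-c) = 1 := by rw [← Real.exp_add]; simp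
    nlinarith [Real.exp_pos (-c)]
  have h2 := Real.log_le_log (by positivity) h1
  rw [Real.log_mul hc.ne' (Real.exp_ne_zero _), Real.log_exp] at h2
  rw [one_div, Real.log_inv]
  linarith

lemma log_inv_le_neg_log_one_sub_exp_neg {c : ℝ} (hc : 0 < c) :
    Real.log (1 / c) ≤ -Real.log (1 - Real.exp (-c)) := by
  have h1 : 1 - Real.exp (-c) ≤ c := by linarith [Real.add_one_le_exp (-c)]
  have h2 := Real.log_le_log (sub_pos.2 (Real.exp_lt_one_iff.2 (by linarith))) h1
  rw [one_div, Real.log_inv]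
  linarith

variable {μ D : ℝ}

lemma bump_zero (β : ℝ) : bump μ D β 0 = Real.exp (-μ * (β / D) ^ 2) := by
  rw [bump]; congr 2; ring

lemma bump_add_bump_neg_ge (β v : ℝ) :
    2 * (Real.exp (-μ * (β / D) ^ 2) * Real.exp (-(μ * (v / D) ^ 2))) ≤
      bump μ D β v + bump μ D (-β) v := by
  have h1 : bump μ D β v = Real.exp (-μ * (β / D) ^ 2) * Real.exp (-(μ * (v / D) ^ 2)) *
      Real.exp (2 * μ * (v / D) * (β / D)) := by
    rw [bump, ← Real.exp_add, ← Real.exp_add]; congr 1; ring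
  have h2 : bump μ D (-β) v = Real.exp (-μ * (β / D) ^ 2) * Real.exp (-(μ * (v / D) ^ 2)) *
      Real.exp (-(2 * μ * (v / D) * (β / D))) := by
    rw [bump, ← Real.exp_add, ← Real.exp_add]; congr 1; ring
  rw [h1, h2, ← mul_add, mul_comm 2]
  refine mul_le_mul_of_nonneg_left ?_ (by positivity)
  linarith [Real.add_one_le_exp (2 * μ * (v / D) * (β / D)),
    Real.add_one_le_exp (-(2 * μ * (v / D) * (β / D)))]

lemma abs_exp_neg_sq_sub_le (x y : ℝ) :
    |Real.exp (-x ^ 2) - Real.exp (-y ^ 2)| ≤ |x - y| := by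
  have hd : ∀ z : ℝ, HasDerivAt (fun z ↦ Real.exp (-z ^ 2)) (Real.exp (-z ^ 2) * (-(2 * z))) z := by
    intro z
    simpa using ((hasDerivAt_pow 2 z).neg).exp
  have h := Convex.norm_image_sub_le_of_norm_hasDerivWithin_le (f := fun z : ℝ ↦ Real.exp (-z ^ 2))
    (C := 1) (s := univ) (fun z _ ↦ (hd z).hasDerivWithinAt) (fun z _ ↦ ?_) convex_univ
    (mem_univ y) (mem_univ x)
  · simpa using h
  · rw [norm_mul, Real.norm_eq_abs, Real.norm_eq_abs, abs_of_pos (Real.exp_pos _), abs_neg, abs_mul,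
      abs_two, Real.exp_neg, inv_mul_le_one₀ (Real.exp_pos _)]
    have h1 := Real.add_one_le_exp (z ^ 2)
    nlinarith [sq_nonneg (|z| - 1), sq_abs z]

lemma abs_bump_sub_bump_zero_le (hμ : 0 < μ) (hD : 0 < D) (β : ℝ) {v : ℝ} (hv : 0 ≤ v) :
    |bump μ D β v - bump μ D β 0| ≤ √μ * v / D := by
  have h : ∀ v, bump μ D β v = Real.exp (-(√μ * ((v - β) / D)) ^ 2) := by
    intro v
    rw [bump, mul_pow, Real.sq_sqrt hμ.le, neg_mul]
  rw [h, h]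
  refine (abs_exp_neg_sq_sub_le _ _).trans_eq ?_
  rw [show √μ * ((v - β) / D) - √μ * ((0 - β) / D) = √μ * v / D by ring, abs_of_nonneg (by positivity)]

lemma integrable_bump (hμ : 0 < μ) (hD : 0 < D) (β : ℝ) : Integrable (bump μ D β) := by
  have h := ((integrable_exp_neg_mul_sq (b := μ / D ^ 2) (by positivity)).comp_sub_right β)
  refine h.congr (Eventually.of_forall fun v ↦ ?_)
  simp only [bump]
  congr 1
  ring

lemma integral_bump (hμ : 0 < μ) (hD : 0 < D) (β : ℝ) : ∫ v, bump μ D β v = D * √(π / μ) := by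
  have h : ∀ v, bump μ D β v = Real.exp (-(μ / D ^ 2) * (v - β) ^ 2) := by
    intro v; simp only [bump]; congr 1; ring
  simp_rw [h]
  rw [integral_sub_right_eq_self (fun v ↦ Real.exp (-(μ / D ^ 2) * v ^ 2)) β, integral_gaussian,
    show π / (μ / D ^ 2) = D ^ 2 * (π / μ) by field_simp, Real.sqrt_mul (by positivity),
    Real.sqrt_sq hD.le]

/-- The integrand of the archimedean part attached to a symmetric pair of Gaussians. -/
noncomputable def archIntegrand (μ D β w : ℝ) : ℝ :=
  (Real.exp (-μ * (β / D) ^ 2) -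
    Real.exp (-(1 / 2) * (w / 2)) * ((bump μ D β (w / 2) + bump μ D (-β) (w / 2)) / 2))
      / (Real.exp w - 1)

lemma integrableOn_archIntegrand (hμ : 0 < μ) (hD : 0 < D) (β : ℝ) :
    IntegrableOn (archIntegrand μ D β) (Ioi 0) := by
  have h := ((integrableOn_arch_bump hμ hD β).add (integrableOn_arch_bump hμ hD (-β))).div_const 2
  refine h.congr (Eventually.of_forall fun w ↦ ?_)
  simp only [archIntegrand, Pi.add_apply, bump_zero]
  rw [neg_div, neg_sq]
  ring

lemma archPart_pair (hμ : 0 < μ) (hD : 0 < D) (β : ℝ) :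
    archPart (bump μ D β) + archPart (bump μ D (-β)) =
      -(Real.log π + Real.eulerMascheroniConstant) * Real.exp (-μ * (β / D) ^ 2)
        + ∫ w in Ioi 0, archIntegrand μ D β w := by
  have h1 : ∫ w in Ioi 0, archIntegrand μ D β w =
      ((∫ w in Ioi (0 : ℝ), (bump μ D β 0 - Real.exp (-(1 / 2) * (w / 2)) * bump μ D β (w / 2))
        / (Real.exp w - 1)) +
      ∫ w in Ioi (0 : ℝ), (bump μ D (-β) 0 - Real.exp (-(1 / 2) * (w / 2)) * bump μ D (-β) (w / 2))
        / (Real.exp w - 1)) / 2 := by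
    rw [← integral_add (integrableOn_arch_bump hμ hD β) (integrableOn_arch_bump hμ hD (-β)),
      ← integral_div]
    refine integral_congr_ae (Eventually.of_forall fun w ↦ ?_)
    simp only [archIntegrand, bump_zero]
    rw [neg_div, neg_sq]
    ring
  have hneg : (-β / D) ^ 2 = (β / D) ^ 2 := by ring
  rw [h1, archPart, archPart]
  simp only [bump_zero, hneg]
  ring

lemma setIntegral_Ioi_eq_add {f : ℝ → ℝ} {c : ℝ} (hc : 0 ≤ c) (hf : IntegrableOn f (Ioi 0)) :
    ∫ w in Ioi 0, f w = (∫ w in Ioc 0 c, f w) + ∫ w in Ioi c, f w := by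
  rw [← Ioc_union_Ioi_eq_Ioi hc, setIntegral_union (Ioc_disjoint_Ioi le_rfl) measurableSet_Ioi
    (hf.mono_set Ioc_subset_Ioi_self) (hf.mono_set (Ioi_subset_Ioi hc))]

/-- Upper bound for the archimedean part of a pair of Gaussians near the origin. -/
lemma archPart_pair_le (hμ : 0 < μ) (hD : 0 < D) (β : ℝ) :
    archPart (bump μ D β) + archPart (bump μ D (-β)) ≤ Real.exp (-μ * (β / D) ^ 2) *
      (Real.log (1 / D) - (Real.log π + Real.eulerMascheroniConstant) + μ / 8 + 2 * D) := by
  rw [archPart_pair hμ hD]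
  set E := Real.exp (-μ * (β / D) ^ 2) with hE
  have hE0 : 0 < E := Real.exp_pos _
  have hInt := integrableOn_archIntegrand hμ hD β
  rw [setIntegral_Ioi_eq_add hD.le hInt]
  have hbound : ∀ w, 0 < w → archIntegrand μ D β w ≤
      E * (1 - Real.exp (-(w / 4 + μ * (w / 2 / D) ^ 2))) / (Real.exp w - 1) := by
    intro w hw
    have h2 : (1 : ℝ) < Real.exp w := Real.one_lt_exp_iff.2 hw
    rw [archIntegrand]
    refine div_le_div_of_nonneg_right ?_ (by linarith)
    have h3 := bump_add_bump_neg_ge (μ := μ) (D := D) β (w / 2)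
    have h4 : Real.exp (-(w / 4 + μ * (w / 2 / D) ^ 2)) =
        Real.exp (-(1 / 2) * (w / 2)) * Real.exp (-(μ * (w / 2 / D) ^ 2)) := by
      rw [← Real.exp_add]; congr 1; ring
    rw [h4, ← hE] at *
    nlinarith [Real.exp_pos (-(1 / 2) * (w / 2))]
  have h1 : ∫ w in Ioc 0 D, archIntegrand μ D β w ≤ E * (D / 4 + μ / 8) := by
    calc ∫ w in Ioc 0 D, archIntegrand μ D β w
        ≤ ∫ w in Ioc 0 D, E * (1 / 4 + μ / (4 * D ^ 2) * w) := by
          refine setIntegral_mono_on (hInt.mono_set Ioc_subset_Ioi_self)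
            ((by fun_prop : Continuous fun w : ℝ ↦ E * (1 / 4 + μ / (4 * D ^ 2) * w)).integrableOn_Ioc)
            measurableSet_Ioc fun w hw ↦ (hbound w hw.1).trans ?_
          have h2 : w ≤ Real.exp w - 1 := by linarith [Real.add_one_le_exp w]
          have h3 : 0 < w := hw.1
          have h4 : 1 - Real.exp (-(w / 4 + μ * (w / 2 / D) ^ 2)) ≤ w / 4 + μ * (w / 2 / D) ^ 2 := by
            linarith [Real.add_one_le_exp (-(w / 4 + μ * (w / 2 / D) ^ 2))]
          rw [div_le_iff₀ (by linarith)]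
          calc E * (1 - Real.exp (-(w / 4 + μ * (w / 2 / D) ^ 2)))
              ≤ E * (w / 4 + μ * (w / 2 / D) ^ 2) := by gcongr
            _ = E * (1 / 4 + μ / (4 * D ^ 2) * w) * w := by field_simp; ring
            _ ≤ _ := by gcongr
      _ = E * (D / 4 + μ / 8) := by
          rw [← intervalIntegral.integral_of_le hD.le, intervalIntegral.integral_const_mul,
            intervalIntegral.integral_add (by simp) (by
              apply Continuous.intervalIntegrable; fun_prop),
            intervalIntegral.integral_const, intervalIntegral.integral_const_mul, integral_id]
          rw [smul_eq_mul]
          field_simp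
          ring
  have h2 : ∫ w in Ioi D, archIntegrand μ D β w ≤ E * -Real.log (1 - Real.exp (-D)) := by
    rw [← integral_inv_exp_sub_one hD, ← integral_const_mul]
    refine setIntegral_mono_on (hInt.mono_set (Ioi_subset_Ioi hD.le))
      ((integrableOn_inv_exp_sub_one hD).const_mul _) measurableSet_Ioi fun w hw ↦
      (hbound w (hD.trans hw)).trans ?_
    have h2 : (1 : ℝ) < Real.exp w := Real.one_lt_exp_iff.2 (hD.trans hw)
    rw [mul_one_div]
    refine div_le_div_of_nonneg_right ?_ (by linarith)
    nlinarith [Real.exp_pos (-(w / 4 + μ * (w / 2 / D) ^ 2))]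
  have h3 := mul_le_mul_of_nonneg_left (neg_log_one_sub_exp_neg_le hD) hE0.le
  nlinarith [mul_pos hE0 hD]

/-- Lower bound for the archimedean part of a pair of Gaussians near the origin. -/
lemma le_archPart_pair (hμ : 0 < μ) (hD : 0 < D) (β : ℝ) :
    Real.exp (-μ * (β / D) ^ 2) *
      (Real.log (1 / D) - (Real.log π + Real.eulerMascheroniConstant)) - √μ / 2 - 2 * √(π / μ) ≤
      archPart (bump μ D β) + archPart (bump μ D (-β)) := by
  rw [archPart_pair hμ hD]
  set E := Real.exp (-μ * (β / D) ^ 2) with hE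
  have hE0 : 0 < E := Real.exp_pos _
  have hInt := integrableOn_archIntegrand hμ hD β
  rw [setIntegral_Ioi_eq_add hD.le hInt]
  have h1 : -(√μ / 2) ≤ ∫ w in Ioc 0 D, archIntegrand μ D β w := by
    calc -(√μ / 2) = ∫ w in Ioc 0 D, -(√μ / (2 * D)) := by
          rw [setIntegral_const]
          simp [hD.le]
          field_simp
      _ ≤ _ := by
          refine setIntegral_mono_on (by simp) (hInt.mono_set Ioc_subset_Ioi_self)
            measurableSet_Ioc fun w hw ↦ ?_
          have h3 : 0 < w := hw.1
          have h2 : w ≤ Real.exp w - 1 := by linarith [Real.add_one_le_exp w]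
          have h4 := (abs_le.1 (abs_bump_sub_bump_zero_le hμ hD β (v := w / 2) (by positivity))).2
          have h5 := (abs_le.1 (abs_bump_sub_bump_zero_le hμ hD (-β) (v := w / 2) (by positivity))).2
          rw [bump_zero] at h4 h5
          rw [neg_div, neg_sq] at h5
          rw [← hE] at h4 h5
          have h6 : Real.exp (-(1 / 2) * (w / 2)) ≤ 1 := Real.exp_le_one_iff.2 (by linarith)
          have h7 : 0 < (bump μ D β (w / 2) + bump μ D (-β) (w / 2)) / 2 := by
            linarith [bump_pos (μ := μ) (D := D) β (w / 2), bump_pos (μ := μ) (D := D) (-β) (w / 2)]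
          rw [archIntegrand, le_div_iff₀ (by linarith)]
          have h8 : √μ * (w / 2) / D = √μ / (2 * D) * w := by ring
          have h9 : √μ / (2 * D) * w ≤ √μ / (2 * D) * (Real.exp w - 1) := by gcongr
          have h10 := mul_le_of_le_one_left h7.le h6
          rw [← hE]
          linarith
  have h2 : E * -Real.log (1 - Real.exp (-D)) - 2 * √(π / μ) ≤
      ∫ w in Ioi D, archIntegrand μ D β w := by
    have hb : ∀ β, Integrable fun w ↦ bump μ D β (w / 2) := fun β ↦
      (integrable_bump hμ hD β).comp_div two_ne_zero
    have hb' : ∀ β, ∫ w in Ioi D, bump μ D β (w / 2) ≤ 2 * (D * √(π / μ)) := by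
      intro β
      refine (setIntegral_le_integral (hb β) (Eventually.of_forall fun w ↦ (bump_pos _ _).le)).trans ?_
      rw [Measure.integral_comp_div, integral_bump hμ hD]
      simp
    have hI := integrableOn_inv_exp_sub_one hD
    have hsum : IntegrableOn (fun w ↦ bump μ D β (w / 2) + bump μ D (-β) (w / 2)) (Ioi D) :=
      (hb β).integrableOn.add (hb (-β)).integrableOn
    calc E * -Real.log (1 - Real.exp (-D)) - 2 * √(π / μ)
        ≤ E * (∫ w in Ioi D, 1 / (Real.exp w - 1)) -
            1 / (2 * D) * ((∫ w in Ioi D, bump μ D β (w / 2)) +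
              ∫ w in Ioi D, bump μ D (-β) (w / 2)) := by
          rw [integral_inv_exp_sub_one hD]
          have h3 : 1 / (2 * D) * ((∫ w in Ioi D, bump μ D β (w / 2)) +
              ∫ w in Ioi D, bump μ D (-β) (w / 2)) ≤
              1 / (2 * D) * (2 * (D * √(π / μ)) + 2 * (D * √(π / μ))) :=
            mul_le_mul_of_nonneg_left (add_le_add (hb' β) (hb' (-β))) (by positivity)
          have h4 : 1 / (2 * D) * (2 * (D * √(π / μ)) + 2 * (D * √(π / μ))) = 2 * √(π / μ) := by
            field_simp; ring
          linarith
      _ = ∫ w in Ioi D, (E * (1 / (Real.exp w - 1)) -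
            1 / (2 * D) * (bump μ D β (w / 2) + bump μ D (-β) (w / 2))) := by
          rw [integral_sub (hI.const_mul _)
            (hsum.const_mul _), integral_const_mul,
            integral_const_mul, integral_add (hb β).integrableOn (hb (-β)).integrableOn]
      _ ≤ _ := by
          refine setIntegral_mono_on ((hI.const_mul _).sub
            (hsum.const_mul _))
            (hInt.mono_set (Ioi_subset_Ioi hD.le)) measurableSet_Ioi fun w hw ↦ ?_
          have hw' : D < w := hw
          have h3 : D ≤ Real.exp w - 1 := by linarith [Real.add_one_le_exp w]
          have h6 : Real.exp (-(1 / 2) * (w / 2)) ≤ 1 := Real.exp_le_one_iff.2 (by linarith)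
          have h7 : 0 < bump μ D β (w / 2) + bump μ D (-β) (w / 2) := by
            linarith [bump_pos (μ := μ) (D := D) β (w / 2), bump_pos (μ := μ) (D := D) (-β) (w / 2)]
          rw [archIntegrand, sub_div, ← hE, mul_one_div]
          refine sub_le_sub_left ?_ _
          rw [show 1 / (2 * D) * (bump μ D β (w / 2) + bump μ D (-β) (w / 2)) =
            (bump μ D β (w / 2) + bump μ D (-β) (w / 2)) / 2 / D by ring]
          refine div_le_div₀ (by positivity) ?_ hD h3
          exact mul_le_of_le_one_left (by positivity) h6
  have h3 := mul_le_mul_of_nonneg_left (log_inv_le_neg_log_one_sub_exp_neg hD) hE0.le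
  linarith

end ArchimedeanBounds

section PoleBounds

open Set Topology

variable {μ D : ℝ}

lemma exp_half_mul_bump (hμ : 0 < μ) (hD : 0 < D) (β w : ℝ) :
    Real.exp w * (Real.exp (-(1 / 2) * w) * bump μ D β w) =
      Real.exp (β / 2 + D ^ 2 / (16 * μ)) * bump μ D (β + D ^ 2 / (4 * μ)) w := by
  simp only [bump]
  rw [← Real.exp_add, ← Real.exp_add, ← Real.exp_add]
  congr 1
  field_simp
  ring

lemma polePart_nonneg (β : ℝ) : 0 ≤ polePart (bump μ D β) :=
  setIntegral_nonneg measurableSet_Ioi fun _ _ ↦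
    mul_nonneg (Real.exp_pos _).le (mul_nonneg (Real.exp_pos _).le (bump_pos _ _).le)

lemma polePart_le (hμ : 0 < μ) (hD : 0 < D) (β : ℝ) :
    polePart (bump μ D β) ≤ D * √(π / μ) * Real.exp (β / 2 + D ^ 2 / (16 * μ)) := by
  rw [polePart]
  simp_rw [exp_half_mul_bump hμ hD]
  rw [integral_const_mul, mul_comm (D * _), ← integral_bump hμ hD (β + D ^ 2 / (4 * μ))]
  refine mul_le_mul_of_nonneg_left ?_ (Real.exp_pos _).le
  exact setIntegral_le_integral (integrable_bump hμ hD _)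
    (Eventually.of_forall fun w ↦ (bump_pos _ _).le)

lemma le_polePart (hμ : 0 < μ) (hD : 0 < D) {β : ℝ} (hβ : 0 ≤ β) :
    D * √(π / μ) * Real.exp (β / 2) - 2 * Real.exp (-μ * (β / D) ^ 2) ≤ polePart (bump μ D β) := by
  have hi : Integrable fun w ↦ Real.exp w * (Real.exp (-(1 / 2) * w) * bump μ D β w) := by
    simp_rw [exp_half_mul_bump hμ hD]
    exact (integrable_bump hμ hD _).const_mul _
  have h1 : ∫ w, Real.exp w * (Real.exp (-(1 / 2) * w) * bump μ D β w) =
      D * √(π / μ) * Real.exp (β / 2 + D ^ 2 / (16 * μ)) := by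
    simp_rw [exp_half_mul_bump hμ hD]
    rw [integral_const_mul, integral_bump hμ hD, mul_comm]
  have h2 := integral_add_compl (measurableSet_Ioi (a := (0 : ℝ))) hi
  rw [compl_Ioi, h1] at h2
  have h3 : ∫ w in Iic 0, Real.exp w * (Real.exp (-(1 / 2) * w) * bump μ D β w) ≤
      2 * Real.exp (-μ * (β / D) ^ 2) := by
    have hI : IntegrableOn (fun w : ℝ ↦ Real.exp (1 / 2 * w)) (Iic 0) :=
      integrableOn_exp_mul_Iic (by norm_num) 0
    have hv : ∫ w in Iic (0 : ℝ), Real.exp (1 / 2 * w) = 2 := by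
      rw [integral_exp_mul_Iic (by norm_num)]; norm_num
    refine le_of_le_of_eq ?_ (congrArg (· * Real.exp (-μ * (β / D) ^ 2)) hv)
    rw [← integral_mul_const]
    refine setIntegral_mono_on hi.integrableOn (hI.mul_const _) measurableSet_Iic fun w hw ↦ ?_
    have hw' : w ≤ 0 := hw
    rw [← mul_assoc, ← Real.exp_add, show w + -(1 / 2) * w = 1 / 2 * w by ring]
    refine mul_le_mul_of_nonneg_left ?_ (Real.exp_pos _).le
    rw [bump, Real.exp_le_exp, neg_mul, neg_mul, neg_le_neg_iff, div_pow, div_pow]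
    gcongr μ * (?_ / _)
    nlinarith
  have h4 : D * √(π / μ) * Real.exp (β / 2) ≤
      D * √(π / μ) * Real.exp (β / 2 + D ^ 2 / (16 * μ)) := by
    gcongr
    have : 0 ≤ D ^ 2 / (16 * μ) := by positivity
    linarith
  rw [polePart]
  linarith

end PoleBounds

section PrimeTail

open Set Topology ArithmeticFunction

variable {μ D : ℝ}

lemma primePart_nonneg (β : ℝ) : 0 ≤ primePart (bump μ D β) :=
  tsum_nonneg fun _ ↦ mul_nonneg vonMangoldt_nonneg
    (mul_nonneg (Real.exp_pos _).le (bump_pos _ _).le)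

/-- A Gaussian centred well to the left of `log 2` sees almost no primes. -/
lemma primePart_le (hμ : 4 ≤ μ) (hD : 0 < D) (hD' : D ≤ 1 / 100) {β : ℝ} (hβ : β ≤ 3 / 10) :
    primePart (bump μ D β) ≤ D := by
  have hμ0 : 0 < μ := by linarith
  set s := 1 / D with hs
  have hs100 : 100 ≤ s := by rw [hs, le_div_iff₀ hD]; linarith
  have hterm : ∀ n : ℕ, vonMangoldt n * (Real.exp (-(1 / 2) * Real.log n) * bump μ D β (Real.log n))
      ≤ D / 2 * (1 / (n : ℝ) ^ 2) := by
    intro n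
    rcases lt_or_ge n 2 with hn | hn
    · have h0 : vonMangoldt n = 0 := by
        interval_cases n
        · simp
        · simp
      rw [h0, zero_mul]
      positivity
    have hn0 : (0 : ℝ) < n := by positivity
    have hlog : Real.log 2 ≤ Real.log n := Real.log_le_log (by norm_num) (by exact_mod_cast hn)
    have hl2 := Real.log_two_gt_d9
    set L := Real.log n with hL
    have hn' : (n : ℝ) = Real.exp L := (Real.exp_log hn0).symm
    have h1 : bump μ D β L ≤ Real.exp (-(s * L) - 3 * L) := by
      rw [bump, Real.exp_le_exp]
      have h2 : L / 2 ≤ L - β := by linarith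
      have h3 : (L / 2) ^ 2 ≤ (L - β) ^ 2 := pow_le_pow_left₀ (by linarith) h2 2
      have h4 : (L / 2) ^ 2 * s ^ 2 ≤ ((L - β) / D) ^ 2 := by
        rw [show ((L - β) / D) ^ 2 = (L - β) ^ 2 * s ^ 2 by rw [hs]; ring]
        gcongr
      have h5 : 4 * ((L / 2) ^ 2 * s ^ 2) ≤ μ * ((L - β) / D) ^ 2 := by gcongr
      have h6 : s * L + 3 * L ≤ L ^ 2 * s ^ 2 := by nlinarith [mul_pos (show 0 < L by linarith) (show 0 < s by linarith), mul_le_mul hs100 (show 0.69 ≤ L by linarith) (by norm_num) (by linarith)]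
      nlinarith
    have h7 : Real.exp (-(1 / 2) * L) ≤ 1 := Real.exp_le_one_iff.2 (by linarith)
    have h8 : vonMangoldt n ≤ Real.exp L := by
      refine vonMangoldt_le_log.trans ?_
      linarith [Real.add_one_le_exp L]
    have h9 : Real.exp (-(s * L)) ≤ D / 2 := by
      have h10 : 2 * s ≤ Real.exp (s * L) := by
        have h11 : s * L / 2 + 1 ≤ Real.exp (s * L / 2) := Real.add_one_le_exp _
        have h12 : Real.exp (s * L) = Real.exp (s * L / 2) ^ 2 := by
          rw [← Real.exp_nat_mul]; congr 1; push_cast; ring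
        have h13 : 0.69 * s ≤ s * L := by nlinarith
        rw [h12]
        nlinarith
      rw [Real.exp_neg, inv_le_comm₀ (Real.exp_pos _) (by positivity), inv_div]
      calc 2 / D = 2 * s := by rw [hs]; ring
        _ ≤ _ := h10
    calc vonMangoldt n * (Real.exp (-(1 / 2) * L) * bump μ D β L)
        ≤ Real.exp L * (1 * Real.exp (-(s * L) - 3 * L)) := by
          gcongr
          · exact mul_nonneg (Real.exp_pos _).le (bump_pos _ _).le
          · exact (bump_pos _ _).le
      _ = Real.exp (-(s * L)) * (1 / (n : ℝ) ^ 2) := by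
          rw [hn', one_mul, one_div, ← Real.exp_nat_mul, ← Real.exp_neg, ← Real.exp_add, ← Real.exp_add]
          congr 1; push_cast; ring
      _ ≤ _ := by gcongr
  have hsum : Summable fun n : ℕ ↦ D / 2 * (1 / (n : ℝ) ^ 2) :=
    (Real.summable_one_div_nat_pow.2 one_lt_two).mul_left _
  refine ((summable_prime_bump hμ0 hD β).tsum_le_tsum hterm hsum).trans ?_
  rw [tsum_mul_left, hasSum_zeta_two.tsum_eq]
  have hpi : π ^ 2 / 6 ≤ 2 := by nlinarith [Real.pi_lt_d2, Real.pi_pos]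
  nlinarith

end PrimeTail

section FarArch

open Set Topology

variable {μ D : ℝ}

lemma log_pi_add_gamma_bounds : 3 / 2 ≤ Real.log π + Real.eulerMascheroniConstant ∧
    Real.log π + Real.eulerMascheroniConstant ≤ 3 := by
  have h1 := Real.one_half_lt_eulerMascheroniConstant
  have h2 := Real.eulerMascheroniConstant_lt_two_thirds
  have h3 : (1 : ℝ) ≤ Real.log π := by
    rw [Real.le_log_iff_exp_le Real.pi_pos]
    linarith [Real.exp_one_lt_d9, Real.pi_gt_three]
  have h4 : Real.log π ≤ 2 := by
    rw [Real.log_le_iff_le_exp Real.pi_pos]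
    have := Real.add_one_le_exp (2 : ℝ)
    have h5 := Real.exp_one_gt_d9
    have h6 : Real.exp 2 = Real.exp 1 ^ 2 := by rw [← Real.exp_nat_mul]; norm_num
    rw [h6]
    nlinarith [Real.pi_lt_four]
  constructor <;> linarith

lemma neg_log_one_sub_le_two_mul {x : ℝ} (h0 : 0 ≤ x) (h1 : x ≤ 1 / 2) :
    -Real.log (1 - x) ≤ 2 * x := by
  have h := Real.one_sub_inv_le_log_of_pos (x := 1 - x) (by linarith)
  have h2 : (1 - x)⁻¹ ≤ 1 + 2 * x := by
    rw [inv_le_iff_one_le_mul₀ (by linarith)]; nlinarith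
  linarith

/-- Away from the origin the archimedean part of a Gaussian is not very negative. -/
lemma le_archPart_far (hμ : 4 ≤ μ) (hD : 0 < D) (hD' : D ≤ 1 / 100) {β : ℝ} (hβ : 10 ≤ |β|) :
    -(1 / 200) ≤ archPart (bump μ D β) := by
  have hμ0 : 0 < μ := by linarith
  set B := |β| with hB
  have hB0 : 0 < B := by linarith
  set m := μ * (B / 2 / D) ^ 2 with hm
  have hm4 : 10000 ≤ m := by
    have h1 : 500 ≤ B / 2 / D := by rw [le_div_iff₀ hD]; linarith
    rw [hm]; nlinarith
  have hexpm : Real.exp (-m) * m ^ 2 ≤ 2 := by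
    have := Real.quadratic_le_exp_of_nonneg (x := m) (by linarith)
    rw [Real.exp_neg, inv_mul_le_iff₀ (Real.exp_pos _)]
    nlinarith
  have hexpm' : Real.exp (-m) * m ≤ 1 / 5000 := by
    nlinarith [mul_pos (Real.exp_pos (-m)) (show 0 < m by linarith)]
  have hInt := integrableOn_arch_bump hμ0 hD β
  have hsq : (β / D) ^ 2 = (B / D) ^ 2 := by rw [div_pow, div_pow, hB, sq_abs]
  have h0 : bump μ D β 0 ≤ 1 / 5000 := by
    have h1 : bump μ D β 0 ≤ Real.exp (-m) := by
      rw [bump_zero, hsq, Real.exp_le_exp, hm, neg_mul, neg_le_neg_iff]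
      gcongr
      linarith
    nlinarith [Real.exp_pos (-m)]
  have hnear : -(5 * (Real.exp (-m) * m)) ≤ ∫ w in Ioc 0 B,
      (bump μ D β 0 - Real.exp (-(1 / 2) * (w / 2)) * bump μ D β (w / 2)) / (Real.exp w - 1) := by
    calc -(5 * (Real.exp (-m) * m)) = ∫ w in Ioc 0 B, -(5 * (Real.exp (-m) * m) / B) := by
          rw [setIntegral_const]
          simp [hB0.le]
          field_simp
      _ ≤ _ := by
          refine setIntegral_mono_on (by simp) (hInt.mono_set Ioc_subset_Ioi_self)
            measurableSet_Ioc fun w hw ↦ ?_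
          have hw0 : 0 < w := hw.1
          have hwB : w ≤ B := hw.2
          have hw1 : w ≤ Real.exp w - 1 := by linarith [Real.add_one_le_exp w]
          set X := μ * ((w / 2 - β) / D) ^ 2 - m with hX
          set Y := μ * ((0 - β) / D) ^ 2 - m with hY
          have hX0 : 0 ≤ X := by
            rw [hX, hm, sub_nonneg]
            gcongr μ * ?_
            rw [div_pow _ D, div_pow _ D]
            gcongr ?_ / _
            rw [← sq_abs (w / 2 - β)]
            refine pow_le_pow_left₀ (by linarith) ?_ 2
            have := abs_sub_abs_le_abs_sub β (w / 2)
            rw [abs_sub_comm, abs_of_pos (show 0 < w / 2 by linarith)] at this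
            linarith
          have hY0 : 0 ≤ Y := by
            rw [hY, hm, sub_nonneg, zero_sub, neg_div, neg_sq, hsq]
            gcongr
            linarith
          have hXY : |X - Y| ≤ 5 * m * w / B := by
            have h1 : X - Y = μ / D ^ 2 * (w / 2 * (w / 2 - 2 * β)) := by
              rw [hX, hY]; ring
            have h2 : |w / 2 - 2 * β| ≤ 5 / 2 * B := by
              refine (abs_sub _ _).trans ?_
              rw [abs_of_pos (show 0 < w / 2 by linarith), abs_mul, abs_two]
              linarith
            rw [h1, abs_mul, abs_mul, abs_of_pos (show 0 < w / 2 by linarith),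
              abs_of_pos (show 0 < μ / D ^ 2 by positivity)]
            calc μ / D ^ 2 * (w / 2 * |w / 2 - 2 * β|) ≤ μ / D ^ 2 * (w / 2 * (5 / 2 * B)) := by gcongr
              _ = 5 * m * w / B := by rw [hm]; field_simp
          have h1 : bump μ D β (w / 2) - bump μ D β 0 ≤ Real.exp (-m) * (5 * m * w / B) := by
            have e1 : bump μ D β (w / 2) = Real.exp (-m) * Real.exp (-X) := by
              rw [bump, ← Real.exp_add]; congr 1; rw [hX]; ring
            have e2 : bump μ D β 0 = Real.exp (-m) * Real.exp (-Y) := by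
              rw [bump, ← Real.exp_add]; congr 1; rw [hY]; ring
            rw [e1, e2, ← mul_sub]
            gcongr
            exact (le_abs_self _).trans ((abs_exp_neg_sub_exp_neg_le hX0 hY0).trans hXY)
          have h6 : Real.exp (-(1 / 2) * (w / 2)) ≤ 1 := Real.exp_le_one_iff.2 (by linarith)
          have h10 := mul_le_of_le_one_left (bump_pos (μ := μ) (D := D) β (w / 2)).le h6
          rw [le_div_iff₀ (by linarith)]
          have h11 : 5 * (Real.exp (-m) * m) / B * w ≤ 5 * (Real.exp (-m) * m) / B * (Real.exp w - 1) := by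
            gcongr
          have h12 : Real.exp (-m) * (5 * m * w / B) = 5 * (Real.exp (-m) * m) / B * w := by ring
          linarith
  have hfar : Real.log (1 - Real.exp (-B)) ≤ ∫ w in Ioi B,
      (bump μ D β 0 - Real.exp (-(1 / 2) * (w / 2)) * bump μ D β (w / 2)) / (Real.exp w - 1) := by
    rw [← neg_neg (Real.log _), ← integral_inv_exp_sub_one hB0, ← integral_neg]
    refine setIntegral_mono_on (integrableOn_inv_exp_sub_one hB0).neg
      (hInt.mono_set (Ioi_subset_Ioi hB0.le)) measurableSet_Ioi fun w hw ↦ ?_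
    have hw' : B < w := hw
    have h2 : (1 : ℝ) < Real.exp w := Real.one_lt_exp_iff.2 (hB0.trans hw)
    rw [← neg_div]
    refine div_le_div_of_nonneg_right ?_ (by linarith)
    have h6 : Real.exp (-(1 / 2) * (w / 2)) ≤ 1 := Real.exp_le_one_iff.2 (by linarith)
    have h7 := mul_le_one₀ h6 (bump_pos (μ := μ) (D := D) β (w / 2)).le (bump_le_one hμ0.le β (w / 2))
    linarith [bump_pos (μ := μ) (D := D) β 0]
  have hB' : Real.exp (-B) ≤ 1 / 1024 := by
    have h1 : Real.exp (-B) ≤ Real.exp (-10) := Real.exp_le_exp.2 (by linarith)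
    have h2 : Real.exp (-10) ≤ 1 / 1024 := by
      have h3 : (2 : ℝ) ≤ Real.exp 1 := by linarith [Real.add_one_le_exp (1 : ℝ)]
      have h4 : Real.exp 10 = Real.exp 1 ^ 10 := by rw [← Real.exp_nat_mul]; norm_num
      rw [Real.exp_neg, one_div, h4]
      gcongr
      calc (1024 : ℝ) = 2 ^ 10 := by norm_num
        _ ≤ _ := by gcongr
    exact h1.trans h2
  have hlog := neg_log_one_sub_le_two_mul (Real.exp_pos (-B)).le (by linarith)
  rw [archPart, setIntegral_Ioi_eq_add hB0.le hInt]
  have hc := log_pi_add_gamma_bounds.2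
  nlinarith [bump_pos (μ := μ) (D := D) β 0]

/-- Away from the origin the archimedean part of a pair of Gaussians is small. -/
lemma archPart_pair_far (hμ : 4 ≤ μ) (hμ' : μ ≤ 5) (hD : 0 < D) (hD' : D ≤ 1 / 100) {β : ℝ}
    (hβ : 10 ≤ |β|) : |archPart (bump μ D β) + archPart (bump μ D (-β))| ≤ 1 / 100 := by
  rw [abs_le]
  constructor
  · linarith [le_archPart_far hμ hD hD' hβ, le_archPart_far hμ hD hD' (β := -β) (by rwa [abs_neg])]
  · refine (archPart_pair_le (by linarith) hD β).trans ?_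
    have h1 : Real.exp (-μ * (β / D) ^ 2) ≤ D ^ 2 := by
      have h2 : 1 / D ^ 2 ≤ Real.exp (μ * (β / D) ^ 2) := by
        refine le_trans ?_ (Real.add_one_le_exp _)
        have h3 : 1 ≤ μ * β ^ 2 := by
          have : 10 ^ 2 ≤ |β| ^ 2 := pow_le_pow_left₀ (by norm_num) hβ 2
          rw [sq_abs] at this
          nlinarith
        have h4 : 1 / D ^ 2 ≤ μ * β ^ 2 / D ^ 2 := by gcongr
        rw [div_pow, ← mul_div_assoc]
        linarith
      rw [neg_mul, Real.exp_neg, inv_le_comm₀ (Real.exp_pos _) (by positivity), inv_eq_one_div]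
      exact h2
    have h2 : Real.log (1 / D) ≤ 1 / D := (Real.log_le_sub_one_of_pos (by positivity)).trans (by linarith)
    have h3 := log_pi_add_gamma_bounds.1
    have h4 : Real.log (1 / D) - (Real.log π + Real.eulerMascheroniConstant) + μ / 8 + 2 * D ≤ 1 / D := by
      linarith
    calc _ ≤ Real.exp (-μ * (β / D) ^ 2) * (1 / D) := by gcongr
      _ ≤ D ^ 2 * (1 / D) := by gcongr
      _ = D := by field_simp
      _ ≤ _ := hD'

end FarArch

section TrigonometricMajorant

/-- Cosine coefficients of the trigonometric polynomial localising near `l`. -/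
noncomputable def coeffP : ℕ → ℝ
  | 0 => 0.46060
  | 1 => 0.60628
  | 2 => -0.06688
  | _ => 0

/-- Cosine coefficients of a trigonometric majorant of the polynomial with coefficients
`coeffP` in absolute value. -/
noncomputable def coeffT : ℕ → ℝ
  | 0 => 0.53420
  | 1 => 0.47048
  | 2 => 0.04140
  | 3 => -0.07391
  | 4 => 0.04166
  | 5 => -0.01777
  | 6 => 0.00446
  | _ => 0

lemma cos_five_mul (θ : ℝ) :
    Real.cos (5 * θ) = 16 * Real.cos θ ^ 5 - 20 * Real.cos θ ^ 3 + 5 * Real.cos θ := by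
  rw [show 5 * θ = 2 * θ + 3 * θ by ring, Real.cos_add, Real.cos_two_mul, Real.cos_three_mul,
    Real.sin_two_mul, Real.sin_three_mul]
  linear_combination (6 * Real.cos θ - 8 * Real.cos θ * (Real.sin θ ^ 2 + 1 - Real.cos θ ^ 2)) *
    (-1 : ℝ) * Real.sin_sq_add_cos_sq θ

lemma abs_sum_coeffP_le (θ : ℝ) :
    |∑ j ∈ Finset.range 7, coeffP j * Real.cos (j * θ)| ≤
      ∑ j ∈ Finset.range 7, coeffT j * Real.cos (j * θ) := by
  have c2 : Real.cos (2 * θ) = 2 * Real.cos θ ^ 2 - 1 := Real.cos_two_mul θ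
  have c3 : Real.cos (3 * θ) = 4 * Real.cos θ ^ 3 - 3 * Real.cos θ := Real.cos_three_mul θ
  have c4 : Real.cos (4 * θ) = 8 * Real.cos θ ^ 4 - 8 * Real.cos θ ^ 2 + 1 := by
    rw [show 4 * θ = 2 * (2 * θ) by ring, Real.cos_two_mul, c2]; ring
  have c5 := cos_five_mul θ
  have c6 : Real.cos (6 * θ) =
      32 * Real.cos θ ^ 6 - 48 * Real.cos θ ^ 4 + 18 * Real.cos θ ^ 2 - 1 := by
    rw [show 6 * θ = 2 * (3 * θ) by ring, Real.cos_two_mul, c3]; ring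
  have b1 := abs_le.1 (Real.abs_cos_le_one θ)
  have b2 := abs_le.1 (Real.abs_cos_le_one (2 * θ))
  have b3 := abs_le.1 (Real.abs_cos_le_one (3 * θ))
  have b4 := abs_le.1 (Real.abs_cos_le_one (4 * θ))
  have b5 := abs_le.1 (Real.abs_cos_le_one (5 * θ))
  have b6 := abs_le.1 (Real.abs_cos_le_one (6 * θ))
  have hc : 0 ≤ 1 - Real.cos θ ^ 2 := by
    have := Real.sin_sq_add_cos_sq θ
    nlinarith [sq_nonneg (Real.sin θ)]
  simp only [Finset.sum_range_succ, Finset.sum_range_zero, coeffP, coeffT, Nat.cast_zero,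
    Nat.cast_one, Nat.cast_ofNat, zero_mul, one_mul, Real.cos_zero, mul_one, zero_add]
  rw [c2] at b2 ⊢
  rw [c3] at b3 ⊢
  rw [c4] at b4 ⊢
  rw [c5] at b5 ⊢
  rw [c6] at b6 ⊢
  generalize Real.cos θ = c at *
  obtain ⟨b1, b1'⟩ := b1
  obtain ⟨b2, b2'⟩ := b2
  obtain ⟨b3, b3'⟩ := b3
  obtain ⟨b4, b4'⟩ := b4
  obtain ⟨b5, b5'⟩ := b5
  obtain ⟨b6, b6'⟩ := b6
  rw [abs_le]
  constructor
  · have h1 := sq_nonneg ((-0.134761) + 0.195443 * c + 0.754865 * (2 * c ^ 2 - 1) + 0.598844 * (4 * c ^ 3 - 3 * c))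
    have h2 := mul_nonneg hc (sq_nonneg ((-0.075573) + (-0.794481) * (2 * c) + (-0.591350) * (4 * c ^ 2 - 1)))
    linarith
  · have h1 := sq_nonneg ((-0.138411) + 0.253256 * c + (-0.187847) * (2 * c ^ 2 - 1) + 0.095363 * (4 * c ^ 3 - 3 * c))
    have h2 := mul_nonneg hc (sq_nonneg ((-0.005704) + 0.010889 * (2 * c) + (-0.013195) * (4 * c ^ 2 - 1)))
    linarith

end TrigonometricMajorant

section Kernel

open Set

/-- The Gaussian `exp (-9 x² / 2)`. -/
noncomputable def gs (x : ℝ) : ℝ := Real.exp (-(9 / 2) * x ^ 2)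

/-- The combination of Gaussians weighting the primes near `exp l`. -/
noncomputable def kern (t : ℝ) : ℝ :=
  ∑ j ∈ Finset.range 7, coeffP j / 2 * (gs (t - j * (11 / 20)) + gs (t + j * (11 / 20)))

/-- The part of `kern` that matters to the right of the origin. -/
noncomputable def kernRight (t : ℝ) : ℝ :=
  0.46060 * gs t + 0.30314 * gs (t - 11 / 20) + 0.30314 * gs (t + 11 / 20)
    - 0.03344 * gs (t - 11 / 10)

/-- A convex piecewise linear majorant of `kern` on `[1, ∞)`. -/
noncomputable def hinge (t : ℝ) : ℝ :=
  0.149 * max (1.09 - t) 0 + 0.1445 * max (1.18 - t) 0 + 0.203 * max (1.275 - t) 0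

lemma gs_pos (x : ℝ) : 0 < gs x := Real.exp_pos _

lemma gs_le_one (x : ℝ) : gs x ≤ 1 := Real.exp_le_one_iff.2 (by nlinarith [sq_nonneg x])

lemma gs_neg (x : ℝ) : gs (-x) = gs x := by rw [gs, gs, neg_sq]

lemma kern_eq (t : ℝ) : kern t = kernRight t - 0.03344 * gs (t + 11 / 10) := by
  simp only [kern, kernRight, Finset.sum_range_succ, Finset.sum_range_zero, coeffP, Nat.cast_zero,
    Nat.cast_one, Nat.cast_ofNat]
  rw [show t - 0 * (11 / 20) = t by ring, show t + 0 * (11 / 20) = t by ring,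
    show t - 1 * (11 / 20) = t - 11 / 20 by ring, show t + 1 * (11 / 20) = t + 11 / 20 by ring,
    show t - 2 * (11 / 20) = t - 11 / 10 by ring, show t + 2 * (11 / 20) = t + 11 / 10 by ring]
  ring

lemma kern_le_kernRight (t : ℝ) : kern t ≤ kernRight t := by
  rw [kern_eq]; linarith [gs_pos (t + 11 / 10)]

lemma kern_neg (t : ℝ) : kern (-t) = kern t := by
  rw [kern_eq, kern_eq, kernRight, kernRight, gs_neg, show -t - 11 / 20 = -(t + 11 / 20) by ring,
    show -t + 11 / 20 = -(t - 11 / 20) by ring, show -t - 11 / 10 = -(t + 11 / 10) by ring,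
    show -t + 11 / 10 = -(t - 11 / 10) by ring]
  simp only [gs_neg]
  ring

lemma kern_abs (t : ℝ) : kern |t| = kern t := by
  rcases abs_choice t with h | h <;> rw [h]
  exact kern_neg t

lemma kern_le (t : ℝ) : kern t ≤ 1.1 := by
  refine (kern_le_kernRight t).trans ?_
  rw [kernRight]
  linarith [gs_le_one t, gs_le_one (t - 11 / 20), gs_le_one (t + 11 / 20), gs_pos (t - 11 / 10)]

lemma hinge_nonneg (t : ℝ) : 0 ≤ hinge t := by rw [hinge]; positivity

lemma gs_mul_gs_le {c d s t : ℝ} (hcd : c ≤ d) (hst : s ≤ t) :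
    gs (t - c) * gs (s - d) ≤ gs (s - c) * gs (t - d) := by
  simp only [gs]
  rw [← Real.exp_add, ← Real.exp_add, Real.exp_le_exp]
  nlinarith [mul_nonneg (sub_nonneg.2 hcd) (sub_nonneg.2 hst)]

lemma gs_le_of_sum {x y b : ℝ} (n : ℕ) (hx : (9 / 2) * x ^ 2 = y) (hb : 0 < b)
    (h : 1 / b ≤ ∑ i ∈ Finset.range n, y ^ i / i.factorial) : gs x ≤ b := by
  have hy : 0 ≤ y := by rw [← hx]; positivity
  have h1 := h.trans (Real.sum_le_exp_of_nonneg hy n)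
  rw [gs, neg_mul, hx, Real.exp_neg, inv_le_comm₀ (Real.exp_pos _) hb, inv_eq_one_div]
  exact h1

lemma le_gs (x : ℝ) : 1 - (9 / 2) * x ^ 2 ≤ gs x := by
  rw [gs]; linarith [Real.add_one_le_exp (-(9 / 2) * x ^ 2)]

lemma kernRight_one : kernRight 1 ≤ 0.095245 := by
  have h1 : gs 1 ≤ 0.01112 := gs_le_of_sum 18 (y := 4.5) (by norm_num) (by norm_num)
    (by norm_num [Finset.sum_range_succ, Nat.factorial])
  have h2 : gs (1 - 11 / 20) ≤ 0.4021 := gs_le_of_sum 8 (y := 0.91125) (by norm_num) (by norm_num)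
    (by norm_num [Finset.sum_range_succ, Nat.factorial])
  have h3 : gs (1 + 11 / 20) ≤ 0.0001 := gs_le_of_sum 13 (y := 10.81125) (by norm_num) (by norm_num)
    (by norm_num [Finset.sum_range_succ, Nat.factorial])
  have h4 := le_gs (1 - 11 / 10)
  rw [kernRight]
  linarith

lemma kernRight_second : kernRight 1.09 ≤ 0.05056 := by
  have h1 : gs 1.09 ≤ 0.00478 := gs_le_of_sum 18 (y := 5.34645) (by norm_num) (by norm_num)
    (by norm_num [Finset.sum_range_succ, Nat.factorial])
  have h2 : gs (1.09 - 11 / 20) ≤ 0.2693 := gs_le_of_sum 9 (y := 1.3122) (by norm_num) (by norm_num)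
    (by norm_num [Finset.sum_range_succ, Nat.factorial])
  have h3 : gs (1.09 + 11 / 20) ≤ 0.0001 := gs_le_of_sum 12 (y := 12.1032) (by norm_num)
    (by norm_num) (by norm_num [Finset.sum_range_succ, Nat.factorial])
  have h4 := le_gs (1.09 - 11 / 10)
  rw [kernRight]
  linarith

lemma kernRight_third : kernRight 1.18 ≤ 0.019285 := by
  have h1 : gs 1.18 ≤ 0.00191 := gs_le_of_sum 18 (y := 6.2658) (by norm_num) (by norm_num)
    (by norm_num [Finset.sum_range_succ, Nat.factorial])
  have h2 : gs (1.18 - 11 / 20) ≤ 0.16765 := gs_le_of_sum 11 (y := 1.78605) (by norm_num)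
    (by norm_num) (by norm_num [Finset.sum_range_succ, Nat.factorial])
  have h3 : gs (1.18 + 11 / 20) ≤ 0.00001 := gs_le_of_sum 15 (y := 13.46805) (by norm_num)
    (by norm_num) (by norm_num [Finset.sum_range_succ, Nat.factorial])
  have h4 := le_gs (1.18 - 11 / 10)
  rw [kernRight]
  linarith

lemma kernRight_last : kernRight 1.275 ≤ 0 := by
  have h1 : gs 1.275 ≤ 0.0007 := gs_le_of_sum 18 (y := 7.3153125) (by norm_num) (by norm_num)
    (by norm_num [Finset.sum_range_succ, Nat.factorial])
  have h2 : gs (1.275 - 11 / 20) ≤ 0.094 := gs_le_of_sum 11 (y := 2.3653125) (by norm_num)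
    (by norm_num) (by norm_num [Finset.sum_range_succ, Nat.factorial])
  have h3 : gs (1.275 + 11 / 20) ≤ 0.00001 := gs_le_of_sum 17 (y := 14.9878125) (by norm_num)
    (by norm_num) (by norm_num [Finset.sum_range_succ, Nat.factorial])
  have h4 := le_gs (1.275 - 11 / 10)
  rw [kernRight]
  linarith

lemma kernRight_nonpos {t : ℝ} (ht : 1.275 ≤ t) : kernRight t ≤ 0 := by
  have h0 := gs_mul_gs_le (c := 0) (d := 11 / 10) (by norm_num) ht
  have h1 := gs_mul_gs_le (c := 11 / 20) (d := 11 / 10) (by norm_num) ht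
  have h2 := gs_mul_gs_le (c := -(11 / 20)) (d := 11 / 10) (by norm_num) ht
  rw [sub_zero, sub_zero] at h0
  rw [sub_neg_eq_add, sub_neg_eq_add] at h2
  have h3 : kernRight t * gs (1.275 - 11 / 10) ≤ kernRight 1.275 * gs (t - 11 / 10) := by
    rw [kernRight, kernRight]; linarith
  have h4 : kernRight 1.275 * gs (t - 11 / 10) ≤ 0 :=
    mul_nonpos_of_nonpos_of_nonneg kernRight_last (gs_pos _).le
  exact nonpos_of_mul_nonpos_left (h3.trans h4) (gs_pos _)

lemma kern_nonpos {t : ℝ} (ht : 1.275 ≤ |t|) : kern t ≤ 0 := by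
  rw [← kern_abs]
  exact (kern_le_kernRight _).trans (kernRight_nonpos ht)

lemma hasDerivAt_gs_sub (c t : ℝ) :
    HasDerivAt (fun t ↦ gs (t - c)) (-9 * (t - c) * gs (t - c)) t := by
  have h := ((((hasDerivAt_id t).sub_const c).pow 2).const_mul (-(9 / 2))).exp
  convert! h using 1
  simp [gs]
  ring

lemma hasDerivAt_deriv_gs_sub (c t : ℝ) :
    HasDerivAt (fun t ↦ -9 * (t - c) * gs (t - c)) ((81 * (t - c) ^ 2 - 9) * gs (t - c)) t := by
  have h := (((hasDerivAt_id t).sub_const c).const_mul (-9)).mul (hasDerivAt_gs_sub c t)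
  convert! h using 1
  simp
  ring

lemma convexOn_kernRight : ConvexOn ℝ (Icc 1 1.275) kernRight := by
  have e : kernRight = fun t ↦ 0.46060 * gs (t - 0) + 0.30314 * gs (t - 11 / 20)
      + 0.30314 * gs (t - -(11 / 20)) - 0.03344 * gs (t - 11 / 10) := by
    ext t; rw [kernRight, sub_zero, sub_neg_eq_add]
  rw [e]
  have hd := fun t ↦ ((((hasDerivAt_gs_sub 0 t).const_mul 0.46060).add
    ((hasDerivAt_gs_sub (11 / 20) t).const_mul 0.30314)).add
    ((hasDerivAt_gs_sub (-(11 / 20)) t).const_mul 0.30314)).sub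
    ((hasDerivAt_gs_sub (11 / 10) t).const_mul 0.03344)
  have hd' := fun t ↦ ((((hasDerivAt_deriv_gs_sub 0 t).const_mul 0.46060).add
    ((hasDerivAt_deriv_gs_sub (11 / 20) t).const_mul 0.30314)).add
    ((hasDerivAt_deriv_gs_sub (-(11 / 20)) t).const_mul 0.30314)).sub
    ((hasDerivAt_deriv_gs_sub (11 / 10) t).const_mul 0.03344)
  refine convexOn_of_hasDerivWithinAt2_nonneg (convex_Icc _ _)
    (fun t _ ↦ (hd t).continuousAt.continuousWithinAt) (fun t _ ↦ (hd t).hasDerivWithinAt)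
    (fun t _ ↦ (hd' t).hasDerivWithinAt) fun t ht ↦ ?_
  rw [interior_Icc] at ht
  obtain ⟨h1, h2⟩ := ht
  have p1 := mul_nonneg (show 0 ≤ 81 * (t - 0) ^ 2 - 9 by nlinarith) (gs_pos (t - 0)).le
  have p2 := mul_nonneg (show 0 ≤ 81 * (t - 11 / 20) ^ 2 - 9 by nlinarith) (gs_pos (t - 11 / 20)).le
  have p3 := mul_nonneg (show 0 ≤ 81 * (t - -(11 / 20)) ^ 2 - 9 by nlinarith)
    (gs_pos (t - -(11 / 20))).le
  have p4 := mul_nonneg (show 0 ≤ 9 - 81 * (t - 11 / 10) ^ 2 by nlinarith)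
    (gs_pos (t - 11 / 10)).le
  linarith

lemma le_affine_of_convexOn {s : Set ℝ} {f : ℝ → ℝ} (hf : ConvexOn ℝ s f) {x y m c : ℝ} (hx : x ∈ s)
    (hy : y ∈ s) (hfx : f x ≤ m * x + c) (hfy : f y ≤ m * y + c) {t : ℝ} (ht : t ∈ Icc x y) :
    f t ≤ m * t + c := by
  have h := (hf.add ((LinearMap.mul ℝ ℝ (-m)).convexOn hf.1)).le_max_of_mem_Icc hx hy ht
  simp only [Pi.add_apply, LinearMap.mul_apply'] at h
  have h2 : max (f x + -m * x) (f y + -m * y) ≤ c := max_le (by linarith) (by linarith)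
  linarith

lemma kern_le_hinge {t : ℝ} (ht : 1 ≤ |t|) : kern t ≤ hinge |t| := by
  rw [← kern_abs]
  generalize |t| = t at *
  refine (kern_le_kernRight t).trans ?_
  rcases le_total 1.275 t with h | h
  · exact (kernRight_nonpos h).trans (hinge_nonneg t)
  have hc := convexOn_kernRight
  have m1 := le_max_left (1.09 - t) 0
  have m1' := le_max_right (1.09 - t) 0
  have m2 := le_max_left (1.18 - t) 0
  have m2' := le_max_right (1.18 - t) 0
  have m3 := le_max_left (1.275 - t) 0
  rw [hinge]
  rcases le_total t 1.09 with h1 | h1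
  · have := le_affine_of_convexOn hc (x := 1) (y := 1.09) (m := -0.4965) (c := 0.591745)
      (by norm_num) (by norm_num) (by linarith [kernRight_one]) (by linarith [kernRight_second])
      ⟨ht, h1⟩
    linarith
  rcases le_total t 1.18 with h2 | h2
  · have := le_affine_of_convexOn hc (x := 1.09) (y := 1.18) (m := -0.3475) (c := 0.429335)
      (by norm_num) (by norm_num) (by linarith [kernRight_second]) (by linarith [kernRight_third])
      ⟨h1, h2⟩
    linarith
  · have := le_affine_of_convexOn hc (x := 1.18) (y := 1.275) (m := -0.203) (c := 0.258825)
      (by norm_num) (by norm_num) (by linarith [kernRight_third]) (by linarith [kernRight_last])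
      ⟨h2, h⟩
    linarith

end Kernel

section HingeSum

open Set

lemma integral_indicator_Ioi {τ u : ℝ} (hτ : 1 ≤ τ) :
    ∫ s in Ioc 1 u, (Ioi τ).indicator (fun _ ↦ (1 : ℝ)) s = max (u - τ) 0 := by
  rw [setIntegral_indicator measurableSet_Ioi, Ioc_inter_Ioi, max_eq_right hτ, setIntegral_const]
  simp

/-- A linear bound for a counting function controls the sum of a hinge function. -/
lemma sum_max_sub_le {ι : Type*} (S : Finset ι) (τ : ι → ℝ) (hτ : ∀ i ∈ S, 1 ≤ τ i) {u α β : ℝ}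
    (hu : 1 ≤ u) (hN : ∀ s ∈ Ioc 1 u, ((S.filter fun i ↦ τ i < s).card : ℝ) ≤ α * (s - 1) + β) :
    ∑ i ∈ S, max (u - τ i) 0 ≤ α * (u - 1) ^ 2 / 2 + β * (u - 1) := by
  have hi : ∀ i ∈ S, IntegrableOn ((Ioi (τ i)).indicator (fun _ ↦ (1 : ℝ))) (Ioc 1 u) := fun i _ ↦
    (integrableOn_const (by simp)).indicator measurableSet_Ioi
  calc ∑ i ∈ S, max (u - τ i) 0
      = ∫ s in Ioc 1 u, ∑ i ∈ S, (Ioi (τ i)).indicator (fun _ ↦ (1 : ℝ)) s := by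
        rw [integral_finsetSum _ hi]
        exact Finset.sum_congr rfl fun i h ↦ (integral_indicator_Ioi (hτ i h)).symm
    _ ≤ ∫ s in Ioc 1 u, (α * (s - 1) + β) := by
        refine setIntegral_mono_on (integrable_finsetSum _ hi)
          (Continuous.integrableOn_Ioc (by fun_prop)) measurableSet_Ioc fun s hs ↦ ?_
        refine le_trans (le_of_eq ?_) (hN s hs)
        simp [indicator_apply]
    _ = α * (u - 1) ^ 2 / 2 + β * (u - 1) := by
        rw [← intervalIntegral.integral_of_le hu]
        have hd : ∀ s ∈ uIcc 1 u, HasDerivAt (fun s ↦ α * (s - 1) ^ 2 / 2 + β * (s - 1))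
            (α * (s - 1) + β) s := by
          intro s _
          have h := ((((hasDerivAt_id s).sub_const 1).pow 2).const_mul α).div_const 2 |>.add
            (((hasDerivAt_id s).sub_const 1).const_mul β)
          convert! h using 1
          simp
          ring
        rw [intervalIntegral.integral_eq_sub_of_hasDerivAt hd
          (Continuous.intervalIntegrable (by fun_prop) _ _)]
        ring

end HingeSum

section NearbyPrimes

open Finset

/-- The integers `n` with `|log n - l| ≤ 1.275 D`, up to the left endpoint. -/
noncomputable def window (l D : ℝ) : Finset ℕ :=
  Ioc ⌊Real.exp (l - 1.275 * D)⌋₊ ⌊Real.exp (l + 1.275 * D)⌋₊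

variable {l D : ℝ}

lemma mem_Ioc_floor_exp {x y : ℝ} {n : ℕ} :
    n ∈ Ioc ⌊Real.exp x⌋₊ ⌊Real.exp y⌋₊ ↔ n ≠ 0 ∧ x < Real.log n ∧ Real.log n ≤ y := by
  rw [mem_Ioc, Nat.floor_lt (Real.exp_pos _).le, Nat.le_floor_iff (Real.exp_pos _).le]
  rcases Nat.eq_zero_or_pos n with rfl | hn
  · simp [(Real.exp_pos x).le]
  · have hn' : (0 : ℝ) < n := by exact_mod_cast hn
    rw [Real.lt_log_iff_exp_lt hn', Real.log_le_iff_le_exp hn']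
    simp [hn.ne']

lemma sieve_level (hl : 20 ≤ l) : ∃ z : ℕ, 1 ≤ z ∧ (z : ℝ) ≤ Real.exp (l / 4) ∧
    (z : ℝ) ^ 2 ≤ Real.exp (l / 2) / 256 ∧ l / 4 - 2.7726 ≤ Real.log (z + 1) := by
  have h16 : (16 : ℝ) ≤ Real.exp (l / 4) := by
    have h1 : Real.exp (l / 4) ≥ Real.exp 5 := Real.exp_le_exp.2 (by linarith)
    have h2 : Real.exp 5 = Real.exp 1 ^ 5 := by rw [← Real.exp_nat_mul]; norm_num
    have h3 : (2 : ℝ) ≤ Real.exp 1 := by linarith [Real.add_one_le_exp (1 : ℝ)]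
    have h4 : (2 : ℝ) ^ 5 ≤ Real.exp 1 ^ 5 := by gcongr
    linarith
  have h0 : 0 ≤ Real.exp (l / 4) / 16 := by positivity
  have hz := Nat.floor_le h0
  refine ⟨⌊Real.exp (l / 4) / 16⌋₊, ?_, ?_, ?_, ?_⟩
  · rw [Nat.one_le_floor_iff]; linarith
  · linarith
  · have h1 : Real.exp (l / 2) = Real.exp (l / 4) ^ 2 := by
      rw [← Real.exp_nat_mul]; congr 1; push_cast; ring
    rw [h1]
    calc _ ≤ (Real.exp (l / 4) / 16) ^ 2 := by gcongr
      _ = _ := by ring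
  · rw [Real.le_log_iff_exp_le (by positivity)]
    refine le_trans ?_ (Nat.lt_floor_add_one (Real.exp (l / 4) / 16)).le
    rw [Real.exp_sub]
    gcongr
    rw [← Real.log_le_iff_le_exp (by norm_num), show (16 : ℝ) = 2 ^ 4 by norm_num, Real.log_pow]
    have := Real.log_two_lt_d9
    norm_num
    linarith

lemma exp_sub_exp_le (x y : ℝ) : Real.exp y - Real.exp x ≤ (y - x) * Real.exp y := by
  have h := Real.add_one_le_exp (x - y)
  have h2 : Real.exp x = Real.exp (x - y) * Real.exp y := by rw [← Real.exp_add]; congr 1; ring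
  rw [h2]
  nlinarith [Real.exp_pos y]

lemma card_primes_window_le (hl : 20 ≤ l) (hD : 0 < D) (hD' : D ≤ 1 / 2000)
    (hno : ∀ p : ℕ, p.Prime → D < |Real.log p - l|) {s : ℝ} (hs : 1 ≤ s) (hs' : s ≤ 1.275) :
    (#{p ∈ window l D | Nat.Prime p ∧ |(Real.log p - l) / D| < s} : ℝ) ≤
      2 * (Real.exp l * D * 1.001 / (l / 4 - 2.7726)) * (s - 1) + 2 * (Real.exp (l / 2) / 256) := by
  obtain ⟨z, hz1, hz2, hz3, hz4⟩ := sieve_level hl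
  have hw : 0 < l / 4 - 2.7726 := by linarith
  have key : ∀ x y, l / 4 ≤ x → x ≤ y → y ≤ l + 1.275 * D → y - x = (s - 1) * D →
      (#{p ∈ Ioc ⌊Real.exp x⌋₊ ⌊Real.exp y⌋₊ | Nat.Prime p} : ℝ) ≤
        Real.exp l * D * 1.001 / (l / 4 - 2.7726) * (s - 1) + Real.exp (l / 2) / 256 := by
    intro x y hx hxy hy hyx
    refine (card_primes_Ioc_le hz1 (hz2.trans (Real.exp_le_exp.2 hx))
      (Real.exp_le_exp.2 hxy)).trans ?_
    have h1 : Real.exp y ≤ Real.exp l * 1.001 := by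
      have h2 : Real.exp y ≤ Real.exp (l + 1.275 * D) := Real.exp_le_exp.2 hy
      rw [Real.exp_add] at h2
      refine h2.trans ?_
      gcongr
      have h3 := Real.add_one_le_exp (-(1.275 * D))
      rw [Real.exp_neg] at h3
      have h4 := Real.exp_pos (1.275 * D)
      have h5 : (1 - 1.275 * D) * Real.exp (1.275 * D) ≤ 1 := by
        calc _ ≤ (Real.exp (1.275 * D))⁻¹ * Real.exp (1.275 * D) := by gcongr; linarith
          _ = 1 := inv_mul_cancel₀ h4.ne'
      nlinarith
    have h2 : Real.exp y - Real.exp x ≤ Real.exp l * D * 1.001 * (s - 1) := by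
      refine (exp_sub_exp_le x y).trans ?_
      rw [hyx]
      have : 0 ≤ (s - 1) * D := mul_nonneg (by linarith) hD.le
      calc _ ≤ (s - 1) * D * (Real.exp l * 1.001) := by gcongr
        _ = _ := by ring
    have h0 : 0 ≤ Real.exp y - Real.exp x := sub_nonneg.2 (Real.exp_le_exp.2 hxy)
    have h3 : (Real.exp y - Real.exp x) / Real.log (z + 1) ≤
        Real.exp l * D * 1.001 * (s - 1) / (l / 4 - 2.7726) :=
      div_le_div₀ (h0.trans h2) h2 hw hz4
    calc _ ≤ _ := add_le_add h3 hz3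
      _ = _ := by ring
  have hsD : s * D ≤ 1.275 * D := by gcongr
  have hDs : D ≤ s * D := by nlinarith
  have hr := key (l + D) (l + s * D) (by linarith) (by linarith) (by linarith) (by ring)
  have hlft := key (l - s * D) (l - D) (by linarith) (by linarith) (by linarith) (by ring)
  have hsub : {p ∈ window l D | Nat.Prime p ∧ |(Real.log p - l) / D| < s} ⊆
      {p ∈ Ioc ⌊Real.exp (l + D)⌋₊ ⌊Real.exp (l + s * D)⌋₊ | Nat.Prime p} ∪
      {p ∈ Ioc ⌊Real.exp (l - s * D)⌋₊ ⌊Real.exp (l - D)⌋₊ | Nat.Prime p} := by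
    intro p hp
    rw [mem_filter] at hp
    obtain ⟨-, hp, hps⟩ := hp
    have h1 := hno p hp
    rw [abs_div, abs_of_pos hD, div_lt_iff₀ hD, abs_lt] at hps
    rw [mem_union, mem_filter, mem_filter, mem_Ioc_floor_exp, mem_Ioc_floor_exp]
    rcases lt_abs.1 h1 with h | h
    · exact Or.inl ⟨⟨hp.ne_zero, by linarith, by linarith⟩, hp⟩
    · exact Or.inr ⟨⟨hp.ne_zero, by linarith, by linarith⟩, hp⟩
  have hcard := (card_le_card hsub).trans (card_union_le _ _)
  have hcard' : (#{p ∈ window l D | Nat.Prime p ∧ |(Real.log p - l) / D| < s} : ℝ) ≤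
      #{p ∈ Ioc ⌊Real.exp (l + D)⌋₊ ⌊Real.exp (l + s * D)⌋₊ | Nat.Prime p} +
      #{p ∈ Ioc ⌊Real.exp (l - s * D)⌋₊ ⌊Real.exp (l - D)⌋₊ | Nat.Prime p} := by exact_mod_cast hcard
  linarith

lemma sum_hinge_primes_le (hl : 20 ≤ l) (hD : 0 < D) (hD' : D ≤ 1 / 2000)
    (hno : ∀ p : ℕ, p.Prime → D < |Real.log p - l|) :
    ∑ p ∈ window l D with p.Prime, hinge |(Real.log p - l) / D| ≤
      2 * (Real.exp l * D * 1.001 / (l / 4 - 2.7726)) * 0.010621 +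
        2 * (Real.exp (l / 2) / 256) * 0.09525 := by
  have hw : 0 < l / 4 - 2.7726 := by linarith
  have hα : 0 ≤ 2 * (Real.exp l * D * 1.001 / (l / 4 - 2.7726)) := by positivity
  have hβ : 0 ≤ 2 * (Real.exp (l / 2) / 256) := by positivity
  have key : ∀ u : ℝ, 1 ≤ u → u ≤ 1.275 → _ := fun u hu hu' ↦
    sum_max_sub_le ({p ∈ window l D | p.Prime}) (fun p ↦ |(Real.log p - l) / D|)
    (α := 2 * (Real.exp l * D * 1.001 / (l / 4 - 2.7726))) (β := 2 * (Real.exp (l / 2) / 256))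
    (fun p hp ↦ by
      have h := hno p (mem_filter.1 hp).2
      rw [abs_div, abs_of_pos hD, le_div_iff₀ hD]
      linarith) hu (fun s hs ↦ by
      rw [filter_filter]
      exact card_primes_window_le hl hD hD' hno hs.1.le (hs.2.trans hu'))
  have h1 := key 1.09 (by norm_num) (by norm_num)
  have h2 := key 1.18 (by norm_num) (by norm_num)
  have h3 := key 1.275 (by norm_num) (by norm_num)
  simp only [hinge, sum_add_distrib, ← mul_sum]
  nlinarith

end NearbyPrimes

section PrimePowers

open Finset ArithmeticFunction

variable {l D : ℝ}

lemma mem_window {n : ℕ} :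
    n ∈ window l D ↔ n ≠ 0 ∧ l - 1.275 * D < Real.log n ∧ Real.log n ≤ l + 1.275 * D :=
  mem_Ioc_floor_exp

lemma sub_le_of_pow_mem {A B : ℝ} {k m m' : ℕ} (hk : 2 ≤ k) (hm0 : m ≠ 0) (hA : 0 < A)
    (hm : A ≤ (m : ℝ) ^ k) (hm' : (m' : ℝ) ^ k ≤ B) (h : m ≤ m') :
    (m' : ℝ) - m ≤ (B - A) / √A := by
  have h1 : (1 : ℝ) ≤ m := by exact_mod_cast Nat.one_le_iff_ne_zero.2 hm0
  have hmm : (m : ℝ) ≤ m' := by exact_mod_cast h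
  obtain ⟨j, rfl⟩ : ∃ j, k = j + 1 := ⟨k - 1, by omega⟩
  have h2 : √A ≤ (m : ℝ) ^ j := by
    rw [Real.sqrt_le_left (by positivity), ← pow_mul]
    exact hm.trans (pow_le_pow_right₀ h1 (by omega))
  rw [le_div_iff₀ (Real.sqrt_pos.2 hA)]
  calc ((m' : ℝ) - m) * √A ≤ (m' - m) * (m : ℝ) ^ j := by
        gcongr
    _ = m' * (m : ℝ) ^ j - (m : ℝ) ^ (j + 1) := by ring
    _ ≤ m' * (m' : ℝ) ^ j - (m : ℝ) ^ (j + 1) := by gcongr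
    _ = (m' : ℝ) ^ (j + 1) - (m : ℝ) ^ (j + 1) := by ring
    _ ≤ B - A := by linarith

lemma card_le_of_forall_sub_le {S : Finset ℕ} {q : ℝ} (hq : 0 ≤ q)
    (h : ∀ m ∈ S, ∀ m' ∈ S, m ≤ m' → (m' : ℝ) - m ≤ q) : (#S : ℝ) ≤ q + 1 := by
  rcases S.eq_empty_or_nonempty with rfl | hS
  · simp; linarith
  have hsub : S ⊆ Icc (S.min' hS) (S.min' hS + ⌊q⌋₊) := by
    intro m hm
    rw [mem_Icc]
    refine ⟨S.min'_le m hm, ?_⟩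
    have h1 := h _ (S.min'_mem hS) m hm (S.min'_le m hm)
    rw [← Nat.cast_sub (S.min'_le m hm)] at h1
    have := Nat.le_floor h1
    omega
  have h2 := card_le_card hsub
  rw [Nat.card_Icc] at h2
  have h3 : (#S : ℝ) ≤ (⌊q⌋₊ : ℝ) + 1 := by
    have : #S ≤ ⌊q⌋₊ + 1 := by omega
    exact_mod_cast this
  linarith [Nat.floor_le hq]

/-- Proper prime powers in the window are rare. -/
lemma card_primePow_window_le (hl : 20 ≤ l) (hD : 0 < D) (hD' : D ≤ 1 / 2000) :
    (#{n ∈ window l D | ¬ Nat.Prime n ∧ IsPrimePow n} : ℝ) ≤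
      3 / 2 * l * (2.56 * (Real.exp (l / 2) * D) + 1) := by
  set A := Real.exp (l - 1.275 * D) with hA
  set B := Real.exp (l + 1.275 * D) with hB
  have hA0 : 0 < A := Real.exp_pos _
  have hAB : A ≤ B := Real.exp_le_exp.2 (by linarith)
  have hq : (B - A) / √A ≤ 2.56 * (Real.exp (l / 2) * D) := by
    have h1 : √A = Real.exp (l / 2 - 0.6375 * D) := by
      rw [hA, ← Real.exp_half]; congr 1; ring
    rw [h1, div_le_iff₀ (Real.exp_pos _)]
    refine (exp_sub_exp_le _ _).trans ?_
    have h2 : Real.exp (l / 2) * Real.exp (l / 2 - 0.6375 * D) = Real.exp (l + 1.275 * D) *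
        Real.exp (-(1.9125 * D)) := by
      rw [← Real.exp_add, ← Real.exp_add]; congr 1; ring
    have h3 := Real.add_one_le_exp (-(1.9125 * D))
    calc (l + 1.275 * D - (l - 1.275 * D)) * Real.exp (l + 1.275 * D)
        = 2.55 * D * Real.exp (l + 1.275 * D) := by ring
      _ ≤ 2.56 * D * (Real.exp (l + 1.275 * D) * Real.exp (-(1.9125 * D))) := by
        nlinarith [mul_pos hD (Real.exp_pos (l + 1.275 * D))]
      _ = _ := by rw [← h2]; ring
  have hq0 : 0 ≤ (B - A) / √A := div_nonneg (by linarith) (Real.sqrt_nonneg _)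
  set K := ⌊3 / 2 * l⌋₊ with hK
  let S : ℕ → Finset ℕ := fun k ↦ {m ∈ range (⌊B⌋₊ + 1) | m ^ k ∈ window l D}
  have hS : ∀ k ∈ Icc 2 K, (#(S k) : ℝ) ≤ (B - A) / √A + 1 := by
    intro k hk
    refine card_le_of_forall_sub_le hq0 fun m hm m' hm' hmm ↦ ?_
    have hk2 := (mem_Icc.1 hk).1
    have h1 := (mem_filter.1 hm).2
    have h2 := (mem_filter.1 hm').2
    rw [window, mem_Ioc, Nat.floor_lt hA0.le, Nat.le_floor_iff (Real.exp_pos _).le] at h1 h2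
    push_cast at h1 h2
    refine sub_le_of_pow_mem hk2 ?_ hA0 h1.1.le h2.2 hmm
    rintro rfl
    have h3 := h1.1
    rw [Nat.cast_zero, zero_pow (by omega)] at h3
    linarith
  have hsub : {n ∈ window l D | ¬ Nat.Prime n ∧ IsPrimePow n} ⊆
      (Icc 2 K).biUnion fun k ↦ (S k).image (· ^ k) := by
    intro n hn
    rw [mem_filter] at hn
    obtain ⟨hnw, hnp, hpp⟩ := hn
    obtain ⟨p, k, hp, hk, rfl⟩ := (isPrimePow_nat_iff n).1 hpp
    have hk2 : 2 ≤ k := by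
      by_contra hcon
      have : k = 1 := by omega
      subst this
      rw [pow_one] at hnp
      exact hnp hp
    have hw := mem_window.1 hnw
    have hkK : k ≤ K := by
      rw [hK, Nat.le_floor_iff (by linarith)]
      have h1 : (k : ℝ) * Real.log 2 ≤ l + 1.275 * D := by
        refine le_trans ?_ hw.2.2
        rw [Nat.cast_pow, Real.log_pow]
        have : Real.log 2 ≤ Real.log p :=
          Real.log_le_log (by norm_num) (by exact_mod_cast hp.two_le)
        gcongr
      nlinarith [Real.log_two_gt_d9]
    have hpB : p ≤ ⌊B⌋₊ := (Nat.le_self_pow hk.ne' p).trans (mem_Ioc.1 hnw).2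
    exact mem_biUnion.2 ⟨k, mem_Icc.2 ⟨hk2, hkK⟩, mem_image.2
      ⟨p, mem_filter.2 ⟨mem_range.2 (by omega), hnw⟩, rfl⟩⟩
  have h1 : (#{n ∈ window l D | ¬ Nat.Prime n ∧ IsPrimePow n} : ℝ) ≤
      ∑ k ∈ Icc 2 K, (#(S k) : ℝ) := by
    have h2 := (card_le_card hsub).trans card_biUnion_le
    have h3 : ∑ k ∈ Icc 2 K, #((S k).image (· ^ k)) ≤ ∑ k ∈ Icc 2 K, #(S k) :=
      sum_le_sum fun k _ ↦ card_image_le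
    exact_mod_cast h2.trans h3
  refine h1.trans ((sum_le_sum hS).trans ?_)
  rw [sum_const, nsmul_eq_mul, Nat.card_Icc]
  have h4 : ((K + 1 - 2 : ℕ) : ℝ) ≤ 3 / 2 * l := by
    refine le_trans ?_ (Nat.floor_le (show 0 ≤ 3 / 2 * l by linarith))
    exact_mod_cast (by omega : K + 1 - 2 ≤ K)
  gcongr

lemma vonMangoldt_le_of_not_prime {n : ℕ} (hn : ¬ Nat.Prime n) (h1 : n ≠ 0) :
    vonMangoldt n ≤ Real.log n / 2 := by
  by_cases hpp : IsPrimePow n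
  · obtain ⟨p, k, hp, hk, rfl⟩ := (isPrimePow_nat_iff n).1 hpp
    have hk2 : 2 ≤ k := by
      by_contra hcon
      have : k = 1 := by omega
      subst this
      rw [pow_one] at hn
      exact hn hp
    rw [vonMangoldt_apply_pow hk.ne', vonMangoldt_apply_prime hp, Nat.cast_pow, Real.log_pow]
    have h2 : (2 : ℝ) ≤ k := by exact_mod_cast hk2
    have h3 : 0 ≤ Real.log p := Real.log_natCast_nonneg p
    nlinarith
  · rw [vonMangoldt_apply, if_neg hpp]
    linarith [Real.log_natCast_nonneg n]

end PrimePowers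

section PrimeSum

open Finset ArithmeticFunction

variable {l D : ℝ}

lemma exp_half_ge (hl : 21 ≤ l) : 36000 * (l / 21) ^ 3 ≤ Real.exp (l / 2) := by
  have h1 : (36000 : ℝ) ≤ Real.exp (21 / 2) := by
    have h2 : Real.exp (21 / 2) ^ 2 = Real.exp 1 ^ 21 := by
      rw [← Real.exp_nat_mul, ← Real.exp_nat_mul]; norm_num
    have h3 : (2.718 : ℝ) ^ 21 ≤ Real.exp 1 ^ 21 :=
      pow_le_pow_left₀ (by norm_num) (by linarith [Real.exp_one_gt_d9]) _
    refine le_of_sq_le_sq ?_ (Real.exp_pos _).le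
    rw [h2]
    exact le_trans (by norm_num) h3
  have h2 : (l / 21) ^ 3 ≤ Real.exp ((l - 21) / 2) := by
    have h3 : l / 21 ≤ Real.exp ((l - 21) / 6) := by
      linarith [Real.add_one_le_exp ((l - 21) / 6)]
    calc (l / 21) ^ 3 ≤ Real.exp ((l - 21) / 6) ^ 3 := by gcongr
      _ = _ := by rw [← Real.exp_nat_mul]; congr 1; push_cast; ring
  calc 36000 * (l / 21) ^ 3 ≤ Real.exp (21 / 2) * Real.exp ((l - 21) / 2) := by gcongr
    _ = _ := by rw [← Real.exp_add]; congr 1; ring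

lemma kern_eq_sum_bump (hD : 0 < D) (v : ℝ) : kern ((v - l) / D) =
    ∑ j ∈ range 7, coeffP j / 2 * (bump (9 / 2) D (l + j * (11 / 20 * D)) v +
      bump (9 / 2) D (l - j * (11 / 20 * D)) v) := by
  refine sum_congr rfl fun j _ ↦ ?_
  rw [gs, gs, bump, bump]
  congr 4 <;> · congr 2; field_simp; ring

lemma summable_kern (hD : 0 < D) : Summable fun n : ℕ ↦
    vonMangoldt n * (Real.exp (-(1 / 2) * Real.log n) * kern ((Real.log n - l) / D)) := by
  have h : Summable fun n : ℕ ↦ ∑ j ∈ range 7, (coeffP j / 2 *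
      (vonMangoldt n * (Real.exp (-(1 / 2) * Real.log n) *
        bump (9 / 2) D (l + j * (11 / 20 * D)) (Real.log n))) + coeffP j / 2 *
      (vonMangoldt n * (Real.exp (-(1 / 2) * Real.log n) *
        bump (9 / 2) D (l - j * (11 / 20 * D)) (Real.log n)))) :=
    summable_sum fun j _ ↦ ((summable_prime_bump (by norm_num) hD _).mul_left _).add
      ((summable_prime_bump (by norm_num) hD _).mul_left _)
  refine h.congr fun n ↦ ?_
  rw [kern_eq_sum_bump hD, mul_sum, mul_sum]
  exact sum_congr rfl fun j _ ↦ by ring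

lemma tsum_kern_eq (hD : 0 < D) : ∑' n : ℕ,
    vonMangoldt n * (Real.exp (-(1 / 2) * Real.log n) * kern ((Real.log n - l) / D)) =
    ∑ j ∈ range 7, coeffP j / 2 * (primePart (bump (9 / 2) D (l + j * (11 / 20 * D))) +
      primePart (bump (9 / 2) D (l - j * (11 / 20 * D)))) := by
  have hs := fun β ↦ summable_prime_bump (μ := 9 / 2) (by norm_num) hD β
  simp_rw [mul_add, primePart, ← tsum_mul_left]
  simp_rw [← fun j : ℕ ↦ ((hs (l + j * (11 / 20 * D))).mul_left (coeffP j / 2)).tsum_add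
    ((hs (l - j * (11 / 20 * D))).mul_left (coeffP j / 2))]
  rw [← Summable.tsum_finsetSum fun j _ ↦ ((hs _).mul_left _).add ((hs _).mul_left _)]
  refine tsum_congr fun n ↦ ?_
  rw [kern_eq_sum_bump hD, mul_sum, mul_sum]
  exact sum_congr rfl fun j _ ↦ by ring

/-- The contribution of the primes and prime powers around `exp l`, if there is no prime at
logarithmic distance at most `D` from it. -/
lemma tsum_kern_le (hl : 21 ≤ l) (hD : 0 < D) (hD' : D ≤ 1 / 2000)
    (hr : Real.exp (l / 2) * D ≤ 0.45 * l) (hno : ∀ p : ℕ, p.Prime → D < |Real.log p - l|) :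
    ∑' n : ℕ, vonMangoldt n * (Real.exp (-(1 / 2) * Real.log n) * kern ((Real.log n - l) / D)) ≤
      1.0005 * l * (0.021264 * (Real.exp (l / 2) * D) / (l / 4 - 2.7726) + 0.000745) + 0.27 := by
  set r := Real.exp (l / 2) * D with hr'
  have hr0 : 0 < r := by positivity
  have hw : 0 < l / 4 - 2.7726 := by linarith
  set f : ℕ → ℝ := fun n ↦
    vonMangoldt n * (Real.exp (-(1 / 2) * Real.log n) * kern ((Real.log n - l) / D)) with hf
  have hout : ∀ n ∉ window l D, f n ≤ 0 := by
    intro n hn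
    rcases Nat.eq_zero_or_pos n with rfl | hn0
    · simp [hf]
    refine mul_nonpos_of_nonneg_of_nonpos vonMangoldt_nonneg
      (mul_nonpos_of_nonneg_of_nonpos (Real.exp_pos _).le (kern_nonpos ?_))
    rw [abs_div, abs_of_pos hD, le_div_iff₀ hD, le_abs]
    by_contra! hcon
    exact hn (mem_window.2 ⟨hn0.ne', by linarith, by linarith⟩)
  have h1 : ∑' n, f n ≤ ∑ n ∈ window l D, f n := by
    have h := (summable_kern (l := l) hD).hasSum.neg
    have h2 := sum_le_hasSum (window l D) (fun n hn ↦ neg_nonneg.2 (hout n hn)) h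
    rw [sum_neg_distrib] at h2
    linarith
  set W := Real.exp (-(1 / 2) * (l - 1.275 * D)) with hW
  have hW0 : 0 < W := Real.exp_pos _
  have hWn : ∀ n ∈ window l D, Real.exp (-(1 / 2) * Real.log n) ≤ W := fun n hn ↦
    Real.exp_le_exp.2 (by linarith [(mem_window.1 hn).2.1])
  have hWl : W * Real.exp (l / 2) ≤ 1.0004 := by
    rw [hW, ← Real.exp_add, show -(1 / 2) * (l - 1.275 * D) + l / 2 = 0.6375 * D by ring]
    have h3 := Real.add_one_le_exp (-(0.6375 * D))
    have h4 : Real.exp (-(0.6375 * D)) * Real.exp (0.6375 * D) = 1 := by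
      rw [← Real.exp_add]; simp
    have h5 := mul_le_mul_of_nonneg_right h3 (Real.exp_pos (0.6375 * D)).le
    nlinarith [Real.exp_pos (0.6375 * D)]
  have hprime : ∑ n ∈ window l D with Nat.Prime n, f n ≤
      1.0005 * l * (0.021264 * r / (l / 4 - 2.7726) + 0.000745) := by
    calc ∑ n ∈ window l D with Nat.Prime n, f n
        ≤ ∑ n ∈ window l D with Nat.Prime n,
            (l + 1.275 * D) * W * hinge |(Real.log n - l) / D| := by
          refine sum_le_sum fun p hp ↦ ?_
          rw [mem_filter] at hp
          have h2 := mem_window.1 hp.1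
          have h3 : 1 ≤ |(Real.log p - l) / D| := by
            rw [abs_div, abs_of_pos hD, le_div_iff₀ hD, one_mul]
            exact (hno p hp.2).le
          have h4 := kern_le_hinge h3
          rw [hf]
          dsimp only
          rw [vonMangoldt_apply_prime hp.2, ← mul_assoc]
          calc _ ≤ Real.log p * Real.exp (-(1 / 2) * Real.log p) * hinge |(Real.log p - l) / D| := by
                gcongr
              _ ≤ _ := by
                gcongr
                · exact hinge_nonneg _
                · exact h2.2.2
                · exact hWn p hp.1
      _ = (l + 1.275 * D) * W * ∑ n ∈ window l D with Nat.Prime n,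
            hinge |(Real.log n - l) / D| := by rw [mul_sum]
      _ ≤ (l + 1.275 * D) * W * (2 * (Real.exp l * D * 1.001 / (l / 4 - 2.7726)) * 0.010621 +
            2 * (Real.exp (l / 2) / 256) * 0.09525) := by
          gcongr
          exact sum_hinge_primes_le (by linarith) hD hD' hno
      _ = (l + 1.275 * D) * (W * Real.exp (l / 2)) * (2 * 1.001 * 0.010621 *
            (r / (l / 4 - 2.7726)) + 2 * 0.09525 / 256) := by
          have : Real.exp l = Real.exp (l / 2) * Real.exp (l / 2) := by
            rw [← Real.exp_add]; congr 1; ring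
          rw [this, hr']
          ring
      _ ≤ (l + 1.275 * D) * 1.0004 * (0.021264 * (r / (l / 4 - 2.7726)) + 0.000745) := by
          have : 0 ≤ r / (l / 4 - 2.7726) := by positivity
          gcongr <;> norm_num
      _ ≤ 1.0005 * l * (0.021264 * (r / (l / 4 - 2.7726)) + 0.000745) := by
          have : 0 ≤ r / (l / 4 - 2.7726) := by positivity
          exact mul_le_mul_of_nonneg_right (by linarith) (by positivity)
      _ = _ := by ring
  have hpow : ∑ n ∈ window l D with ¬ Nat.Prime n, f n ≤ 0.27 := by
    calc ∑ n ∈ window l D with ¬ Nat.Prime n, f n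
        = ∑ n ∈ window l D with ¬ Nat.Prime n ∧ IsPrimePow n, f n := by
          rw [← filter_filter]
          refine (sum_subset (filter_subset _ _) fun n hn hn' ↦ ?_).symm
          have : ¬ IsPrimePow n := fun h ↦ hn' (mem_filter.2 ⟨hn, h⟩)
          rw [hf]
          dsimp only
          rw [vonMangoldt_apply, if_neg this, zero_mul]
      _ ≤ ∑ n ∈ window l D with ¬ Nat.Prime n ∧ IsPrimePow n, ((l + 1.275 * D) / 2) * (W * 1.1) := by
          refine sum_le_sum fun n hn ↦ ?_
          rw [mem_filter] at hn
          have h2 := mem_window.1 hn.1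
          have h3 := vonMangoldt_le_of_not_prime hn.2.1 h2.1
          rw [hf]
          dsimp only
          calc _ ≤ vonMangoldt n * (Real.exp (-(1 / 2) * Real.log n) * 1.1) := by
                gcongr
                exact kern_le _
              _ ≤ _ := by
                gcongr
                · linarith [h2.2.2]
                · exact hWn n hn.1
      _ ≤ 3 / 2 * l * (2.56 * r + 1) * (((l + 1.275 * D) / 2) * (W * 1.1)) := by
          rw [sum_const, nsmul_eq_mul]
          gcongr
          exact card_primePow_window_le (by linarith) hD hD'
      _ ≤ 3 / 2 * l * (1.21 * l) * ((1.001 * l / 2) * (W * 1.1)) := by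
          gcongr
          · linarith
          · linarith
      _ ≤ 1.001 * l ^ 3 * W := by
          have : 0 < l ^ 3 * W := by positivity
          linarith
      _ ≤ 0.27 := by
          have h2 := exp_half_ge hl
          have h3 : W * (36000 * (l / 21) ^ 3) ≤ 1.0004 := (mul_le_mul_of_nonneg_left h2 hW0.le).trans hWl
          rw [div_pow] at h3
          norm_num at h3
          linarith
  rw [← sum_filter_add_sum_filter_not (window l D) (fun n ↦ Nat.Prime n)] at h1
  linarith

end PrimeSum

section Contradiction

open Finset

variable {D l : ℝ}

lemma sqrt_pi_div_bounds : 0.8354 ≤ √(π / (9 / 2)) ∧ √(π / (9 / 2)) ≤ 0.8357 := by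
  have h1 := Real.pi_gt_d4
  have h2 := Real.pi_lt_d4
  constructor
  · refine Real.le_sqrt_of_sq_le ?_
    rw [le_div_iff₀ (by norm_num)]
    norm_num at h1 ⊢
    linarith
  · rw [Real.sqrt_le_left (by norm_num), div_le_iff₀ (by norm_num)]
    norm_num at h2 ⊢
    linarith

lemma exp_bump_center (hD : 0 < D) (j : ℝ) :
    Real.exp (-(9 / 2) * (j * (11 / 20 * D) / D) ^ 2) = gs (j * (11 / 20)) := by
  rw [gs, ← mul_assoc, mul_div_assoc, div_self hD.ne', mul_one]

lemma exp_le_one_of_small {t : ℝ} (ht : t ≤ 0.00085) (hD : 0 < D) (hD' : D ≤ 1 / 2000) :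
    Real.exp (t + D ^ 2 / (16 * (9 / 2))) ≤ 1.001 := by
  have h1 : D ^ 2 ≤ 1 / 2000 * (1 / 2000) := by nlinarith
  have h2 : t + D ^ 2 / (16 * (9 / 2)) ≤ 0.0009 := by linarith
  have h3 := Real.exp_bound_div_one_sub_of_interval (x := 0.0009) (by norm_num) (by norm_num)
  exact (Real.exp_le_exp.2 h2).trans (h3.trans (by norm_num))

lemma weilForm_pair_le (hD : 0 < D) (hD' : D ≤ 1 / 2000) {j : ℝ} (h0 : 0 ≤ j) (h6 : j ≤ 6) :
    weilForm (1 / 2) (bump (9 / 2) D (j * (11 / 20 * D))) +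
      weilForm (1 / 2) (bump (9 / 2) D (-(j * (11 / 20 * D)))) ≤
    gs (j * (11 / 20)) * (Real.log (1 / D) - (Real.log π + Real.eulerMascheroniConstant) + 0.5635)
      + 0.001 := by
  have h1 := archPart_pair_le (μ := 9 / 2) (by norm_num) hD (j * (11 / 20 * D))
  rw [exp_bump_center hD] at h1
  have hpole : ∀ t : ℝ, t ≤ 0.0017 → polePart (bump (9 / 2) D t) ≤ 0.0005 := fun t ht ↦ by
    refine (polePart_le (by norm_num) hD t).trans ?_
    have h2 := exp_le_one_of_small (t := t / 2) (by linarith) hD hD'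
    have h3 := sqrt_pi_div_bounds.2
    calc D * √(π / (9 / 2)) * Real.exp (t / 2 + D ^ 2 / (16 * (9 / 2)))
        ≤ 1 / 2000 * 0.8357 * 1.001 := by gcongr
      _ ≤ 0.0005 := by norm_num
  have hj : j * (11 / 20 * D) ≤ 0.0017 := by nlinarith
  have hj' : -(j * (11 / 20 * D)) ≤ 0.0017 := by nlinarith
  have h2 := hpole _ hj
  have h3 := hpole _ hj'
  have h4 := primePart_nonneg (μ := 9 / 2) (D := D) (j * (11 / 20 * D))
  have h5 := primePart_nonneg (μ := 9 / 2) (D := D) (-(j * (11 / 20 * D)))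
  have h6 : 0 ≤ gs (j * (11 / 20)) := (Real.exp_pos _).le
  have h7 : gs (j * (11 / 20)) * (2 * D) ≤ gs (j * (11 / 20)) * 0.001 :=
    mul_le_mul_of_nonneg_left (by linarith) h6
  rw [weilForm_half, weilForm_half]
  linarith

lemma le_weilForm_pair (hD : 0 < D) (hD' : D ≤ 1 / 2000) {j : ℝ} (h0 : 0 ≤ j) (h6 : j ≤ 6) :
    gs (j * (11 / 20)) * (Real.log (1 / D) - (Real.log π + Real.eulerMascheroniConstant)) - 2.74 ≤
    weilForm (1 / 2) (bump (9 / 2) D (j * (11 / 20 * D))) +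
      weilForm (1 / 2) (bump (9 / 2) D (-(j * (11 / 20 * D)))) := by
  have h1 := le_archPart_pair (μ := 9 / 2) (by norm_num) hD (j * (11 / 20 * D))
  rw [exp_bump_center hD] at h1
  have hj : j * (11 / 20 * D) ≤ 3 / 10 := by nlinarith
  have hj' : -(j * (11 / 20 * D)) ≤ 3 / 10 := by nlinarith
  have h2 := primePart_le (μ := 9 / 2) (by norm_num) hD (by linarith) hj
  have h3 := primePart_le (μ := 9 / 2) (by norm_num) hD (by linarith) hj'
  have h4 := polePart_nonneg (μ := 9 / 2) (D := D) (j * (11 / 20 * D))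
  have h5 := polePart_nonneg (μ := 9 / 2) (D := D) (-(j * (11 / 20 * D)))
  have h6 : √(9 / 2) ≤ 2.122 := by
    rw [Real.sqrt_le_left (by norm_num)]; norm_num
  have h7 := sqrt_pi_div_bounds.2
  rw [weilForm_half, weilForm_half]
  linarith

lemma weilForm_far_le (hl : 21 ≤ l) (hD : 0 < D) (hD' : D ≤ 1 / 2000) {t : ℝ}
    (ht : |t| ≤ 0.0017) :
    weilForm (1 / 2) (bump (9 / 2) D (l + t)) + weilForm (1 / 2) (bump (9 / 2) D (-(l + t))) ≤
      1.001 * (√(π / (9 / 2)) * (Real.exp (l / 2) * D)) + 0.012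
        - primePart (bump (9 / 2) D (l + t)) := by
  obtain ⟨ht1, ht2⟩ := abs_le.1 ht
  have h1 := (abs_le.1 (archPart_pair_far (μ := 9 / 2) (by norm_num) (by norm_num) hD
    (by linarith) (β := l + t) (by rw [abs_of_nonneg] <;> linarith))).2
  have h2 : polePart (bump (9 / 2) D (l + t)) ≤
      1.001 * (√(π / (9 / 2)) * (Real.exp (l / 2) * D)) := by
    refine (polePart_le (by norm_num) hD _).trans ?_
    have h3 : (l + t) / 2 + D ^ 2 / (16 * (9 / 2)) = l / 2 + (t / 2 + D ^ 2 / (16 * (9 / 2))) := by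
      ring
    rw [h3, Real.exp_add]
    have h4 := exp_le_one_of_small (t := t / 2) (by linarith) hD hD'
    calc _ ≤ D * √(π / (9 / 2)) * (Real.exp (l / 2) * 1.001) := by gcongr
      _ = _ := by ring
  have h3 : polePart (bump (9 / 2) D (-(l + t))) ≤ 0.001 := by
    refine (polePart_le (by norm_num) hD _).trans ?_
    have h4 := exp_le_one_of_small (t := -(l + t) / 2) (by linarith) hD hD'
    have h5 := sqrt_pi_div_bounds.2
    calc D * √(π / (9 / 2)) * Real.exp (-(l + t) / 2 + D ^ 2 / (16 * (9 / 2)))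
        ≤ 1 / 2000 * 0.8357 * 1.001 := by gcongr
      _ ≤ 0.001 := by norm_num
  have h4 := primePart_nonneg (μ := 9 / 2) (D := D) (-(l + t))
  rw [weilForm_half, weilForm_half]
  linarith

lemma le_weilForm_far (hl : 21 ≤ l) (hD : 0 < D) (hD' : D ≤ 1 / 2000) {t : ℝ}
    (ht : |t| ≤ 0.0017) :
    √(π / (9 / 2)) * (Real.exp (l / 2) * D) * (1 + t / 2) - 0.012
        - primePart (bump (9 / 2) D (l + t)) ≤
    weilForm (1 / 2) (bump (9 / 2) D (l + t)) + weilForm (1 / 2) (bump (9 / 2) D (-(l + t))) := by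
  obtain ⟨ht1, ht2⟩ := abs_le.1 ht
  have h1 := (abs_le.1 (archPart_pair_far (μ := 9 / 2) (by norm_num) (by norm_num) hD
    (by linarith) (β := l + t) (by rw [abs_of_nonneg] <;> linarith))).1
  have h2 : √(π / (9 / 2)) * (Real.exp (l / 2) * D) * (1 + t / 2) - 0.001 ≤
      polePart (bump (9 / 2) D (l + t)) := by
    refine le_trans ?_ (le_polePart (by norm_num) hD (by linarith))
    have h3 : (l + t) / 2 = l / 2 + t / 2 := by ring
    have h4 : 1 + t / 2 ≤ Real.exp (t / 2) := by linarith [Real.add_one_le_exp (t / 2)]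
    have h5 : Real.exp (-(9 / 2) * ((l + t) / D) ^ 2) ≤ 0.0005 := by
      have h6 : 1000 ≤ (l + t) / D := by rw [le_div_iff₀ hD]; linarith
      rw [neg_mul, Real.exp_neg]
      refine inv_le_of_inv_le₀ (by norm_num) ?_
      refine le_trans ?_ (Real.add_one_le_exp _)
      nlinarith
    have h6 : √(π / (9 / 2)) * (Real.exp (l / 2) * D) * (1 + t / 2) ≤
        √(π / (9 / 2)) * (Real.exp (l / 2) * D) * Real.exp (t / 2) := by gcongr
    rw [h3, Real.exp_add]
    linarith
  have h3 := polePart_nonneg (μ := 9 / 2) (D := D) (-(l + t))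
  have h4 := primePart_le (μ := 9 / 2) (by norm_num) hD (by linarith) (β := -(l + t)) (by linarith)
  rw [weilForm_half, weilForm_half]
  linarith

/-- The consequence of positivity under the Riemann hypothesis, with all terms except the
contribution of the primes near `exp l` estimated. -/
lemma pole_le_of_RH (hRH : RiemannHypothesis) (hl : 21 ≤ l) (hD : 0 < D) (hD' : D ≤ 1 / 2000) :
    0.8353 * (Real.exp (l / 2) * D) ≤ 0.655 * (Real.log (1 / D) - 1.5) + 0.65
      + ∑ j ∈ range 7, coeffP j / 2 * (primePart (bump (9 / 2) D (l + j * (11 / 20 * D))) +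
        primePart (bump (9 / 2) D (l - j * (11 / 20 * D)))) := by
  have key := sum_weilForm_bump_nonneg hRH (μ := 9 / 2) (by norm_num) hD 7 coeffP coeffT
    (11 / 20 * D) l abs_sum_coeffP_le
  set M := Real.log (1 / D) - (Real.log π + Real.eulerMascheroniConstant) with hM
  set R := √(π / (9 / 2)) * (Real.exp (l / 2) * D) with hR
  have near_le := fun (j : ℕ) (hj : (j : ℝ) ≤ 6) ↦ weilForm_pair_le hD hD' (Nat.cast_nonneg j) hj
  have le_near := fun (j : ℕ) (hj : (j : ℝ) ≤ 6) ↦ le_weilForm_pair hD hD' (Nat.cast_nonneg j) hj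
  have htj : ∀ j : ℕ, (j : ℝ) ≤ 6 → |(j : ℝ) * (11 / 20 * D)| ≤ 0.0017 := fun j hj ↦ by
    rw [abs_of_nonneg (by positivity)]; nlinarith
  have far_le := fun (j : ℕ) (hj : (j : ℝ) ≤ 6) ↦ weilForm_far_le hl hD hD' (htj j hj)
  have far_le' := fun (j : ℕ) (hj : (j : ℝ) ≤ 6) ↦ weilForm_far_le hl hD hD'
    (t := -(j * (11 / 20 * D))) (by rw [abs_neg]; exact htj j hj)
  have le_far := fun (j : ℕ) (hj : (j : ℝ) ≤ 6) ↦ le_weilForm_far hl hD hD' (htj j hj)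
  have le_far' := fun (j : ℕ) (hj : (j : ℝ) ≤ 6) ↦ le_weilForm_far hl hD hD'
    (t := -(j * (11 / 20 * D))) (by rw [abs_neg]; exact htj j hj)
  simp only [← sub_eq_add_neg] at far_le' le_far'
  have hC := log_pi_add_gamma_bounds
  have hM0 : 0 ≤ M := by
    have h1 : Real.exp 3 ≤ 1 / D := by
      have h2 : (2000 : ℝ) ≤ 1 / D := by rw [le_div_iff₀ hD]; linarith
      have h3 : Real.exp 3 = Real.exp 1 ^ 3 := by rw [← Real.exp_nat_mul]; norm_num
      have h4 : Real.exp 1 ^ 3 ≤ 3 ^ 3 := by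
        gcongr
        exact Real.exp_one_lt_three.le
      linarith
    have h2 := (Real.le_log_iff_exp_le (by positivity)).2 h1
    linarith
  have hg : ∀ {j : ℕ} {b : ℝ}, gs (j * (11 / 20)) ≤ b → gs (j * (11 / 20)) * M ≤ b * M :=
    fun h ↦ mul_le_mul_of_nonneg_right h hM0
  have hg' : ∀ j : ℕ, 0 ≤ gs (j * (11 / 20)) * M :=
    fun j ↦ mul_nonneg (Real.exp_pos _).le hM0
  have g0 : gs ((0 : ℕ) * (11 / 20)) ≤ 1 := by simp [gs]
  have g1 : gs ((1 : ℕ) * (11 / 20)) ≤ 0.25635 :=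
    gs_le_of_sum 10 (y := 1.36125) (by norm_num) (by norm_num)
      (by norm_num [Finset.sum_range_succ, Nat.factorial])
  have g2 : gs ((2 : ℕ) * (11 / 20)) ≤ 0.00435 :=
    gs_le_of_sum 18 (y := 5.445) (by norm_num) (by norm_num)
      (by norm_num [Finset.sum_range_succ, Nat.factorial])
  have g4 : gs ((4 : ℕ) * (11 / 20)) ≤ 0.0001 :=
    gs_le_of_sum 12 (y := 21.78) (by norm_num) (by norm_num)
      (by norm_num [Finset.sum_range_succ, Nat.factorial])
  have g6 : gs ((6 : ℕ) * (11 / 20)) ≤ 0.0001 :=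
    gs_le_of_sum 12 (y := 49.005) (by norm_num) (by norm_num)
      (by norm_num [Finset.sum_range_succ, Nat.factorial])
  have hRlow : 0.8354 * (Real.exp (l / 2) * D) ≤ R :=
    mul_le_mul_of_nonneg_right sqrt_pi_div_bounds.1 (by positivity)
  have hr0 : 0 < Real.exp (l / 2) * D := by positivity
  simp only [Finset.sum_range_succ, Finset.range_zero, Finset.sum_empty, coeffP, coeffT] at key ⊢
  have hMM : M ≤ Real.log (1 / D) - 1.5 := by linarith
  linarith [near_le 0 (by norm_num), near_le 1 (by norm_num), near_le 2 (by norm_num),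
    near_le 4 (by norm_num), near_le 6 (by norm_num), le_near 3 (by norm_num),
    le_near 5 (by norm_num), hg g0, hg g1, hg g2, hg g4, hg g6, hg' 3, hg' 5,
    le_far 0 (by norm_num), le_far 1 (by norm_num), le_far' 0 (by norm_num),
    le_far' 1 (by norm_num), far_le 2 (by norm_num), far_le' 2 (by norm_num)]

/-- Under the Riemann hypothesis there is a prime in a short logarithmic window around `exp l`. -/
theorem exists_prime_log_near (hRH : RiemannHypothesis) (hl : 21 ≤ l) (hD : 0 < D)
    (hD' : D ≤ 1 / 2000) (hr : 0.4398 * l ≤ Real.exp (l / 2) * D)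
    (hr' : Real.exp (l / 2) * D ≤ 0.4402 * l) :
    ∃ p : ℕ, p.Prime ∧ |Real.log p - l| ≤ D := by
  by_contra! hno
  have h1 := pole_le_of_RH hRH hl hD hD'
  have h2 := tsum_kern_le hl hD hD' (by linarith) hno
  rw [tsum_kern_eq hD] at h2
  have hlog : Real.log (1 / D) = l / 2 - Real.log (Real.exp (l / 2) * D) := by
    rw [Real.log_mul (Real.exp_pos _).ne' hD.ne', Real.log_exp, one_div, Real.log_inv]
    ring
  set r := Real.exp (l / 2) * D with hr_def
  have hlogr : 2.1 ≤ Real.log r := by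
    rw [Real.le_log_iff_exp_le (by positivity)]
    have h3 : Real.exp 2.1 = Real.exp 1 ^ 2 * Real.exp 0.1 := by
      rw [← Real.exp_nat_mul, ← Real.exp_add]; norm_num
    have h4 := Real.exp_bound_div_one_sub_of_interval (x := 0.1) (by norm_num) (by norm_num)
    have h5 := Real.exp_one_lt_d9
    have h6 : Real.exp 1 ^ 2 ≤ 2.71829 ^ 2 := by
      gcongr
      linarith
    rw [h3]
    calc Real.exp 1 ^ 2 * Real.exp 0.1 ≤ 2.71829 ^ 2 * (1 / (1 - 0.1)) := by gcongr
      _ ≤ 0.4398 * 21 := by norm_num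
      _ ≤ r := by linarith
  have hfrac : 0.021264 * r / (l / 4 - 2.7726) * l ≤ 0.037443 * (l + 23.51) := by
    rw [div_mul_eq_mul_div, div_le_iff₀ (by linarith)]
    have h3 : 0.021264 * r * l ≤ 0.021264 * (0.4402 * l) * l := by gcongr
    nlinarith
  linarith

end Contradiction

section LargeRange

/-- The gap bound for large `x`. -/
theorem exists_prime_of_exp_le (hRH : RiemannHypothesis) {x : ℝ} (hx : Real.exp 21 ≤ x) :
    ∃ p : ℕ, p.Prime ∧ x ≤ (p : ℝ) ∧ (p : ℝ) ≤ x + 22 / 25 * √x * Real.log x := by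
  have hx0 : 0 < x := (Real.exp_pos _).trans_le hx
  set y := Real.log x with hy
  have hxy : x = Real.exp y := (Real.exp_log hx0).symm
  have hy21 : 21 ≤ y := (Real.le_log_iff_exp_le hx0).2 hx
  have hsq : √x = Real.exp (y / 2) := by rw [hxy, Real.exp_half]
  have hsx : √x * √x = x := Real.mul_self_sqrt hx0.le
  have hs0 : 0 < √x := Real.sqrt_pos.2 hx0
  set δ := 22 / 25 * y / √x with hδ
  have hδ0 : 0 < δ := by positivity
  have hsδ : √x * δ = 0.88 * y := by rw [hδ]; field_simp; ring
  have hδ1 : δ ≤ 0.000515 := by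
    have h1 := exp_half_ge hy21
    rw [hδ, div_le_iff₀ hs0, hsq]
    have h2 : y / 21 ≤ (y / 21) ^ 3 := le_self_pow₀ (by linarith) (by norm_num)
    linarith
  set D := Real.log (1 + δ) / 2 with hD
  have hDle : D ≤ δ / 2 := by
    have := Real.log_le_sub_one_of_pos (show 0 < 1 + δ by linarith)
    linarith
  have hDge : δ / 2 * (1 - δ / 2) ≤ D := by
    have h1 := Real.le_log_one_add_of_nonneg hδ0.le
    have h2 : δ * (1 - δ / 2) ≤ 2 * δ / (δ + 2) := by
      rw [le_div_iff₀ (by linarith)]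
      nlinarith [pow_pos hδ0 3]
    linarith
  have hD0 : 0 < D := lt_of_lt_of_le (by nlinarith) hDge
  have hexp : Real.exp ((y + D) / 2) = √x * Real.exp (D / 2) := by
    rw [hsq, ← Real.exp_add]; congr 1; ring
  obtain ⟨p, hp, hpl⟩ := exists_prime_log_near hRH (l := y + D) (D := D) (by linarith) hD0
    (by linarith) (by
      have h1 : 1 ≤ Real.exp (D / 2) := Real.one_le_exp (by linarith)
      rw [hexp]
      calc 0.4398 * (y + D) ≤ 0.44 * y * (1 - δ / 2) := by nlinarith
        _ = √x * 1 * (δ / 2 * (1 - δ / 2)) := by linear_combination (-(1 / 2) * (1 - δ / 2)) * hsδ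
        _ ≤ √x * Real.exp (D / 2) * D := by gcongr; nlinarith) (by
      have h1 : Real.exp (D / 2) ≤ 1.0003 :=
        (Real.exp_bound_div_one_sub_of_interval (by linarith) (by linarith)).trans (by
          rw [div_le_iff₀ (by linarith)]; linarith)
      rw [hexp]
      calc √x * Real.exp (D / 2) * D ≤ √x * 1.0003 * (δ / 2) := by gcongr
        _ = 1.0003 / 2 * (0.88 * y) := by rw [← hsδ]; ring
        _ ≤ _ := by linarith)
  have hp0 : (0 : ℝ) < p := by exact_mod_cast hp.pos
  obtain ⟨h1, h2⟩ := abs_le.1 hpl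
  refine ⟨p, hp, ?_, ?_⟩
  · exact (Real.log_le_log_iff hx0 hp0).1 (by linarith)
  · have h3 : x + 22 / 25 * √x * y = x * (1 + δ) := by
      linear_combination (-√x) * hsδ + δ * hsx
    rw [h3, ← Real.log_le_log_iff hp0 (by positivity),
      Real.log_mul hx0.ne' (by positivity)]
    linarith

end LargeRange

section Ladder

/-- `force n f` equals `f n`; the recursion on `n` makes the kernel evaluate `n` first. -/
def force {α : Type} (n : ℕ) (f : ℕ → α) : α :=
  Nat.rec (motive := fun _ ↦ α) (f 0) (fun k _ ↦ f (k + 1)) n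

lemma force_eq {α : Type} (n : ℕ) (f : ℕ → α) : force n f = f n := by
  cases n <;> rfl

/-- The product of the `2 ^ k` odd numbers `2 * a + 3, 2 * a + 5, …`. -/
def oddProd (k : ℕ) : ℕ → ℕ :=
  Nat.rec (motive := fun _ ↦ ℕ → ℕ) (fun a ↦ 2 * a + 3)
    (fun k ih a ↦ force (ih a) fun u ↦ force (ih (a + 2 ^ k)) fun v ↦ u * v) k

/-- The first of the numbers `m, m - 2, m - 4, …` coprime to `N`, looking at `fuel` of them. -/
def searchDown (N fuel : ℕ) : ℕ → ℕ :=
  Nat.rec (motive := fun _ ↦ ℕ → ℕ) (fun _ ↦ 0)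
    (fun _ ih m ↦ cond (Nat.beq (Nat.gcd (N % m) m) 1) m (force (m - 2) ih)) fuel

/-- One Newton step for the square root of `n`. -/
def newton (n s : ℕ) : ℕ := (s + n / s) / 2

/-- An odd number close to the end of the interval in which a prime after `n` is sought. -/
def target (n : ℕ) : ℕ :=
  force (Nat.log2 n) fun b ↦
    force (newton n (2 ^ (b / 2))) fun s ↦ force (newton n s) fun s ↦ force (newton n s) fun s ↦
      force (n + 609 * b * s / 1000) fun m ↦ m + m % 2 - 1

/-- Whether `q` is certified to be a prime not far beyond `n`. -/
def admissible (N B n q : ℕ) : Bool :=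
  Nat.ble 2 q && (Nat.beq (q % 2) 1 && (Nat.ble (q + 1) B && (Nat.beq (Nat.gcd (N % q) q) 1 &&
    (Nat.ble n q && Nat.ble (((q - n) * 10000) ^ 2) ((6099 * Nat.log2 n) ^ 2 * n)))))

/-- Move from `n` to a prime beyond `n`, unless `n` has reached `limit`. -/
def step (N B limit n : ℕ) : ℕ :=
  cond (Nat.ble limit n) n
    (force (target n) fun m ↦ force (searchDown N 200 m) fun q ↦ cond (admissible N B n q) q n)

/-- Iterate `step` `2 ^ k` times. -/
def climb (N B limit k : ℕ) : ℕ → ℕ :=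
  Nat.rec (motive := fun _ ↦ ℕ → ℕ) (step N B limit) (fun _ ih n ↦ force (ih n) ih) k

/-- Climb using trial division by the odd numbers up to `2 ^ (k + 1) + 1`. -/
def ascend (k limit j n : ℕ) : ℕ :=
  force (oddProd k 0) fun N ↦ climb N ((2 ^ (k + 1) + 3) ^ 2) limit j n

/-- The gap bound on `[4, n]`. -/
def GapBound (n : ℕ) : Prop :=
  ∀ x : ℝ, 4 ≤ x → x ≤ n →
    ∃ p : ℕ, p.Prime ∧ x ≤ (p : ℝ) ∧ (p : ℝ) ≤ x + 22 / 25 * √x * Real.log x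

lemma dvd_oddProd {k : ℕ} : ∀ {a d : ℕ}, a ≤ d → d < a + 2 ^ k → 2 * d + 3 ∣ oddProd k a := by
  induction k with
  | zero =>
    intro a d h1 h2
    obtain rfl : d = a := by simp at h2; omega
    exact dvd_rfl
  | succ k ih =>
    intro a d h1 h2
    have h : oddProd (k + 1) a = oddProd k a * oddProd k (a + 2 ^ k) := by
      change force (oddProd k a) (fun u ↦ force (oddProd k (a + 2 ^ k)) fun v ↦ u * v) = _
      rw [force_eq, force_eq]
    rw [h]
    rw [pow_succ] at h2
    rcases lt_or_ge d (a + 2 ^ k) with h3 | h3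
    · exact (ih h1 h3).mul_right _
    · exact (ih h3 (by omega)).mul_left _

lemma prime_of_coprime_oddProd {k q : ℕ} (h2 : 2 ≤ q) (hodd : q % 2 = 1)
    (hq : q < (2 ^ (k + 1) + 3) ^ 2) (hg : Nat.gcd (oddProd k 0 % q) q = 1) : q.Prime := by
  by_contra hp
  have h1 := Nat.minFac_sq_le_self (by omega) hp
  have h3 : q.minFac < 2 ^ (k + 1) + 3 := lt_of_pow_lt_pow_left₀ 2 (Nat.zero_le _) (h1.trans_lt hq)
  have h4 : q.minFac.Prime := Nat.minFac_prime (by omega)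
  have h5 : q.minFac % 2 = 1 := by
    rcases h4.eq_two_or_odd with h | h
    · have := h ▸ q.minFac_dvd
      omega
    · exact h
  have h6 := h4.two_le
  rw [pow_succ] at h3
  have h7 := dvd_oddProd (k := k) (a := 0) (d := (q.minFac - 3) / 2) (Nat.zero_le _) (by omega)
  have h8 : 2 * ((q.minFac - 3) / 2) + 3 = q.minFac := by omega
  rw [h8] at h7
  have h9 : q.minFac ∣ Nat.gcd (oddProd k 0 % q) q :=
    Nat.dvd_gcd ((Nat.dvd_mod_iff q.minFac_dvd).2 h7) q.minFac_dvd
  rw [hg] at h9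
  exact h4.one_lt.ne' (Nat.dvd_one.1 h9)

lemma gapBound_of_admissible {k n q : ℕ} (hn : GapBound n) (hn0 : 4 ≤ n)
    (h : admissible (oddProd k 0) ((2 ^ (k + 1) + 3) ^ 2) n q = true) : GapBound q ∧ 4 ≤ q := by
  simp only [admissible, Bool.and_eq_true, Nat.ble_eq, Nat.beq_eq] at h
  obtain ⟨h2, hodd, hB, hg, hnq, hgap⟩ := h
  refine ⟨fun x hx4 hxq ↦ ?_, hn0.trans hnq⟩
  rcases le_total x n with hxn | hxn
  · exact hn x hx4 hxn
  refine ⟨q, prime_of_coprime_oddProd h2 hodd hB hg, hxq, ?_⟩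
  have hn1 : (0 : ℝ) < n := by exact_mod_cast (by omega : 0 < n)
  have hlog : 0.6931 * (Nat.log2 n : ℝ) ≤ Real.log n := by
    have h3 : (2 : ℝ) ^ Nat.log2 n ≤ n := by exact_mod_cast Nat.log2_self_le (by omega)
    have h4 := Real.log_le_log (by positivity) h3
    rw [Real.log_pow] at h4
    have h5 := Real.log_two_gt_d9
    nlinarith [(Nat.cast_nonneg (Nat.log2 n) : (0 : ℝ) ≤ _)]
  have hcast : (((q : ℝ) - n) * 10000) ^ 2 ≤ (6099 * (Nat.log2 n : ℝ) * √n) ^ 2 := by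
    rw [mul_pow _ (√(n : ℝ)), Real.sq_sqrt hn1.le, ← Nat.cast_sub hnq]
    exact_mod_cast hgap
  have h3 : ((q : ℝ) - n) * 10000 ≤ 6099 * (Nat.log2 n : ℝ) * √n :=
    (abs_le_of_sq_le_sq' hcast (by positivity)).2
  have h4 : √(n : ℝ) ≤ √x := Real.sqrt_le_sqrt hxn
  have h5 : Real.log n ≤ Real.log x := Real.log_le_log hn1 hxn
  have h6 : (Nat.log2 n : ℝ) * √n * 0.6931 ≤ Real.log x * √x := by
    calc _ = 0.6931 * (Nat.log2 n : ℝ) * √n := by ring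
      _ ≤ Real.log x * √x := by
        have := hlog.trans h5
        exact mul_le_mul this h4 (by positivity) (le_trans (by positivity) this)
  have h7 : 0 ≤ (Nat.log2 n : ℝ) * √n := by positivity
  linarith

lemma gapBound_step {k limit n : ℕ} (hn : GapBound n ∧ 4 ≤ n) :
    GapBound (step (oddProd k 0) ((2 ^ (k + 1) + 3) ^ 2) limit n) ∧
      4 ≤ step (oddProd k 0) ((2 ^ (k + 1) + 3) ^ 2) limit n := by
  rw [step, force_eq, force_eq]
  cases Nat.ble limit n
  · rw [cond_false]
    cases h : admissible (oddProd k 0) ((2 ^ (k + 1) + 3) ^ 2) n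
      (searchDown (oddProd k 0) 200 (target n))
    · exact hn
    · exact gapBound_of_admissible hn.1 hn.2 h
  · exact hn

lemma gapBound_ascend {k limit j n : ℕ} (hn : GapBound n ∧ 4 ≤ n) :
    GapBound (ascend k limit j n) ∧ 4 ≤ ascend k limit j n := by
  rw [ascend, force_eq]
  induction j generalizing n with
  | zero => exact gapBound_step hn
  | succ j ih =>
    have h : ∀ N B, climb N B limit (j + 1) n = climb N B limit j (climb N B limit j n) :=
      fun N B ↦ force_eq _ _
    rw [h]
    exact ih (ih hn)

/-- The ladder of primes used for the verification below `exp 21`. -/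
def ladderTop : ℕ :=
  force (ascend 2 100 4 11) fun n ↦ force (ascend 5 4000 5 n) fun n ↦
    force (ascend 10 4000000 9 n) fun n ↦ ascend 15 1318815800 13 n

lemma le_ladderTop : 1318815800 ≤ ladderTop := by
  refine Nat.le_of_ble_eq_true ?_
  decide +kernel

lemma gapBound_eleven : GapBound 11 := by
  intro x hx4 hx11
  have hl2 := Real.log_two_gt_d9
  have hlog4 : 1.386 ≤ Real.log 4 := by
    rw [show (4 : ℝ) = 2 ^ 2 by norm_num, Real.log_pow]
    push_cast
    linarith
  have key : ∀ {s t : ℝ}, 0 ≤ s → 0 ≤ t → s ≤ √x → t ≤ Real.log x →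
      22 / 25 * (s * t) ≤ 22 / 25 * √x * Real.log x := fun hs ht h1 h2 ↦ by
    rw [mul_assoc]
    gcongr
  have hs2 : 2 ≤ √x := Real.le_sqrt_of_sq_le (by linarith)
  have hlogx := hlog4.trans (Real.log_le_log (by norm_num) hx4)
  have h1 := key (by norm_num) (by norm_num) hs2 hlogx
  rcases le_or_gt x 5 with hx5 | hx5
  · exact ⟨5, by norm_num, by exact_mod_cast hx5, by push_cast; linarith⟩
  rcases le_or_gt x 7 with hx7 | hx7
  · exact ⟨7, by norm_num, by exact_mod_cast hx7, by push_cast; linarith⟩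
  refine ⟨11, by norm_num, by exact_mod_cast hx11, ?_⟩
  have hs : 2.6 ≤ √x := Real.le_sqrt_of_sq_le (by linarith)
  have hlog7 : 1.9 ≤ Real.log 7 := by
    have h2 : Real.log (2 ^ 14) ≤ Real.log (7 ^ 5) :=
      Real.log_le_log (by norm_num) (by norm_num)
    rw [Real.log_pow, Real.log_pow] at h2
    push_cast at h2
    linarith
  have h2 := key (by norm_num) (by norm_num) hs
    (hlog7.trans (Real.log_le_log (by norm_num) hx7.le))
  push_cast
  linarith

/-- The gap bound below `exp 21`, verified by computation. -/
theorem exists_prime_of_le_exp {x : ℝ} (hx4 : 4 ≤ x) (hx : x ≤ Real.exp 21) :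
    ∃ p : ℕ, p.Prime ∧ x ≤ (p : ℝ) ∧ (p : ℝ) ≤ x + 22 / 25 * √x * Real.log x := by
  have h : GapBound ladderTop := by
    simp only [ladderTop, force_eq]
    exact (gapBound_ascend <| gapBound_ascend <| gapBound_ascend <| gapBound_ascend
      ⟨gapBound_eleven, by norm_num⟩).1
  refine h x hx4 (hx.trans ?_)
  have h1 : Real.exp 21 = Real.exp 1 ^ 21 := by rw [← Real.exp_nat_mul]; norm_num
  have h2 : Real.exp 1 ^ 21 ≤ 2.7182818286 ^ 21 := by
    gcongr
    exact Real.exp_one_lt_d9.le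
  have h3 : (1318815800 : ℝ) ≤ ladderTop := by exact_mod_cast le_ladderTop
  rw [h1]
  refine h2.trans (le_trans ?_ h3)
  norm_num

end Ladder

end PrimeGap

/-- RH implies there is a prime in [x, x + (22/25)√x log x] for all x ≥ 4. -/
theorem prime_in_interval_RH (hRH : RiemannHypothesis) (x : ℝ) (hx : 4 ≤ x) :
    ∃ p : ℕ, p.Prime ∧ x ≤ (p : ℝ) ∧
      (p : ℝ) ≤ x + 22 / 25 * Real.sqrt x * Real.log x := by
  rcases le_total x (Real.exp 21) with h | h
  · exact PrimeGap.exists_prime_of_le_exp hx h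
  · exact PrimeGap.exists_prime_of_exp_le hRH h
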